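/- Let n ≥ 1, 1 < p < ∞ and α ∈ ℝ. There exist constants c, C > 0 (depending only on n, p, α) such that for every Schwartz function f on ℝ^{n+1}: c·‖𝓕⁻¹(m_α·𝓕f)‖_{Lᵖ} ≤ ‖𝓕⁻¹(m_{α−2}·𝓕f)‖_{Lᵖ} + Σ_{k,l=1}^{n} ‖𝓕⁻¹(m_{α−2}·𝓕(∂_{X_k}∂_{X_l}f))‖_{Lᵖ} + ‖𝓕⁻¹(m_{α−2}·𝓕(∂_t f))‖_{Lᵖ} ≤ C·‖𝓕⁻¹(m_α·𝓕f)‖_{Lᵖ}. In particular (α = 2, m_0 = 1), ‖𝓕⁻¹(m_2·𝓕f)‖_{Lᵖ} is comparable to ‖f‖_{Lᵖ} + Σ_{k,l}‖∂_{X_k}∂_{X_l}f‖_{Lᵖ} + ‖∂_t f‖_{Lᵖ}. -/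

import Mathlib

noncomputable section

open MeasureTheory Real Complex
open scoped ENNReal NNReal Real BigOperators

/-- Euclidean space `ℝⁿ`. -/
abbrev Rn (n : ℕ) : Type := EuclideanSpace ℝ (Fin n)

/-- The space `ℝ^{n+1} = ℝⁿ × ℝ`, points written `(X, t)`. -/
abbrev Rn1 (n : ℕ) : Type := EuclideanSpace ℝ (Fin n) × ℝ

/-- Fourier transform on `ℝ^{n+1}`:
`𝓕f(ξ,τ) = ∫ e^{−2πi(X·ξ + tτ)} f(X,t) dX dt`. -/
def FT1 {n : ℕ} (f : Rn1 n → ℂ) (q : Rn1 n) : ℂ :=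
  ∫ p : Rn1 n,
    Complex.exp (-(2 * (π : ℂ) * Complex.I) *
      (((∑ k, p.1 k * q.1 k) + p.2 * q.2 : ℝ) : ℂ)) * f p

/-- Inverse Fourier transform on `ℝ^{n+1}`. -/
def IFT1 {n : ℕ} (f : Rn1 n → ℂ) (x : Rn1 n) : ℂ :=
  ∫ q : Rn1 n,
    Complex.exp ((2 * (π : ℂ) * Complex.I) *
      (((∑ k, q.1 k * x.1 k) + q.2 * x.2 : ℝ) : ℂ)) * f q

/-- The Fourier multiplier operator `f ↦ 𝓕⁻¹(m · 𝓕 f)` on `ℝ^{n+1}`. -/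
def MOp {n : ℕ} (m : Rn1 n → ℂ) (f : Rn1 n → ℂ) : Rn1 n → ℂ :=
  IFT1 (fun q => m q * FT1 f q)

/-- The symbol `m_α(ξ,τ) = (1 + 4π²|ξ|² + iτ)^{α/2}` (principal branch). -/
def mSym {n : ℕ} (α : ℝ) (q : Rn1 n) : ℂ :=
  (1 + 4 * (π : ℂ) ^ 2 * (‖q.1‖ : ℂ) ^ 2 + Complex.I * (q.2 : ℂ)) ^ ((α : ℂ) / 2)

/-- Partial derivative `∂_{X_k}`. -/
def dX {n : ℕ} (k : Fin n) (f : Rn1 n → ℂ) : Rn1 n → ℂ :=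
  fun x => fderiv ℝ f x (EuclideanSpace.single k 1, 0)

/-- Partial derivative `∂_t`. -/
def dT {n : ℕ} (f : Rn1 n → ℂ) : Rn1 n → ℂ :=
  fun x => fderiv ℝ f x (0, 1)

/-- Iterated spatial derivative `D_X^β` for a multi-index `β`. -/
def dXmulti {n : ℕ} (β : Fin n → ℕ) (f : Rn1 n → ℂ) : Rn1 n → ℂ :=
  (List.finRange n).foldr (fun k g => (dX k)^[β k] g) f

/-- The half time-derivative `D_t^{1/2} f = 𝓕⁻¹(|τ|^{1/2}·𝓕f)`. -/
def halfDt {n : ℕ} (f : Rn1 n → ℂ) : Rn1 n → ℂ :=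
  MOp (fun q => ((|q.2| ^ ((1 : ℝ) / 2) : ℝ) : ℂ)) f

/-- The `Lᵖ(ℝ^{n+1})` norm (as a value in `ℝ≥0∞`), `p` a real exponent. -/
def pNorm {n : ℕ} (p : ℝ) (f : Rn1 n → ℂ) : ℝ≥0∞ :=
  eLpNorm f (ENNReal.ofReal p) volume

/-- Multi-indices `β ∈ ℕⁿ` with `|β| = N`. -/
def multiIdx (n N : ℕ) : Finset (Fin n → ℕ) :=
  (Fintype.piFinset fun _ : Fin n => Finset.range (N + 1)).filter fun β => (∑ k, β k) = N

/-- Convolution on `ℝ^{n+1}`. -/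
def conv1 {n : ℕ} (g f : Rn1 n → ℂ) : Rn1 n → ℂ :=
  fun x => ∫ y : Rn1 n, g (x - y) * f y

/-- A parabolic Littlewood–Paley family on `ℝ^{n+1}`. -/
structure ParabolicLP (n : ℕ) where
  φ : SchwartzMap (Rn1 n) ℂ
  ψ : SchwartzMap (Rn1 n) ℂ
  ft_pos : ∀ q : Rn1 n,
    1 / 2 < ‖q.1‖ + |q.2| ^ ((1 : ℝ) / 2) → ‖q.1‖ + |q.2| ^ ((1 : ℝ) / 2) < 2 →
      0 < (FT1 (⇑φ) q).re ∧ (FT1 (⇑φ) q).im = 0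
  ft_supp : ∀ q : Rn1 n,
    ¬(1 / 2 < ‖q.1‖ + |q.2| ^ ((1 : ℝ) / 2) ∧ ‖q.1‖ + |q.2| ^ ((1 : ℝ) / 2) < 2) →
      FT1 (⇑φ) q = 0
  ft_sum : ∀ q : Rn1 n, q ≠ 0 →
    ∑' i : ℤ, FT1 (⇑φ) (((2 : ℝ) ^ (-i)) • q.1, ((2 : ℝ) ^ (-(2 * i))) * q.2) = 1
  ft_psi : ∀ q : Rn1 n,
    FT1 (⇑ψ) q =
      1 - ∑' i : ℕ,
        FT1 (⇑φ) (((2 : ℝ) ^ (-((i : ℤ) + 1))) • q.1, ((2 : ℝ) ^ (-(2 * ((i : ℤ) + 1)))) * q.2)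

/-- The dilate `φ_i`, whose Fourier transform is `𝓕φ(2^{−i}ξ, 2^{−2i}τ)`. -/
def lpPhi {n : ℕ} (P : ParabolicLP n) (i : ℕ) : Rn1 n → ℂ :=
  fun x => (((2 : ℝ) ^ (i * (n + 2)) : ℝ) : ℂ) *
    P.φ (((2 : ℝ) ^ i) • x.1, ((2 : ℝ) ^ (2 * i)) * x.2)

/-- Parabolic Besov norm `N_{s,p}(f)` on `ℝ^{n+1}`, `1 ≤ p < ∞`. -/
def pBesov {n : ℕ} (P : ParabolicLP n) (s p : ℝ) (f : Rn1 n → ℂ) : ℝ≥0∞ :=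
  eLpNorm (conv1 (⇑P.ψ) f) (ENNReal.ofReal p) volume +
  (∑' i : ℕ,
    (ENNReal.ofReal ((2 : ℝ) ^ (s * ((i : ℝ) + 1))) *
      eLpNorm (conv1 (lpPhi P (i + 1)) f) (ENNReal.ofReal p) volume) ^ p) ^ (1 / p)

/-- Parabolic Besov norm `N_{s,∞}(f)` on `ℝ^{n+1}`. -/
def pBesovInf {n : ℕ} (P : ParabolicLP n) (s : ℝ) (f : Rn1 n → ℂ) : ℝ≥0∞ :=
  max (eLpNorm (conv1 (⇑P.ψ) f) ⊤ volume)
    (⨆ i : ℕ, ENNReal.ofReal ((2 : ℝ) ^ (s * ((i : ℝ) + 1))) *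
      eLpNorm (conv1 (lpPhi P (i + 1)) f) ⊤ volume)

/-- The time interval `(0, T)` for `0 < T ≤ ∞`. -/
def tSet (T : ℝ≥0∞) : Set ℝ := {t : ℝ | 0 < t ∧ ENNReal.ofReal t < T}

/-- Lebesgue measure restricted to the strip `ℝⁿ × (0,T)`. -/
def stripMeasure (n : ℕ) (T : ℝ≥0∞) : Measure (Rn1 n) :=
  volume.restrict {x : Rn1 n | x.2 ∈ tSet T}

/-- The parabolic Sobolev norm `‖g‖_{W^{2i,i}_p(ℝⁿ_T)}`. -/
def wNorm {n : ℕ} (i : ℕ) (p : ℝ) (T : ℝ≥0∞) (g : Rn1 n → ℂ) : ℝ≥0∞ :=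
  ∑ l ∈ Finset.range (i + 1),
    ∑ β ∈ (Fintype.piFinset fun _ : Fin n => Finset.range (2 * i + 1)).filter
        (fun β => (∑ k, β k) + 2 * l ≤ 2 * i),
      eLpNorm (dXmulti β (dT^[l] g)) (ENNReal.ofReal p) (stripMeasure n T)

/-- Time-regularity seminorm `[g]_{t,β,p,T}`. -/
def semT {n : ℕ} (b p : ℝ) (T : ℝ≥0∞) (g : Rn1 n → ℂ) : ℝ≥0∞ :=
  (∫⁻ X : Rn n, ∫⁻ t in tSet T, ∫⁻ s in tSet T,
      ENNReal.ofReal (‖g (X, t) - g (X, s)‖ ^ p / |t - s| ^ (1 + p * b / 2))) ^ (1 / p)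

/-- Space-regularity seminorm `[g]_{x,β,p,T}`. -/
def semX {n : ℕ} (b p : ℝ) (T : ℝ≥0∞) (g : Rn1 n → ℂ) : ℝ≥0∞ :=
  (∫⁻ t in tSet T, ∫⁻ X : Rn n, ∫⁻ Y : Rn n,
      ENNReal.ofReal (‖g (X + Y, t) - 2 * g (X, t) + g (X - Y, t)‖ ^ p /
        ‖Y‖ ^ ((n : ℝ) + p * b))) ^ (1 / p)

/-- The parabolic Besov norm `‖g‖_{B^{α,α/2}_p(ℝⁿ_T)}`, formed with index `i` where
`2i < α < 2i+2`. -/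
def pbNorm {n : ℕ} (i : ℕ) (α p : ℝ) (T : ℝ≥0∞) (g : Rn1 n → ℂ) : ℝ≥0∞ :=
  wNorm i p T g +
  ∑ l ∈ Finset.range (i + 1),
    ∑ β ∈ (Fintype.piFinset fun _ : Fin n => Finset.range (2 * i + 1)).filter
        (fun β => (∑ k, β k) + 2 * l = 2 * i),
      (semT (α - 2 * i) p T (dXmulti β (dT^[l] g)) +
        semX (α - 2 * i) p T (dXmulti β (dT^[l] g)))

/-- Fourier transform on `ℝⁿ`. -/
def FTn {n : ℕ} (f : Rn n → ℂ) (ξ : Rn n) : ℂ :=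
  ∫ x : Rn n, Complex.exp (-(2 * (π : ℂ) * Complex.I) * (((∑ k, x k * ξ k : ℝ)) : ℂ)) * f x

/-- Inverse Fourier transform on `ℝⁿ`. -/
def IFTn {n : ℕ} (f : Rn n → ℂ) (x : Rn n) : ℂ :=
  ∫ ξ : Rn n, Complex.exp ((2 * (π : ℂ) * Complex.I) * (((∑ k, ξ k * x k : ℝ)) : ℂ)) * f ξ

/-- Convolution on `ℝⁿ`. -/
def convn {n : ℕ} (g f : Rn n → ℂ) : Rn n → ℂ := fun x => ∫ y : Rn n, g (x - y) * f y

/-- A Littlewood–Paley family on `ℝⁿ`. -/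
structure LPFamily (n : ℕ) where
  φ : SchwartzMap (Rn n) ℂ
  ψ : SchwartzMap (Rn n) ℂ
  ft_pos : ∀ ξ : Rn n, 1 / 2 < ‖ξ‖ → ‖ξ‖ < 2 →
    0 < (FTn (⇑φ) ξ).re ∧ (FTn (⇑φ) ξ).im = 0
  ft_supp : ∀ ξ : Rn n, ¬(1 / 2 < ‖ξ‖ ∧ ‖ξ‖ < 2) → FTn (⇑φ) ξ = 0
  ft_sum : ∀ ξ : Rn n, ξ ≠ 0 → ∑' i : ℤ, FTn (⇑φ) (((2 : ℝ) ^ (-i)) • ξ) = 1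
  ft_psi : ∀ ξ : Rn n,
    FTn (⇑ψ) ξ = 1 - ∑' i : ℕ, FTn (⇑φ) (((2 : ℝ) ^ (-((i : ℤ) + 1))) • ξ)

/-- The dilate `φ′_i(x) = 2^{in} φ′(2^i x)`. -/
def lpPhin {n : ℕ} (P : LPFamily n) (i : ℕ) : Rn n → ℂ :=
  fun x => (((2 : ℝ) ^ (i * n) : ℝ) : ℂ) * P.φ (((2 : ℝ) ^ i) • x)

/-- Besov norm `B_{s,p}(f)` on `ℝⁿ`, `1 ≤ p < ∞`. -/
def besovN {n : ℕ} (P : LPFamily n) (s p : ℝ) (f : Rn n → ℂ) : ℝ≥0∞ :=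
  eLpNorm (convn (⇑P.ψ) f) (ENNReal.ofReal p) volume +
  (∑' i : ℕ,
    (ENNReal.ofReal ((2 : ℝ) ^ (s * ((i : ℝ) + 1))) *
      eLpNorm (convn (lpPhin P (i + 1)) f) (ENNReal.ofReal p) volume) ^ p) ^ (1 / p)

/-- The heat kernel `Γ(X,t)` on `ℝⁿ` (zero for `t ≤ 0`). -/
def heatKer (n : ℕ) (X : Rn n) (t : ℝ) : ℝ :=
  if 0 < t then (4 * π * t) ^ (-(n : ℝ) / 2) * Real.exp (-‖X‖ ^ 2 / (4 * t)) else 0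

/-- The heat extension `u(X,t) = ∫ Γ(X−Y,t) f(Y) dY`. -/
def heatExt {n : ℕ} (f : Rn n → ℂ) : Rn1 n → ℂ :=
  fun x => ∫ Y : Rn n, (heatKer n (x.1 - Y) x.2 : ℂ) * f Y

set_option linter.unusedSectionVars false
set_option linter.style.haveILetI false

section CalderonZygmund

variable {E : Type*} [NormedAddCommGroup E] [MeasureSpace E] [BorelSpace E]
  [SecondCountableTopology E] [SigmaFinite (volume : Measure E)]

/-- Convolution of the kernel `K` with `f`. -/
def kconv (K f : E → ℂ) (x : E) : ℂ := ∫ y, K (x - y) * f y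

/-- A Calderón–Zygmund cover of the function `f` at height `lam`: the selected cubes are the
fibers of `κ` over `some c`; `star c` is the dilated cube, `y₀ c` the base point of the cube, and
the kernel `K` satisfies Hörmander's condition relative to these. -/
structure IsCZCover (K f : E → ℂ) (lam D D' A : ℝ≥0∞) {ι : Type*} (κ : E → Option ι)
    (star : ι → Set E) (y₀ : ι → E) : Prop where
  meas : ∀ o, MeasurableSet (κ ⁻¹' {o})
  lower : ∀ c, lam * volume (κ ⁻¹' {some c}) ≤ ∫⁻ x in κ ⁻¹' {some c}, ‖f x‖ₑ
  upper : ∀ c, ∫⁻ x in κ ⁻¹' {some c}, ‖f x‖ₑ ≤ D * lam * volume (κ ⁻¹' {some c})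
  good : ∀ x, κ x = none → ‖f x‖ₑ ≤ lam
  star_volume : ∀ c, volume (star c) ≤ D' * volume (κ ⁻¹' {some c})
  hormander : ∀ c, ∀ y ∈ κ ⁻¹' {some c},
    ∫⁻ x in (star c)ᶜ, ‖K (x - y) - K (x - y₀ c)‖ₑ ≤ A

open Classical in
/-- The good part of `f`: `f` itself outside the cubes, the average of `f` on each cube. -/
def goodPart {ι : Type*} (f : E → ℂ) (κ : E → Option ι) (x : E) : ℂ :=
  if κ x = none then f x else ⨍ y in κ ⁻¹' {κ x}, f y

namespace IsCZCover

variable {K f : E → ℂ} {lam D D' A : ℝ≥0∞} {ι : Type*} [Countable ι] {κ : E → Option ι}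
    {star : ι → Set E} {y₀ : ι → E}

lemma iUnion_fibers (κ : E → Option ι) :
    ⋃ c, κ ⁻¹' {some c} = (κ ⁻¹' {none})ᶜ := by
  ext x
  simp only [Set.mem_iUnion, Set.mem_preimage, Set.mem_singleton_iff, Set.mem_compl_iff]
  cases κ x <;> simp

lemma pairwise_disjoint_fibers (κ : E → Option ι) :
    Pairwise (Function.onFun Disjoint fun c => κ ⁻¹' {some c}) := by
  intro a b hab
  refine Set.disjoint_left.2 fun x hx hx' => hab ?_
  simpa using (hx.symm.trans hx' : some a = some b)

lemma lintegral_compl_none (h : IsCZCover K f lam D D' A κ star y₀) (g : E → ℝ≥0∞) :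
    ∫⁻ x in (κ ⁻¹' {none})ᶜ, g x = ∑' c, ∫⁻ x in κ ⁻¹' {some c}, g x := by
  rw [← iUnion_fibers, lintegral_iUnion (fun c => h.meas _) (pairwise_disjoint_fibers κ)]

lemma volume_compl_none (h : IsCZCover K f lam D D' A κ star y₀) :
    volume (κ ⁻¹' {none})ᶜ = ∑' c, volume (κ ⁻¹' {some c}) := by
  rw [← iUnion_fibers, measure_iUnion (pairwise_disjoint_fibers κ) (fun c => h.meas _)]

lemma measurable_goodPart (h : IsCZCover K f lam D D' A κ star y₀) (hf : Measurable f) :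
    Measurable (goodPart f κ) := by
  classical
  let : MeasurableSpace (Option ι) := ⊤
  have hκ : Measurable κ := measurable_to_countable' h.meas
  refine Measurable.ite (h.meas none) hf ?_
  exact (measurable_from_top (f := fun o => ⨍ y in κ ⁻¹' {o}, f y)).comp hκ

lemma goodPart_of_none {x : E} (hx : κ x = none) : goodPart f κ x = f x := by
  simp [goodPart, hx]

lemma goodPart_of_some {x : E} {c : ι} (hx : κ x = some c) :
    goodPart f κ x = ⨍ y in κ ⁻¹' {some c}, f y := by
  simp [goodPart, hx]

lemma volume_ne_top (h : IsCZCover K f lam D D' A κ star y₀) (hf : Integrable f)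
    (hlam : lam ≠ 0) (c : ι) : volume (κ ⁻¹' {some c}) ≠ ⊤ := by
  intro htop
  have h1 := h.lower c
  rw [htop, ENNReal.mul_top hlam, top_le_iff] at h1
  exact (hf.integrableOn (s := κ ⁻¹' {some c})).hasFiniteIntegral.ne h1

lemma enorm_average_mul_le (f : E → ℂ) (s : Set E) (hs : volume s ≠ ⊤) :
    ‖⨍ y in s, f y‖ₑ * volume s ≤ ∫⁻ y in s, ‖f y‖ₑ := by
  have : IsFiniteMeasure (volume.restrict s) := ⟨by simpa using hs.lt_top⟩
  have h1 : ‖⨍ y in s, f y‖ₑ * volume s = ‖∫ y in s, f y‖ₑ := by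
    have h2 := measure_smul_average (volume.restrict s) f
    rw [← h2, enorm_smul, mul_comm, measureReal_restrict_apply_univ]
    congr 1
    rw [Real.enorm_of_nonneg measureReal_nonneg, ofReal_measureReal hs]
  rw [h1]
  exact enorm_integral_le_lintegral_enorm _

lemma enorm_average_le (h : IsCZCover K f lam D D' A κ star y₀) (hf : Integrable f)
    (hlam : lam ≠ 0) (c : ι) : ‖⨍ y in κ ⁻¹' {some c}, f y‖ₑ ≤ D * lam := by
  have hV := h.volume_ne_top hf hlam c
  by_cases h0 : volume (κ ⁻¹' {some c}) = 0
  · have : volume.restrict (κ ⁻¹' {some c}) = 0 := by simpa using h0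
    simp [this]
  · have := (enorm_average_mul_le f _ hV).trans (h.upper c)
    exact (ENNReal.mul_le_mul_iff_left h0 hV).1 this

lemma lintegral_goodPart_le (h : IsCZCover K f lam D D' A κ star y₀) (hf : Integrable f)
    (hlam : lam ≠ 0) (c : ι) :
    ∫⁻ x in κ ⁻¹' {some c}, ‖goodPart f κ x‖ₑ ≤ ∫⁻ x in κ ⁻¹' {some c}, ‖f x‖ₑ := by
  have : ∫⁻ x in κ ⁻¹' {some c}, ‖goodPart f κ x‖ₑ =
      ‖⨍ y in κ ⁻¹' {some c}, f y‖ₑ * volume (κ ⁻¹' {some c}) := by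
    rw [← setLIntegral_const]
    refine setLIntegral_congr_fun (h.meas _) fun x hx => ?_
    rw [goodPart_of_some hx]
  rw [this]
  exact enorm_average_mul_le f _ (h.volume_ne_top hf hlam c)

lemma integrable_goodPart (h : IsCZCover K f lam D D' A κ star y₀) (hfm : Measurable f)
    (hf : Integrable f) (hlam : lam ≠ 0) : Integrable (goodPart f κ) := by
  refine ⟨(h.measurable_goodPart hfm).aestronglyMeasurable, ?_⟩
  have hle : ∫⁻ x, ‖goodPart f κ x‖ₑ ≤ ∫⁻ x, ‖f x‖ₑ := by
    rw [← lintegral_add_compl _ (h.meas none),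
      ← lintegral_add_compl (fun x => ‖f x‖ₑ) (h.meas none)]
    refine add_le_add (le_of_eq ?_) ?_
    · refine setLIntegral_congr_fun (h.meas _) fun x hx => ?_
      rw [goodPart_of_none hx]
    · rw [h.lintegral_compl_none, h.lintegral_compl_none]
      exact ENNReal.tsum_le_tsum fun c => h.lintegral_goodPart_le hf hlam c
  exact hle.trans_lt hf.hasFiniteIntegral

lemma enorm_goodPart_le (h : IsCZCover K f lam D D' A κ star y₀) (hf : Integrable f)
    (hlam : lam ≠ 0) (x : E) : ‖goodPart f κ x‖ₑ ≤ lam + D * lam := by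
  cases hx : κ x with
  | none => rw [goodPart_of_none hx]; exact (h.good x hx).trans le_self_add
  | some c => rw [goodPart_of_some hx]; exact (h.enorm_average_le hf hlam c).trans le_add_self

lemma lintegral_goodPart_sq_le (h : IsCZCover K f lam D D' A κ star y₀)
    (hf : Integrable f) (hlam : lam ≠ 0) :
    ∫⁻ x, ‖goodPart f κ x‖ₑ ^ 2 ≤
      (∫⁻ x in {x | ‖f x‖ₑ ≤ lam}, ‖f x‖ₑ ^ 2) + (D * lam) ^ 2 * volume (κ ⁻¹' {none})ᶜ := by
  rw [← lintegral_add_compl _ (h.meas none)]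
  refine add_le_add ?_ ?_
  · calc ∫⁻ x in κ ⁻¹' {none}, ‖goodPart f κ x‖ₑ ^ 2
        = ∫⁻ x in κ ⁻¹' {none}, ‖f x‖ₑ ^ 2 := by
          refine setLIntegral_congr_fun (h.meas _) fun x hx => ?_
          rw [goodPart_of_none hx]
      _ ≤ _ := lintegral_mono_set fun x hx => h.good x hx
  · rw [← setLIntegral_const]
    refine setLIntegral_mono' (h.meas none).compl fun x hx => ?_
    gcongr
    cases hx' : κ x with
    | none => exact absurd hx' hx
    | some c => rw [goodPart_of_some hx']; exact h.enorm_average_le hf hlam c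

lemma setIntegral_sub_goodPart (h : IsCZCover K f lam D D' A κ star y₀)
    (hf : Integrable f) (hlam : lam ≠ 0) (c : ι) :
    ∫ x in κ ⁻¹' {some c}, (f x - goodPart f κ x) = 0 := by
  have hV := h.volume_ne_top hf hlam c
  have : IsFiniteMeasure (volume.restrict (κ ⁻¹' {some c})) := ⟨by simpa using hV.lt_top⟩
  have h1 : ∫ x in κ ⁻¹' {some c}, (f x - goodPart f κ x) =
      ∫ x in κ ⁻¹' {some c}, (f x - ⨍ y in κ ⁻¹' {some c}, f y) := by
    refine setIntegral_congr_fun (h.meas _) fun x hx => ?_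
    rw [goodPart_of_some hx]
  rw [h1, integral_sub hf.integrableOn (integrable_const _), integral_average, sub_self]

end IsCZCover
end CalderonZygmund

section CalderonZygmund

variable {E : Type*} [NormedAddCommGroup E] [MeasureSpace E] [BorelSpace E]
  [SecondCountableTopology E] [SigmaFinite (volume : Measure E)]

lemma integrable_kernel_mul {K f : E → ℂ} (hK : Continuous K) {M : ℝ} (hM : ∀ x, ‖K x‖ ≤ M)
    (hf : Integrable f) (x : E) : Integrable (fun y => K (x - y) * f y) := by
  refine hf.bdd_mul (c := M) ?_ (Filter.Eventually.of_forall fun y => hM _)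
  exact (hK.comp (continuous_const.sub continuous_id)).aestronglyMeasurable

lemma measurable_kconv {K f : E → ℂ} (hK : Continuous K) (hf : Measurable f) :
    Measurable (kconv K f) := by
  have : StronglyMeasurable (Function.uncurry fun x y => K (x - y) * f y) := by
    refine Measurable.stronglyMeasurable ?_
    exact (hK.measurable.comp (measurable_fst.sub measurable_snd)).mul (hf.comp measurable_snd)
  exact this.integral_prod_right.measurable

namespace IsCZCover

variable {K f : E → ℂ} {lam D D' A : ℝ≥0∞} {ι : Type*} [Countable ι] {κ : E → Option ι}
    {star : ι → Set E} {y₀ : ι → E}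

lemma enorm_kconv_bad_le (h : IsCZCover K f lam D D' A κ star y₀) (hK : Continuous K) {M : ℝ}
    (hM : ∀ x, ‖K x‖ ≤ M) (hfm : Measurable f) (hf : Integrable f) (hlam : lam ≠ 0) (x : E) :
    ‖kconv K (fun y => f y - goodPart f κ y) x‖ₑ ≤
      ∑' c, ∫⁻ y in κ ⁻¹' {some c}, ‖K (x - y) - K (x - y₀ c)‖ₑ * ‖f y - goodPart f κ y‖ₑ := by
  have hb : Integrable (fun y => f y - goodPart f κ y) :=
    hf.sub (h.integrable_goodPart hfm hf hlam)
  have hi := integrable_kernel_mul hK hM hb x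
  have h1 : kconv K (fun y => f y - goodPart f κ y) x =
      ∫ y in ⋃ c, κ ⁻¹' {some c}, K (x - y) * (f y - goodPart f κ y) := by
    rw [kconv, setIntegral_eq_integral_of_forall_compl_eq_zero]
    intro y hy
    rw [iUnion_fibers, Set.mem_compl_iff, not_not] at hy
    rw [goodPart_of_none hy, sub_self, mul_zero]
  rw [h1, integral_iUnion (fun c => h.meas _) (pairwise_disjoint_fibers κ) hi.integrableOn]
  refine enorm_tsum_le_tsum_enorm.trans (ENNReal.tsum_le_tsum fun c => ?_)
  have h2 : ∫ y in κ ⁻¹' {some c}, K (x - y) * (f y - goodPart f κ y) =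
      ∫ y in κ ⁻¹' {some c}, (K (x - y) - K (x - y₀ c)) * (f y - goodPart f κ y) := by
    simp_rw [sub_mul]
    rw [integral_sub hi.integrableOn (hb.integrableOn.const_mul _), integral_const_mul,
      h.setIntegral_sub_goodPart hf hlam c, mul_zero, sub_zero]
  rw [h2]
  refine (enorm_integral_le_lintegral_enorm _).trans (le_of_eq ?_)
  simp_rw [enorm_mul]

lemma lintegral_kconv_bad_le (h : IsCZCover K f lam D D' A κ star y₀) (hK : Continuous K) {M : ℝ}
    (hM : ∀ x, ‖K x‖ ≤ M) (hfm : Measurable f) (hf : Integrable f) (hlam : lam ≠ 0) :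
    ∫⁻ x in (⋃ c, star c)ᶜ, ‖kconv K (fun y => f y - goodPart f κ y) x‖ₑ ≤
      2 * A * D * lam * volume (κ ⁻¹' {none})ᶜ := by
  have hgm := h.measurable_goodPart hfm
  calc ∫⁻ x in (⋃ c, star c)ᶜ, ‖kconv K (fun y => f y - goodPart f κ y) x‖ₑ
      ≤ ∫⁻ x in (⋃ c, star c)ᶜ, ∑' c, ∫⁻ y in κ ⁻¹' {some c},
          ‖K (x - y) - K (x - y₀ c)‖ₑ * ‖f y - goodPart f κ y‖ₑ :=
        lintegral_mono fun x => h.enorm_kconv_bad_le hK hM hfm hf hlam x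
    _ = ∑' c, ∫⁻ x in (⋃ c, star c)ᶜ, ∫⁻ y in κ ⁻¹' {some c},
          ‖K (x - y) - K (x - y₀ c)‖ₑ * ‖f y - goodPart f κ y‖ₑ := by
        refine lintegral_tsum fun c => Measurable.aemeasurable ?_
        refine Measurable.lintegral_prod_right' (f := fun z : E × E =>
          ‖K (z.1 - z.2) - K (z.1 - y₀ c)‖ₑ * ‖f z.2 - goodPart f κ z.2‖ₑ) ?_
        have := hK.measurable
        fun_prop
    _ ≤ ∑' c, (2 * A * D * lam) * volume (κ ⁻¹' {some c}) := by
        refine ENNReal.tsum_le_tsum fun c => ?_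
        have hmeas : AEMeasurable (Function.uncurry fun x y =>
            ‖K (x - y) - K (x - y₀ c)‖ₑ * ‖f y - goodPart f κ y‖ₑ)
            ((volume.restrict (⋃ c, star c)ᶜ).prod (volume.restrict (κ ⁻¹' {some c}))) := by
          have := hK.measurable
          refine Measurable.aemeasurable ?_
          unfold Function.uncurry
          fun_prop
        rw [lintegral_lintegral_swap hmeas]
        calc ∫⁻ y in κ ⁻¹' {some c}, ∫⁻ x in (⋃ c, star c)ᶜ,
              ‖K (x - y) - K (x - y₀ c)‖ₑ * ‖f y - goodPart f κ y‖ₑ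
            ≤ ∫⁻ y in κ ⁻¹' {some c}, A * (‖f y‖ₑ + ‖goodPart f κ y‖ₑ) := by
              refine setLIntegral_mono' (h.meas _) fun y hy => ?_
              rw [lintegral_mul_const]
              · refine mul_le_mul' ?_ (by simpa using enorm_sub_le (E := ℂ))
                refine (lintegral_mono_set ?_).trans (h.hormander c y hy)
                exact Set.compl_subset_compl.2 (Set.subset_iUnion star c)
              · have := hK.measurable
                fun_prop
          _ = A * ((∫⁻ y in κ ⁻¹' {some c}, ‖f y‖ₑ) +
                ∫⁻ y in κ ⁻¹' {some c}, ‖goodPart f κ y‖ₑ) := by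
              rw [lintegral_const_mul, lintegral_add_left] <;> fun_prop
          _ ≤ A * (D * lam * volume (κ ⁻¹' {some c}) + D * lam * volume (κ ⁻¹' {some c})) := by
              gcongr
              · exact h.upper c
              · exact (h.lintegral_goodPart_le hf hlam c).trans (h.upper c)
          _ = _ := by ring
    _ = _ := by rw [ENNReal.tsum_mul_left, h.volume_compl_none]

theorem volume_superlevel_le (h : IsCZCover K f lam D D' A κ star y₀) (hK : Continuous K) {M : ℝ}
    (hM : ∀ x, ‖K x‖ ≤ M) (hfm : Measurable f) (hf : Integrable f) (hlam : lam ≠ 0)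
    (hlam' : lam ≠ ⊤) (hD : D ≠ ⊤) {B : ℝ≥0∞}
    (hL2 : ∀ g : E → ℂ, Measurable g → Integrable g → (∃ R : ℝ, ∀ x, ‖g x‖ ≤ R) →
      ∫⁻ x, ‖kconv K g x‖ₑ ^ 2 ≤ B * ∫⁻ x, ‖g x‖ₑ ^ 2) :
    volume {x | lam < ‖kconv K f x‖ₑ} ≤
      (D' + 4 * A * D + 4 * B * D ^ 2) * volume (κ ⁻¹' {none})ᶜ +
        4 * B * (lam ^ 2)⁻¹ * ∫⁻ x in {x | ‖f x‖ₑ ≤ lam}, ‖f x‖ₑ ^ 2 := by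
  have hgm := h.measurable_goodPart hfm
  have hgi := h.integrable_goodPart hfm hf hlam
  set g := goodPart f κ with hg
  set b := fun y => f y - g y with hb
  set Ω := (κ ⁻¹' {none})ᶜ
  have hTb : Measurable (kconv K b) := measurable_kconv hK (hfm.sub hgm)
  have hTg : Measurable (kconv K g) := measurable_kconv hK hgm
  have hsum : ∀ x, kconv K f x = kconv K b x + kconv K g x := by
    intro x
    have hbi : Integrable b := hf.sub hgi
    rw [kconv, kconv, kconv, ← integral_add (integrable_kernel_mul hK hM hbi x)
      (integrable_kernel_mul hK hM hgi x)]
    congr 1; ext y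
    simp only [hb]; ring
  have hsub : {x | lam < ‖kconv K f x‖ₑ} ⊆ (⋃ c, star c) ∪
      ({x | lam / 2 ≤ ‖kconv K b x‖ₑ} ∩ (⋃ c, star c)ᶜ) ∪ {x | lam / 2 ≤ ‖kconv K g x‖ₑ} := by
    intro x hx
    by_contra hcon
    simp only [Set.mem_union, Set.mem_inter_iff, Set.mem_ofPred_eq, Set.mem_compl_iff, not_or,
      not_and, not_not] at hcon
    obtain ⟨⟨h1, h2⟩, h3⟩ := hcon
    have h2' : ‖kconv K b x‖ₑ < lam / 2 := by
      by_contra hc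
      exact h1 (h2 (not_lt.1 hc))
    have : ‖kconv K f x‖ₑ < lam := by
      rw [hsum]
      calc ‖kconv K b x + kconv K g x‖ₑ ≤ ‖kconv K b x‖ₑ + ‖kconv K g x‖ₑ := enorm_add_le _ _
        _ < lam / 2 + lam / 2 := ENNReal.add_lt_add h2' (not_le.1 h3)
        _ = lam := ENNReal.add_halves lam
    exact lt_asymm this hx
  have e1 : volume (⋃ c, star c) ≤ D' * volume Ω := by
    rw [h.volume_compl_none, ← ENNReal.tsum_mul_left]
    exact (measure_iUnion_le _).trans (ENNReal.tsum_le_tsum fun c => h.star_volume c)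
  have e2 : volume ({x | lam / 2 ≤ ‖kconv K b x‖ₑ} ∩ (⋃ c, star c)ᶜ) ≤ 4 * A * D * volume Ω := by
    have h1 := (mul_meas_ge_le_lintegral (μ := volume.restrict (⋃ c, star c)ᶜ)
      hTb.enorm (lam / 2)).trans (h.lintegral_kconv_bad_le hK hM hfm hf hlam)
    rw [Measure.restrict_apply (measurableSet_le measurable_const hTb.enorm)] at h1
    refine (ENNReal.mul_le_mul_iff_right (a := lam / 2) ?_ ?_).1 (h1.trans (le_of_eq ?_))
    · simpa using hlam
    · exact ENNReal.div_ne_top hlam' (by simp)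
    · have : lam = 2 * (lam / 2) := (ENNReal.mul_div_cancel (by simp) (by simp)).symm
      conv_lhs => rw [this]
      ring
  have e3 : volume {x | lam / 2 ≤ ‖kconv K g x‖ₑ} ≤
      4 * B * (lam ^ 2)⁻¹ * ((∫⁻ x in {x | ‖f x‖ₑ ≤ lam}, ‖f x‖ₑ ^ 2) +
        (D * lam) ^ 2 * volume Ω) := by
    have h0 : ∫⁻ x, ‖kconv K g x‖ₑ ^ 2 ≤ B * ((∫⁻ x in {x | ‖f x‖ₑ ≤ lam}, ‖f x‖ₑ ^ 2) +
        (D * lam) ^ 2 * volume Ω) := by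
      refine (hL2 g hgm hgi ⟨(lam + D * lam).toReal, fun x => ?_⟩).trans ?_
      · have := h.enorm_goodPart_le hf hlam x
        rw [← toReal_enorm]
        refine ENNReal.toReal_mono ?_ this
        exact ENNReal.add_ne_top.2 ⟨hlam', ENNReal.mul_ne_top hD hlam'⟩
      · gcongr
        exact h.lintegral_goodPart_sq_le hf hlam
    have h1 := (mul_meas_ge_le_lintegral (μ := (volume : Measure E))
      (hTg.enorm.pow_const 2) ((lam / 2) ^ 2)).trans h0
    have h2 : {x | lam / 2 ≤ ‖kconv K g x‖ₑ} ⊆ {x | (lam / 2) ^ 2 ≤ ‖kconv K g x‖ₑ ^ 2} :=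
      fun x hx => by
        simp only [Set.mem_ofPred_eq] at hx ⊢
        exact pow_le_pow_left' hx 2
    have h3 : (lam / 2) ^ 2 * volume {x | lam / 2 ≤ ‖kconv K g x‖ₑ} ≤ _ :=
      (mul_le_mul_right (measure_mono h2) _).trans h1
    have hl2 : (lam / 2) ≠ 0 := by simpa using hlam
    have hl2' : (lam / 2) ≠ ⊤ := ENNReal.div_ne_top hlam' (by simp)
    refine (ENNReal.mul_le_mul_iff_right (a := (lam / 2) ^ 2) (pow_ne_zero 2 hl2)
      (ENNReal.pow_ne_top hl2')).1 (h3.trans (le_of_eq ?_))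
    have h4 : (lam / 2) ^ 2 * 4 * (lam ^ 2)⁻¹ = 1 := by
      have : lam = 2 * (lam / 2) := (ENNReal.mul_div_cancel (by simp) (by simp)).symm
      have h5 : (lam / 2) ^ 2 * 4 = lam ^ 2 := by
        conv_rhs => rw [this]
        ring
      rw [h5, ENNReal.mul_inv_cancel (pow_ne_zero 2 hlam) (ENNReal.pow_ne_top hlam')]
    rw [← one_mul (B * _), ← h4]; ring
  calc volume {x | lam < ‖kconv K f x‖ₑ}
      ≤ D' * volume Ω + 4 * A * D * volume Ω + 4 * B * (lam ^ 2)⁻¹ *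
        ((∫⁻ x in {x | ‖f x‖ₑ ≤ lam}, ‖f x‖ₑ ^ 2) + (D * lam) ^ 2 * volume Ω) := by
        refine (measure_mono hsub).trans ((measure_union_le _ _).trans ?_)
        exact add_le_add ((measure_union_le _ _).trans (add_le_add e1 e2)) e3
    _ = (D' + 4 * A * D + 4 * B * D ^ 2 * (lam ^ 2 * (lam ^ 2)⁻¹)) * volume Ω +
        4 * B * (lam ^ 2)⁻¹ * ∫⁻ x in {x | ‖f x‖ₑ ≤ lam}, ‖f x‖ₑ ^ 2 := by ring
    _ = _ := by
        rw [ENNReal.mul_inv_cancel (pow_ne_zero 2 hlam) (ENNReal.pow_ne_top hlam'), mul_one]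

/-- The measure of the union of the cubes is controlled by the part of `f` above half the height. -/
theorem volume_cubes_le (h : IsCZCover K f lam D D' A κ star y₀) (hfm : Measurable f)
    (hf : Integrable f) (hlam : lam ≠ 0) (hlam' : lam ≠ ⊤) :
    volume (κ ⁻¹' {none})ᶜ ≤ 2 * lam⁻¹ * ∫⁻ x in {x | lam / 2 < ‖f x‖ₑ}, ‖f x‖ₑ := by
  have hs : MeasurableSet {x | lam / 2 < ‖f x‖ₑ} := measurableSet_lt measurable_const hfm.enorm
  have key : ∀ c, lam / 2 * volume (κ ⁻¹' {some c}) ≤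
      ∫⁻ x in κ ⁻¹' {some c}, {x | lam / 2 < ‖f x‖ₑ}.indicator (fun x => ‖f x‖ₑ) x := by
    intro c
    have hV := h.volume_ne_top hf hlam c
    have hfin : lam / 2 * volume (κ ⁻¹' {some c}) ≠ ⊤ :=
      ENNReal.mul_ne_top (ENNReal.div_ne_top hlam' (by simp)) hV
    refine (ENNReal.add_le_add_iff_left hfin).1 ?_
    calc lam / 2 * volume (κ ⁻¹' {some c}) + lam / 2 * volume (κ ⁻¹' {some c})
        = lam * volume (κ ⁻¹' {some c}) := by rw [← add_mul, ENNReal.add_halves]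
      _ ≤ ∫⁻ x in κ ⁻¹' {some c}, ‖f x‖ₑ := h.lower c
      _ ≤ ∫⁻ x in κ ⁻¹' {some c}, (lam / 2 +
            {x | lam / 2 < ‖f x‖ₑ}.indicator (fun x => ‖f x‖ₑ) x) := by
          refine lintegral_mono fun x => ?_
          by_cases hx : lam / 2 < ‖f x‖ₑ
          · rw [Set.indicator_of_mem (by exact hx)]; exact le_add_self
          · exact (not_lt.1 hx).trans le_self_add
      _ = _ := by
          rw [lintegral_add_left measurable_const, setLIntegral_const]
  have h2 : lam / 2 * volume (κ ⁻¹' {none})ᶜ ≤ ∫⁻ x in {x | lam / 2 < ‖f x‖ₑ}, ‖f x‖ₑ := by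
    rw [h.volume_compl_none, ← ENNReal.tsum_mul_left]
    refine (ENNReal.tsum_le_tsum key).trans ?_
    rw [← h.lintegral_compl_none, ← lintegral_indicator hs]
    exact setLIntegral_le_lintegral _ _
  have h5 : 2 * lam⁻¹ * (lam / 2) = 1 := by
    rw [div_eq_mul_inv, mul_comm lam, ← mul_assoc, mul_assoc 2, mul_comm lam⁻¹, ← mul_assoc,
      ENNReal.mul_inv_cancel (by simp) (by simp), one_mul, ENNReal.inv_mul_cancel hlam hlam']
  calc volume (κ ⁻¹' {none})ᶜ = 2 * lam⁻¹ * (lam / 2 * volume (κ ⁻¹' {none})ᶜ) := by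
        rw [← mul_assoc, h5, one_mul]
    _ ≤ _ := by gcongr

end IsCZCover
end CalderonZygmund

section RealVariable

lemma lintegral_rpow_below (p : ℝ) (hp : 1 < p) (a : ℝ) (ha : 0 ≤ a) :
    ∫⁻ t in Set.Ioi (0 : ℝ), (if t / 2 < a then ENNReal.ofReal (t ^ (p - 2)) else 0) ≤
      ENNReal.ofReal ((2 * a) ^ (p - 1) / (p - 1)) := by
  have h0 : (0 : ℝ) ≤ 2 * a := by positivity
  have hInt : IntervalIntegrable (fun t : ℝ => t ^ (p - 2)) volume 0 (2 * a) :=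
    intervalIntegral.intervalIntegrable_rpow' (by linarith)
  calc ∫⁻ t in Set.Ioi (0 : ℝ), (if t / 2 < a then ENNReal.ofReal (t ^ (p - 2)) else 0)
      ≤ ∫⁻ t in Set.Ioi (0 : ℝ), (Set.Ioc 0 (2 * a)).indicator
          (fun t => ENNReal.ofReal (t ^ (p - 2))) t := by
        refine setLIntegral_mono' measurableSet_Ioi fun t ht => ?_
        split_ifs with h
        · rw [Set.indicator_of_mem]
          exact ⟨ht, by linarith⟩
        · exact zero_le
    _ ≤ ∫⁻ t, (Set.Ioc 0 (2 * a)).indicator (fun t => ENNReal.ofReal (t ^ (p - 2))) t :=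
        setLIntegral_le_lintegral _ _
    _ = ∫⁻ t in Set.Ioc 0 (2 * a), ENNReal.ofReal (t ^ (p - 2)) :=
        lintegral_indicator measurableSet_Ioc _
    _ = ENNReal.ofReal (∫ t in (0 : ℝ)..(2 * a), t ^ (p - 2)) := by
        rw [intervalIntegral.integral_of_le h0, ofReal_integral_eq_lintegral_ofReal]
        · exact (intervalIntegrable_iff_integrableOn_Ioc_of_le h0).1 hInt
        · refine (ae_restrict_iff' measurableSet_Ioc).2 (Filter.Eventually.of_forall fun t ht => ?_)
          exact Real.rpow_nonneg ht.1.le _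
    _ = _ := by
        rw [integral_rpow (Or.inl (by linarith))]
        have : p - 2 + 1 = p - 1 := by ring
        rw [this, Real.zero_rpow (by linarith), sub_zero]

lemma lintegral_rpow_above (p : ℝ) (hp2 : p < 2) (a : ℝ) (ha : 0 ≤ a) :
    ∫⁻ t in Set.Ioi (0 : ℝ),
        (if a ≤ t then ENNReal.ofReal (t ^ (p - 3)) else 0) * ENNReal.ofReal (a ^ 2) ≤
      ENNReal.ofReal (a ^ p / (2 - p)) := by
  rcases ha.eq_or_lt with rfl | ha
  · simp
  have hInt : IntegrableOn (fun t : ℝ => t ^ (p - 3)) (Set.Ioi a) :=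
    integrableOn_Ioi_rpow_of_lt (by linarith) ha
  rw [lintegral_mul_const' _ _ ENNReal.ofReal_ne_top]
  have h1 : ∫⁻ t in Set.Ioi (0 : ℝ), (if a ≤ t then ENNReal.ofReal (t ^ (p - 3)) else 0) ≤
      ENNReal.ofReal (a ^ (p - 2) / (2 - p)) := by
    calc _ ≤ ∫⁻ t, (Set.Ici a).indicator (fun t => ENNReal.ofReal (t ^ (p - 3))) t := by
          refine (lintegral_mono fun t => ?_).trans (setLIntegral_le_lintegral _ _)
          rw [Set.indicator_apply]
          exact le_rfl
      _ = ∫⁻ t in Set.Ici a, ENNReal.ofReal (t ^ (p - 3)) :=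
          lintegral_indicator measurableSet_Ici _
      _ = ∫⁻ t in Set.Ioi a, ENNReal.ofReal (t ^ (p - 3)) := by
          rw [restrict_Ioi_eq_restrict_Ici]
      _ = ENNReal.ofReal (∫ t in Set.Ioi a, t ^ (p - 3)) := by
          rw [ofReal_integral_eq_lintegral_ofReal hInt]
          refine (ae_restrict_iff' measurableSet_Ioi).2 (Filter.Eventually.of_forall fun t ht => ?_)
          exact Real.rpow_nonneg (ha.le.trans (Set.mem_Ioi.1 ht).le) _
      _ = _ := by
          rw [integral_Ioi_rpow_of_lt (by linarith) ha]
          have : p - 3 + 1 = p - 2 := by ring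
          rw [this, ← neg_sub 2 p, div_neg, neg_div, neg_neg]
  refine (mul_le_mul_left h1 _).trans (le_of_eq ?_)
  have h2 : 0 < 2 - p := by linarith
  rw [← ENNReal.ofReal_mul (by positivity)]
  congr 1
  have : a ^ p = a ^ (p - 2) * a ^ 2 := by
    rw [← Real.rpow_natCast, ← Real.rpow_add ha]
    congr 1
    push_cast; ring
  rw [this]; ring

variable {E : Type*} [MeasurableSpace E] {μ : Measure E} [SFinite μ]

/-- The integration step of the Marcinkiewicz interpolation between a weak `(1,1)` and an `L²`
estimate. -/
lemma lintegral_rpow_le_of_volume_superlevel_le {f g : E → ℂ} (hf : Measurable f)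
    (hg : Measurable g) {p : ℝ} (hp : 1 < p) (hp2 : p < 2) {a b : ℝ≥0∞}
    (h : ∀ lam : ℝ≥0∞, lam ≠ 0 → lam ≠ ⊤ → μ {x | lam < ‖g x‖ₑ} ≤
      a * (2 * lam⁻¹ * ∫⁻ x in {x | lam / 2 < ‖f x‖ₑ}, ‖f x‖ₑ ∂μ) +
        b * (lam ^ 2)⁻¹ * ∫⁻ x in {x | ‖f x‖ₑ ≤ lam}, ‖f x‖ₑ ^ 2 ∂μ) :
    ∫⁻ x, ‖g x‖ₑ ^ p ∂μ ≤ ENNReal.ofReal p * (a * (2 * ENNReal.ofReal (2 ^ (p - 1) / (p - 1))) +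
      b * ENNReal.ofReal (1 / (2 - p))) * ∫⁻ x, ‖f x‖ₑ ^ p ∂μ := by
  have hp0 : 0 < p := by linarith
  have e0 : ∀ z : ℂ, ‖z‖ₑ ^ p = ENNReal.ofReal (‖z‖ ^ p) := fun z => by
    rw [← ofReal_norm, ENNReal.ofReal_rpow_of_nonneg (norm_nonneg _) hp0.le]
  have hgn : ∫⁻ x, ‖g x‖ₑ ^ p ∂μ = ENNReal.ofReal p *
      ∫⁻ t in Set.Ioi (0 : ℝ), μ {x | t < ‖g x‖} * ENNReal.ofReal (t ^ (p - 1)) := by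
    simp_rw [e0]
    exact lintegral_rpow_eq_lintegral_meas_lt_mul μ
      (Filter.Eventually.of_forall fun x => norm_nonneg _) hg.norm.aemeasurable hp0
  set F₁ : ℝ → E → ℝ≥0∞ := fun t x =>
    (if t / 2 < ‖f x‖ then ENNReal.ofReal (t ^ (p - 2)) else 0) * ‖f x‖ₑ with hF₁
  set F₂ : ℝ → E → ℝ≥0∞ := fun t x =>
    (if ‖f x‖ ≤ t then ENNReal.ofReal (t ^ (p - 3)) else 0) * ENNReal.ofReal (‖f x‖ ^ 2) with hF₂
  have hm₁ : Measurable (Function.uncurry F₁) := by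
    refine Measurable.mul (Measurable.ite ?_ ?_ measurable_const) ?_
    · exact measurableSet_lt (by fun_prop) (by fun_prop)
    · fun_prop
    · fun_prop
  have hm₂ : Measurable (Function.uncurry F₂) := by
    refine Measurable.mul (Measurable.ite ?_ ?_ measurable_const) ?_
    · exact measurableSet_le (by fun_prop) (by fun_prop)
    · fun_prop
    · fun_prop
  have hpt : ∀ t ∈ Set.Ioi (0 : ℝ), μ {x | t < ‖g x‖} * ENNReal.ofReal (t ^ (p - 1)) ≤
      a * (2 * ∫⁻ x, F₁ t x ∂μ) + b * ∫⁻ x, F₂ t x ∂μ := by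
    intro t ht
    have ht : 0 < t := ht
    have hl0 : ENNReal.ofReal t ≠ 0 := by simpa using ht
    have h1 := h (ENNReal.ofReal t) hl0 ENNReal.ofReal_ne_top
    have s1 : {x | ENNReal.ofReal t < ‖g x‖ₑ} = {x | t < ‖g x‖} := by
      ext x
      simp only [Set.mem_ofPred_eq]
      rw [← ofReal_norm, ENNReal.ofReal_lt_ofReal_iff_of_nonneg ht.le]
    have s2 : ∀ x, ENNReal.ofReal t / 2 < ‖f x‖ₑ ↔ t / 2 < ‖f x‖ := fun x => by
      have : ENNReal.ofReal t / 2 = ENNReal.ofReal (t / 2) := by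
        rw [ENNReal.ofReal_div_of_pos (by norm_num)]; simp
      rw [this, ← ofReal_norm, ENNReal.ofReal_lt_ofReal_iff_of_nonneg (by positivity)]
    have s3 : ∀ x, ‖f x‖ₑ ≤ ENNReal.ofReal t ↔ ‖f x‖ ≤ t := fun x => by
      rw [← ofReal_norm, ENNReal.ofReal_le_ofReal_iff ht.le]
    have i1 : ENNReal.ofReal (t ^ (p - 1)) * ((ENNReal.ofReal t)⁻¹ *
        ∫⁻ x in {x | ENNReal.ofReal t / 2 < ‖f x‖ₑ}, ‖f x‖ₑ ∂μ) = ∫⁻ x, F₁ t x ∂μ := by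
      rw [← lintegral_indicator (measurableSet_lt measurable_const hf.enorm), ← mul_assoc,
        ← lintegral_const_mul' _ _ (ENNReal.mul_ne_top ENNReal.ofReal_ne_top (by simpa using ht))]
      congr 1; ext x
      simp only [hF₁, Set.indicator_apply, Set.mem_ofPred_eq, s2]
      split_ifs
      · congr 1
        rw [← ENNReal.ofReal_inv_of_pos ht, ← ENNReal.ofReal_mul (by positivity)]
        congr 1
        rw [← Real.rpow_neg_one, ← Real.rpow_add ht]; congr 1; ring
      · simp
    have i2 : ENNReal.ofReal (t ^ (p - 1)) * ((ENNReal.ofReal t ^ 2)⁻¹ *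
        ∫⁻ x in {x | ‖f x‖ₑ ≤ ENNReal.ofReal t}, ‖f x‖ₑ ^ 2 ∂μ) = ∫⁻ x, F₂ t x ∂μ := by
      rw [← lintegral_indicator (measurableSet_le hf.enorm measurable_const), ← mul_assoc,
        ← lintegral_const_mul' _ _ (ENNReal.mul_ne_top ENNReal.ofReal_ne_top (by simpa using ht))]
      congr 1; ext x
      simp only [hF₂, Set.indicator_apply, Set.mem_ofPred_eq, s3]
      split_ifs
      · rw [← ofReal_norm, ENNReal.ofReal_pow (norm_nonneg _)]
        congr 1
        rw [← ENNReal.ofReal_pow ht.le, ← ENNReal.ofReal_inv_of_pos (by positivity),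
          ← ENNReal.ofReal_mul (by positivity)]
        congr 1
        rw [← Real.rpow_natCast, ← Real.rpow_neg ht.le, ← Real.rpow_add ht]; congr 1
        push_cast; ring
      · simp
    rw [s1] at h1
    refine (mul_le_mul_left h1 _).trans (le_of_eq ?_)
    rw [← i1, ← i2]; ring
  have j1 : ∫⁻ t in Set.Ioi (0 : ℝ), ∫⁻ x, F₁ t x ∂μ ≤
      ENNReal.ofReal (2 ^ (p - 1) / (p - 1)) * ∫⁻ x, ‖f x‖ₑ ^ p ∂μ := by
    rw [lintegral_lintegral_swap hm₁.aemeasurable, ← lintegral_const_mul' _ _ ENNReal.ofReal_ne_top]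
    refine lintegral_mono fun x => ?_
    simp only [hF₁]
    rw [lintegral_mul_const' _ _ (by simp)]
    refine (mul_le_mul_left (lintegral_rpow_below p hp _ (norm_nonneg _)) _).trans (le_of_eq ?_)
    have hp1 : 0 < p - 1 := by linarith
    rw [e0, ← ofReal_norm, ← ENNReal.ofReal_mul (by positivity),
      ← ENNReal.ofReal_mul (by positivity)]
    congr 1
    have : ‖f x‖ ^ p = ‖f x‖ ^ (p - 1) * ‖f x‖ := by
      rw [Real.rpow_sub_one' (norm_nonneg _) (by linarith)]
      rcases eq_or_ne ‖f x‖ 0 with h0 | h0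
      · rw [h0, Real.zero_rpow hp0.ne']; simp
      · field_simp
    rw [Real.mul_rpow (by norm_num) (norm_nonneg _), this]; ring
  have j2 : ∫⁻ t in Set.Ioi (0 : ℝ), ∫⁻ x, F₂ t x ∂μ ≤
      ENNReal.ofReal (1 / (2 - p)) * ∫⁻ x, ‖f x‖ₑ ^ p ∂μ := by
    rw [lintegral_lintegral_swap hm₂.aemeasurable, ← lintegral_const_mul' _ _ ENNReal.ofReal_ne_top]
    refine lintegral_mono fun x => ?_
    refine (lintegral_rpow_above p hp2 _ (norm_nonneg _)).trans (le_of_eq ?_)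
    have hp1 : 0 < 2 - p := by linarith
    rw [e0, ← ENNReal.ofReal_mul (by positivity)]
    congr 1; ring
  rw [hgn, mul_assoc]
  refine mul_le_mul_right ?_ _
  have k1 : Measurable fun t => ∫⁻ x, F₁ t x ∂μ := hm₁.lintegral_prod_right'
  have k2 : Measurable fun t => ∫⁻ x, F₂ t x ∂μ := hm₂.lintegral_prod_right'
  calc _ ≤ ∫⁻ t in Set.Ioi (0 : ℝ), (a * (2 * ∫⁻ x, F₁ t x ∂μ) + b * ∫⁻ x, F₂ t x ∂μ) :=
        setLIntegral_mono' measurableSet_Ioi hpt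
    _ = a * (2 * ∫⁻ t in Set.Ioi (0 : ℝ), ∫⁻ x, F₁ t x ∂μ) +
          b * ∫⁻ t in Set.Ioi (0 : ℝ), ∫⁻ x, F₂ t x ∂μ := by
        rw [lintegral_add_left (by fun_prop), lintegral_const_mul _ (by fun_prop),
          lintegral_const_mul _ k1, lintegral_const_mul _ k2]
    _ ≤ a * (2 * (ENNReal.ofReal (2 ^ (p - 1) / (p - 1)) * ∫⁻ x, ‖f x‖ₑ ^ p ∂μ)) +
          b * (ENNReal.ofReal (1 / (2 - p)) * ∫⁻ x, ‖f x‖ₑ ^ p ∂μ) := by gcongr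
    _ = _ := by ring

end RealVariable

section CalderonZygmund

variable {E : Type*} [NormedAddCommGroup E] [MeasureSpace E] [BorelSpace E]
  [SecondCountableTopology E] [SigmaFinite (volume : Measure E)]

/-- The constant in the Calderón–Zygmund theorem. -/
def czConst (D D' A B : ℝ≥0∞) (p : ℝ) : ℝ≥0∞ :=
  ENNReal.ofReal p * ((D' + 4 * A * D + 4 * B * D ^ 2) *
    (2 * ENNReal.ofReal (2 ^ (p - 1) / (p - 1))) + 4 * B * ENNReal.ofReal (1 / (2 - p)))

lemma czConst_ne_top {D D' A B : ℝ≥0∞} (p : ℝ) (hD : D ≠ ⊤) (hD' : D' ≠ ⊤) (hA : A ≠ ⊤)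
    (hB : B ≠ ⊤) : czConst D D' A B p ≠ ⊤ := by
  unfold czConst
  finiteness

/-- `L²`-boundedness of the convolution with `K`, tested on bounded integrable functions. -/
def L2Bound (K : E → ℂ) (B : ℝ≥0∞) : Prop :=
  ∀ g : E → ℂ, Measurable g → Integrable g → (∃ R : ℝ, ∀ x, ‖g x‖ ≤ R) →
    ∫⁻ x, ‖kconv K g x‖ₑ ^ 2 ≤ B * ∫⁻ x, ‖g x‖ₑ ^ 2

theorem lintegral_kconv_rpow_le_of_lt_two {ι : Type*} [Countable ι] {K f : E → ℂ}
    {D D' A B : ℝ≥0∞} (hK : Continuous K) {M : ℝ} (hM : ∀ x, ‖K x‖ ≤ M) (hfm : Measurable f)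
    (hf : Integrable f) (hD : D ≠ ⊤) (hL2 : L2Bound K B)
    (hcover : ∀ lam : ℝ≥0∞, lam ≠ 0 → lam ≠ ⊤ → ∃ (κ : E → Option ι) (star : ι → Set E)
      (y₀ : ι → E), IsCZCover K f lam D D' A κ star y₀)
    {p : ℝ} (hp : 1 < p) (hp2 : p < 2) :
    ∫⁻ x, ‖kconv K f x‖ₑ ^ p ≤ czConst D D' A B p * ∫⁻ x, ‖f x‖ₑ ^ p := by
  refine lintegral_rpow_le_of_volume_superlevel_le hfm (measurable_kconv hK hfm) hp hp2 ?_
  intro lam h0 ht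
  obtain ⟨κ, star, y₀, h⟩ := hcover lam h0 ht
  refine (h.volume_superlevel_le hK hM hfm hf h0 ht hD hL2).trans ?_
  gcongr
  exact h.volume_cubes_le hfm hf h0 ht

end CalderonZygmund

section CalderonZygmund

variable {E : Type*} [NormedAddCommGroup E] [MeasureSpace E] [BorelSpace E]
  [SecondCountableTopology E] [SigmaFinite (volume : Measure E)]

lemma continuous_kconv {K f : E → ℂ} (hK : Continuous K) {M : ℝ} (hM : ∀ x, ‖K x‖ ≤ M)
    (hf : Integrable f) : Continuous (kconv K f) := by
  refine continuous_of_dominated (bound := fun y => M * ‖f y‖) ?_ ?_ ?_ ?_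
  · exact fun x => (integrable_kernel_mul hK hM hf x).aestronglyMeasurable
  · refine fun x => Filter.Eventually.of_forall fun y => ?_
    rw [norm_mul]
    gcongr
    exact hM _
  · exact hf.norm.const_mul M
  · refine Filter.Eventually.of_forall fun y => ?_
    fun_prop

lemma norm_kconv_le {K f : E → ℂ} {M : ℝ} (hM : ∀ x, ‖K x‖ ≤ M)
    (hf : Integrable f) (x : E) : ‖kconv K f x‖ ≤ M * ∫ y, ‖f y‖ := by
  rw [← integral_const_mul]
  refine norm_integral_le_of_norm_le (hf.norm.const_mul M) (Filter.Eventually.of_forall fun y => ?_)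
  rw [norm_mul]
  gcongr
  exact hM _

lemma integrable_kconv [(volume : Measure E).IsAddHaarMeasure] {K f : E → ℂ} (hK : Continuous K)
    {M : ℝ} (hM : ∀ x, ‖K x‖ ≤ M) (hKi : Integrable K) (hfm : Measurable f) (hf : Integrable f) :
    Integrable (kconv K f) := by
  refine ⟨(continuous_kconv hK hM hf).aestronglyMeasurable, ?_⟩
  have hKm := hK.measurable
  calc ∫⁻ x, ‖kconv K f x‖ₑ ≤ ∫⁻ x, ∫⁻ y, ‖K (x - y)‖ₑ * ‖f y‖ₑ := by
        refine lintegral_mono fun x => (enorm_integral_le_lintegral_enorm _).trans (le_of_eq ?_)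
        simp_rw [enorm_mul]
    _ = ∫⁻ y, ∫⁻ x, ‖K (x - y)‖ₑ * ‖f y‖ₑ := by
        refine lintegral_lintegral_swap (Measurable.aemeasurable ?_)
        unfold Function.uncurry
        fun_prop
    _ = ∫⁻ y, (∫⁻ x, ‖K x‖ₑ) * ‖f y‖ₑ := by
        refine lintegral_congr fun y => ?_
        rw [lintegral_mul_const _ (by fun_prop)]
        congr 1
        exact lintegral_sub_right_eq_self (fun x => ‖K x‖ₑ) y
    _ = (∫⁻ x, ‖K x‖ₑ) * ∫⁻ y, ‖f y‖ₑ := lintegral_const_mul _ hfm.enorm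
    _ < ⊤ := ENNReal.mul_lt_top hKi.hasFiniteIntegral hf.hasFiniteIntegral

lemma integral_kconv_mul {K f h : E → ℂ} (hK : Continuous K) {M : ℝ} (hM : ∀ x, ‖K x‖ ≤ M)
    (hf : Integrable f) (hh : Integrable h) :
    ∫ x, kconv K f x * h x = ∫ y, f y * kconv (fun x => K (-x)) h y := by
  have hi : Integrable (Function.uncurry fun x y => K (x - y) * f y * h x)
      ((volume : Measure E).prod volume) := by
    have h1 : Integrable (fun z : E × E => h z.1 * f z.2) (volume.prod volume) := hh.mul_prod hf
    have h2 : Integrable (fun z : E × E => K (z.1 - z.2) * (h z.1 * f z.2))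
        (volume.prod volume) := by
      refine h1.bdd_mul (c := M) ?_ (Filter.Eventually.of_forall fun y => hM _)
      exact (hK.comp (continuous_fst.sub continuous_snd)).aestronglyMeasurable
    refine h2.congr (Filter.Eventually.of_forall fun z => ?_)
    simp only [Function.uncurry]; ring
  calc ∫ x, kconv K f x * h x = ∫ x, ∫ y, K (x - y) * f y * h x := by
        congr 1; ext x; rw [kconv, integral_mul_const]
    _ = ∫ y, ∫ x, K (x - y) * f y * h x := integral_integral_swap hi
    _ = _ := by
        congr 1; ext y
        rw [kconv, ← integral_const_mul]
        congr 1; ext x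
        rw [neg_sub]; ring

theorem lintegral_kconv_rpow_le_of_two_lt [(volume : Measure E).IsAddHaarMeasure] {K f : E → ℂ}
    (hK : Continuous K) {M : ℝ} (hM : ∀ x, ‖K x‖ ≤ M) (hKi : Integrable K) (hfc : Continuous f)
    (hf : Integrable f) {p q : ℝ} (hp : 2 < p) (hpq : p.HolderConjugate q) {C : ℝ≥0∞}
    (hdual : ∀ h : E → ℂ, Continuous h → Integrable h →
      ∫⁻ x, ‖kconv (fun x => K (-x)) h x‖ₑ ^ q ≤ C * ∫⁻ x, ‖h x‖ₑ ^ q) :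
    ∫⁻ x, ‖kconv K f x‖ₑ ^ p ≤ C ^ (p / q) * ∫⁻ x, ‖f x‖ₑ ^ p := by
  have hp0 : 0 < p := by linarith
  have hq0 : 0 < q := hpq.symm.pos
  set u := kconv K f with hu
  have huc : Continuous u := continuous_kconv hK hM hf
  have hui : Integrable u := integrable_kconv hK hM hKi hfc.measurable hf
  have hub := norm_kconv_le hM hf
  set R := M * ∫ y, ‖f y‖
  have hR : 0 ≤ R := (norm_nonneg _).trans (hub 0)
  set h : E → ℂ := fun x => ((‖u x‖ ^ (p - 2) : ℝ) : ℂ) * (starRingEnd ℂ) (u x) with hh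
  have hrc : Continuous fun x => ‖u x‖ ^ (p - 2) :=
    huc.norm.rpow_const fun x => Or.inr (by linarith)
  have hhc : Continuous h := by fun_prop
  have hhn : ∀ x, ‖h x‖ = ‖u x‖ ^ (p - 2) * ‖u x‖ := fun x => by
    rw [hh]
    simp only [norm_mul, Complex.norm_real, RCLike.norm_conj]
    rw [Real.norm_of_nonneg (by positivity)]
  have hhi : Integrable h := by
    refine (hui.norm.const_mul (R ^ (p - 2))).mono' hhc.aestronglyMeasurable
      (Filter.Eventually.of_forall fun x => ?_)
    rw [hhn]
    gcongr
    exact hub x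
  set U := ∫⁻ x, ‖u x‖ₑ ^ p with hU
  have hpow : ∀ x, ‖h x‖ₑ ^ q = ‖u x‖ₑ ^ p := fun x => by
    rw [← ofReal_norm, ← ofReal_norm, ENNReal.ofReal_rpow_of_nonneg (norm_nonneg _) hq0.le,
      ENNReal.ofReal_rpow_of_nonneg (norm_nonneg _) hp0.le, hhn]
    congr 1
    rw [← Real.rpow_add_one' (norm_nonneg _) (by linarith), ← Real.rpow_mul (norm_nonneg _)]
    congr 1
    have := hpq.sub_one_mul_conj
    linarith
  have hUeq : U = ‖∫ x, u x * h x‖ₑ := by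
    have h1 : ∀ x, u x * h x = ((‖u x‖ ^ p : ℝ) : ℂ) := fun x => by
      rw [hh]
      have : u x * (((‖u x‖ ^ (p - 2) : ℝ) : ℂ) * (starRingEnd ℂ) (u x)) =
          ((‖u x‖ ^ (p - 2) : ℝ) : ℂ) * (u x * (starRingEnd ℂ) (u x)) := by ring
      rw [this, Complex.mul_conj, Complex.normSq_eq_norm_sq, ← Complex.ofReal_mul]
      congr 1
      rw [← Real.rpow_add_natCast' (norm_nonneg _) (by push_cast; linarith)]
      congr 1; push_cast; ring
    simp_rw [h1]
    have hnn : 0 ≤ ∫ x, ‖u x‖ ^ p := integral_nonneg fun x => by positivity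
    rw [integral_complex_ofReal, ← ofReal_norm, Complex.norm_real, Real.norm_of_nonneg hnn,
      ofReal_integral_eq_lintegral_ofReal]
    · refine lintegral_congr fun x => ?_
      rw [← ofReal_norm, ENNReal.ofReal_rpow_of_nonneg (norm_nonneg _) hp0.le]
    · refine (hui.norm.const_mul (R ^ (p - 1))).mono'
        (huc.norm.rpow_const fun x => Or.inr hp0.le).aestronglyMeasurable
        (Filter.Eventually.of_forall fun x => ?_)
      rw [Real.norm_of_nonneg (by positivity)]
      have : ‖u x‖ ^ p = ‖u x‖ ^ (p - 1) * ‖u x‖ := by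
        rw [← Real.rpow_add_one' (norm_nonneg _) (by linarith)]; congr 1; ring
      rw [this]
      gcongr
      · linarith
      · exact hub x
    · exact Filter.Eventually.of_forall fun x => by positivity
  have hUtop : U ≠ ⊤ := by rw [hUeq]; exact enorm_ne_top
  have key : U ≤ (∫⁻ x, ‖f x‖ₑ ^ p) ^ (1 / p) * (C * U) ^ (1 / q) := by
    have hTm : Measurable (kconv (fun x => K (-x)) h) :=
      measurable_kconv (hK.comp continuous_neg) hhc.measurable
    calc U = ‖∫ y, f y * kconv (fun x => K (-x)) h y‖ₑ := by
          rw [hUeq, integral_kconv_mul hK hM hf hhi]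
      _ ≤ ∫⁻ y, ‖f y‖ₑ * ‖kconv (fun x => K (-x)) h y‖ₑ := by
          refine (enorm_integral_le_lintegral_enorm _).trans (le_of_eq ?_)
          simp_rw [enorm_mul]
      _ ≤ (∫⁻ x, ‖f x‖ₑ ^ p) ^ (1 / p) *
            (∫⁻ x, ‖kconv (fun x => K (-x)) h x‖ₑ ^ q) ^ (1 / q) :=
          ENNReal.lintegral_mul_le_Lp_mul_Lq volume hpq hfc.enorm.measurable.aemeasurable
            hTm.enorm.aemeasurable
      _ ≤ _ := by
          gcongr
          refine (hdual h hhc hhi).trans (le_of_eq ?_)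
          simp_rw [hpow]; rfl
  rcases eq_or_ne U 0 with h0 | h0
  · rw [h0]; exact zero_le
  have hq1 : U ^ (1 / q) ≠ 0 := by simp [h0, hUtop]
  have hq2 : U ^ (1 / q) ≠ ⊤ := ENNReal.rpow_ne_top_of_nonneg (by positivity) hUtop
  have hsplit : U = U ^ (1 / p) * U ^ (1 / q) := by
    rw [← ENNReal.rpow_add _ _ h0 hUtop, one_div, one_div, hpq.inv_add_inv_eq_one,
      ENNReal.rpow_one]
  have h2 : U ^ (1 / p) ≤ (∫⁻ x, ‖f x‖ₑ ^ p) ^ (1 / p) * C ^ (1 / q) := by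
    refine (ENNReal.mul_le_mul_iff_left hq1 hq2).1 ?_
    rw [← hsplit]
    refine key.trans (le_of_eq ?_)
    rw [ENNReal.mul_rpow_of_nonneg _ _ (by positivity), mul_assoc]
  have h3 := ENNReal.rpow_le_rpow h2 hp0.le
  rw [ENNReal.mul_rpow_of_nonneg _ _ hp0.le, ← ENNReal.rpow_mul, ← ENNReal.rpow_mul,
    ← ENNReal.rpow_mul, one_div_mul_cancel hp0.ne', ENNReal.rpow_one, ENNReal.rpow_one] at h3
  refine h3.trans (le_of_eq ?_)
  rw [mul_comm]
  congr 2
  ring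

/-- Calderón–Zygmund covers exist at all heights for all continuous integrable functions. -/
def HasCZCovers (ι : Type*) (K : E → ℂ) (D D' A : ℝ≥0∞) : Prop :=
  ∀ f : E → ℂ, Continuous f → Integrable f → ∀ lam : ℝ≥0∞, lam ≠ 0 → lam ≠ ⊤ →
    ∃ (κ : E → Option ι) (star : ι → Set E) (y₀ : ι → E), IsCZCover K f lam D D' A κ star y₀

/-- The Calderón–Zygmund theorem: `Lᵖ` bounds depending on the kernel only through the `L²` bound
and Hörmander's constant. -/
theorem exists_lintegral_kconv_rpow_le [(volume : Measure E).IsAddHaarMeasure] (ι : Type*)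
    [Countable ι] {D D' A B : ℝ≥0∞} (hD : D ≠ ⊤) (hD' : D' ≠ ⊤) (hA : A ≠ ⊤)
    (hB : B ≠ ⊤) {p : ℝ} (hp : 1 < p) :
    ∃ C : ℝ≥0∞, C ≠ ⊤ ∧ ∀ K : E → ℂ, Continuous K → (∃ M, ∀ x, ‖K x‖ ≤ M) → Integrable K →
      HasCZCovers ι K D D' A → HasCZCovers ι (fun x => K (-x)) D D' A →
      L2Bound K B → L2Bound (fun x => K (-x)) B →
      ∀ f : E → ℂ, Continuous f → Integrable f → (∃ R : ℝ, ∀ x, ‖f x‖ ≤ R) →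
        ∫⁻ x, ‖kconv K f x‖ₑ ^ p ≤ C * ∫⁻ x, ‖f x‖ₑ ^ p := by
  rcases lt_trichotomy p 2 with h2 | rfl | h2
  · refine ⟨czConst D D' A B p, czConst_ne_top p hD hD' hA hB, ?_⟩
    rintro K hK ⟨M, hM⟩ - hc - hb - f hfc hf -
    exact lintegral_kconv_rpow_le_of_lt_two hK hM hfc.measurable hf hD hb (hc f hfc hf) hp h2
  · refine ⟨B, hB, ?_⟩
    rintro K hK - - - - hb - f hfc hf hR
    simpa using hb f hfc.measurable hf hR
  · have hpq := Real.HolderConjugate.conjExponent hp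
    have hq1 : 1 < p.conjExponent := hpq.symm.lt
    have hq2 : p.conjExponent < 2 := by
      rw [Real.conjExponent, div_lt_iff₀ (by linarith)]; linarith
    refine ⟨czConst D D' A B p.conjExponent ^ (p / p.conjExponent),
      ENNReal.rpow_ne_top_of_nonneg (div_nonneg (by linarith) (by linarith))
        (czConst_ne_top _ hD hD' hA hB), ?_⟩
    rintro K hK ⟨M, hM⟩ hKi - hc - hb f hfc hf -
    refine lintegral_kconv_rpow_le_of_two_lt hK hM hKi hfc hf h2 hpq fun h hhc hhi => ?_
    exact lintegral_kconv_rpow_le_of_lt_two (hK.comp continuous_neg) (fun x => hM _)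
      hhc.measurable hhi hD hb (hc h hhc hhi) hq1 hq2

end CalderonZygmund

section Dyadic

variable {E : Type*} [NormedAddCommGroup E] [MeasureSpace E] [BorelSpace E]
  [SecondCountableTopology E] [SigmaFinite (volume : Measure E)]

/-- An abstract system of nested dyadic cubes: the cubes of generation `j` are the fibers of
`idx j`, and have volume `V j`. -/
structure IsDyadicGrid {I : Type*} (idx : ℤ → E → I) (V : ℤ → ℝ≥0∞) (D : ℝ≥0∞) : Prop where
  meas : ∀ j i, MeasurableSet (idx j ⁻¹' {i})
  nested : ∀ j x y, idx j x = idx j y → idx (j + 1) x = idx (j + 1) y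
  vol : ∀ j x, volume (idx j ⁻¹' {idx j x}) = V j
  pos : ∀ j, V j ≠ 0
  ne_top : ∀ j, V j ≠ ⊤
  doubling : ∀ j, V (j + 1) ≤ D * V j
  large : ∀ R : ℝ≥0∞, R ≠ ⊤ → ∃ N, ∀ j, N ≤ j → R < V j
  small : ∀ x, ∀ U ∈ nhds x, ∃ j, idx j ⁻¹' {idx j x} ⊆ U

namespace IsDyadicGrid

variable {I : Type*} {idx : ℤ → E → I} {V : ℤ → ℝ≥0∞} {D : ℝ≥0∞}

lemma nested_of_le (h : IsDyadicGrid idx V D) {j k : ℤ} (hjk : j ≤ k) {x y : E}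
    (hxy : idx j x = idx j y) : idx k x = idx k y := by
  induction k, hjk using Int.leInduction with
  | base => exact hxy
  | succ k _ ih => exact h.nested k x y ih

/-- The generations at which the average of `f` over the cube containing `x` exceeds `lam`. -/
def heavy (idx : ℤ → E → I) (V : ℤ → ℝ≥0∞) (f : E → ℂ) (lam : ℝ≥0∞) (x : E) (j : ℤ) : Prop :=
  lam * V j < ∫⁻ y in idx j ⁻¹' {idx j x}, ‖f y‖ₑ

lemma heavy_congr (h : IsDyadicGrid idx V D) {f : E → ℂ} {lam : ℝ≥0∞} {j k : ℤ} (hjk : j ≤ k)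
    {x y : E} (hxy : idx j x = idx j y) : heavy idx V f lam x k ↔ heavy idx V f lam y k := by
  rw [heavy, heavy, h.nested_of_le hjk hxy]

lemma exists_greatest_heavy (h : IsDyadicGrid idx V D) {f : E → ℂ} (hf : Integrable f)
    {lam : ℝ≥0∞} (hlam : lam ≠ 0) {x : E} (hx : ∃ j, heavy idx V f lam x j) :
    ∃ j, heavy idx V f lam x j ∧ ∀ k, heavy idx V f lam x k → k ≤ j := by
  refine Int.exists_greatest_of_bdd ?_ hx
  have hfin : lam⁻¹ * ∫⁻ y, ‖f y‖ₑ ≠ ⊤ :=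
    ENNReal.mul_ne_top (by simpa using hlam) hf.hasFiniteIntegral.ne
  obtain ⟨N, hN⟩ := h.large _ hfin
  refine ⟨N, fun k hk => ?_⟩
  by_contra hcon
  have h1 := hN k (not_le.1 hcon).le
  have h2 : lam * V k < ∫⁻ y, ‖f y‖ₑ := lt_of_lt_of_le hk (setLIntegral_le_lintegral _ _)
  rcases eq_or_ne lam ⊤ with rfl | hlt
  · rw [ENNReal.top_mul (h.pos k)] at h2
    exact absurd h2 not_top_lt
  · rw [mul_comm, ← div_eq_mul_inv, ENNReal.div_lt_iff (Or.inl hlam) (Or.inl hlt), mul_comm] at h1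
    exact lt_asymm h1 h2

open Classical in
/-- The stopping cube of `x`: the largest heavy cube containing it. -/
def stopping (idx : ℤ → E → I) (V : ℤ → ℝ≥0∞) (f : E → ℂ) (lam : ℝ≥0∞) (x : E) :
    Option (ℤ × I) :=
  if h : ∃ j, heavy idx V f lam x j ∧ ∀ k, heavy idx V f lam x k → k ≤ j then
    some (h.choose, idx h.choose x) else none

lemma stopping_eq_some_iff {f : E → ℂ} {lam : ℝ≥0∞} {x : E} {c : ℤ × I} :
    stopping idx V f lam x = some c ↔
      heavy idx V f lam x c.1 ∧ (∀ k, heavy idx V f lam x k → k ≤ c.1) ∧ idx c.1 x = c.2 := by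
  unfold stopping
  split_ifs with h
  · obtain ⟨h1, h2⟩ := h.choose_spec
    rw [Option.some_inj]
    constructor
    · rintro rfl
      exact ⟨h1, h2, rfl⟩
    · rintro ⟨h3, h4, h5⟩
      have : h.choose = c.1 := le_antisymm (h4 _ h1) (h2 _ h3)
      exact Prod.ext this (by rw [← h5, this])
  · simp only [false_iff]
    rintro ⟨h3, h4, -⟩
    exact h ⟨_, h3, h4⟩

lemma stopping_eq_none (h : IsDyadicGrid idx V D) {f : E → ℂ} (hf : Integrable f)
    {lam : ℝ≥0∞} (hlam : lam ≠ 0) {x : E} (hx : stopping idx V f lam x = none) (j : ℤ) :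
    ¬ heavy idx V f lam x j := by
  intro hj
  have := h.exists_greatest_heavy hf hlam ⟨j, hj⟩
  unfold stopping at hx
  rw [dif_pos this] at hx
  simp at hx

lemma stopping_fiber (h : IsDyadicGrid idx V D) {f : E → ℂ} {lam : ℝ≥0∞} {x : E} {c : ℤ × I}
    (hx : stopping idx V f lam x = some c) :
    stopping idx V f lam ⁻¹' {some c} = idx c.1 ⁻¹' {idx c.1 x} := by
  rw [stopping_eq_some_iff] at hx
  obtain ⟨h1, h2, h3⟩ := hx
  ext y
  simp only [Set.mem_preimage, Set.mem_singleton_iff]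
  rw [stopping_eq_some_iff]
  constructor
  · rintro ⟨-, -, h4⟩
    rw [h4, h3]
  · intro hy
    have h4 := (h.heavy_congr le_rfl hy.symm).1 h1
    refine ⟨h4, fun k hk => ?_, hy.trans h3⟩
    by_contra hcon
    exact hcon (h2 k ((h.heavy_congr (not_le.1 hcon).le hy).1 hk))

theorem hasCZCovers [Countable I] (h : IsDyadicGrid idx V D) {K : E → ℂ} {D' A : ℝ≥0∞}
    (star : ℤ → E → Set E)
    (star_volume : ∀ j z, volume (star j z) ≤ D' * V j)
    (hormander : ∀ j y z, idx j y = idx j z →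
      ∫⁻ x in (star j z)ᶜ, ‖K (x - y) - K (x - z)‖ₑ ≤ A) :
    HasCZCovers (ℤ × I) K D D' A := by
  classical
  intro f hfc hf lam hlam hlam'
  set κ := stopping idx V f lam
  have hne : ∀ c, (κ ⁻¹' {some c}).Nonempty ∨ κ ⁻¹' {some c} = ∅ :=
    fun c => (Set.eq_empty_or_nonempty _).symm
  have hmeas : ∀ c, MeasurableSet (κ ⁻¹' {some c}) := by
    intro c
    rcases hne c with ⟨x, hx⟩ | hc
    · rw [h.stopping_fiber hx]; exact h.meas _ _
    · rw [hc]; exact MeasurableSet.empty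
  set y₀ : ℤ × I → E := fun c => if hc : (κ ⁻¹' {some c}).Nonempty then hc.some else 0 with hy₀
  have hy : ∀ c, (κ ⁻¹' {some c}).Nonempty → κ (y₀ c) = some c := by
    intro c hc
    simp only [hy₀, dif_pos hc]
    exact hc.some_mem
  have hvol : ∀ c, (κ ⁻¹' {some c}).Nonempty → volume (κ ⁻¹' {some c}) = V c.1 := by
    rintro c ⟨x, hx⟩
    rw [h.stopping_fiber hx, h.vol]
  refine ⟨κ, fun c => if (κ ⁻¹' {some c}).Nonempty then star c.1 (y₀ c) else ∅, y₀,
    ?_, ?_, ?_, ?_, ?_, ?_⟩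
  · rintro (_ | c)
    · rw [← compl_compl (κ ⁻¹' {none}), ← IsCZCover.iUnion_fibers]
      exact (MeasurableSet.iUnion hmeas).compl
    · exact hmeas c
  · intro c
    rcases hne c with ⟨x, hx⟩ | hc
    · rw [hvol c ⟨x, hx⟩, h.stopping_fiber hx]
      exact (stopping_eq_some_iff.1 hx).1.le
    · simp [hc]
  · intro c
    rcases hne c with ⟨x, hx⟩ | hc
    · have h1 : ¬ heavy idx V f lam x (c.1 + 1) := fun h1 => by
        have := (stopping_eq_some_iff.1 hx).2.1 _ h1
        omega
      rw [hvol c ⟨x, hx⟩, h.stopping_fiber hx]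
      calc ∫⁻ y in idx c.1 ⁻¹' {idx c.1 x}, ‖f y‖ₑ
          ≤ ∫⁻ y in idx (c.1 + 1) ⁻¹' {idx (c.1 + 1) x}, ‖f y‖ₑ :=
            lintegral_mono_set fun y hy => h.nested _ _ _ hy
        _ ≤ lam * V (c.1 + 1) := not_lt.1 h1
        _ ≤ lam * (D * V c.1) := by gcongr; exact h.doubling _
        _ = _ := by ring
    · simp [hc]
  · intro x hx
    by_contra hcon
    obtain ⟨l, hl1, hl2⟩ := exists_between (not_le.1 hcon)
    have hU : {y | l < ‖f y‖ₑ} ∈ nhds x :=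
      hfc.enorm.continuousAt.eventually_const_lt hl2
    obtain ⟨j, hj⟩ := h.small x _ hU
    have h1 := not_lt.1 (h.stopping_eq_none hf hlam hx j)
    have h2 : l * V j ≤ ∫⁻ y in idx j ⁻¹' {idx j x}, ‖f y‖ₑ := by
      rw [← h.vol j x, ← setLIntegral_const]
      exact setLIntegral_mono' (h.meas _ _) fun y hy => le_of_lt (hj hy)
    have h3 := h2.trans h1
    rw [ENNReal.mul_le_mul_iff_left (h.pos j) (h.ne_top j)] at h3
    exact not_lt.2 h3 hl1
  · intro c
    split_ifs with hc
    · rw [hvol c hc]; exact star_volume _ _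
    · simp
  · intro c y hyc
    rw [if_pos ⟨y, hyc⟩]
    refine hormander _ _ _ ?_
    have h1 := (stopping_eq_some_iff.1 hyc).2.2
    have h2 := (stopping_eq_some_iff.1 (hy c ⟨y, hyc⟩)).2.2
    rw [h1, h2]

end IsDyadicGrid
end Dyadic

section ParabolicBoxes

variable {n : ℕ}

lemma norm_le_sum_abs (X : Rn n) : ‖X‖ ≤ ∑ k, |X k| := by
  conv_lhs => rw [← (EuclideanSpace.basisFun (Fin n) ℝ).sum_repr X]
  refine (norm_sum_le _ _).trans (Finset.sum_le_sum fun k _ => ?_)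
  rw [norm_smul]
  simp

lemma abs_apply_le_norm (X : Rn n) (k : Fin n) : |X k| ≤ ‖X‖ := by
  simpa using PiLp.norm_apply_le X k

lemma measurableSet_prod_pi {S : Fin n → Set ℝ} {T : Set ℝ} (hS : ∀ k, MeasurableSet (S k))
    (hT : MeasurableSet T) : MeasurableSet {x : Rn1 n | (∀ k, x.1 k ∈ S k) ∧ x.2 ∈ T} := by
  have h1 : ∀ k, Measurable fun x : Rn1 n => x.1 k := fun k => by fun_prop
  have : {x : Rn1 n | (∀ k, x.1 k ∈ S k) ∧ x.2 ∈ T} =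
      (⋂ k, (fun x : Rn1 n => x.1 k) ⁻¹' S k) ∩ (fun x : Rn1 n => x.2) ⁻¹' T := by
    ext x; simp
  rw [this]
  exact (MeasurableSet.iInter fun k => h1 k (hS k)).inter (measurable_snd hT)

lemma volume_prod_pi {S : Fin n → Set ℝ} {T : Set ℝ} (hS : ∀ k, MeasurableSet (S k)) :
    volume {x : Rn1 n | (∀ k, x.1 k ∈ S k) ∧ x.2 ∈ T} = (∏ k, volume (S k)) * volume T := by
  have : {x : Rn1 n | (∀ k, x.1 k ∈ S k) ∧ x.2 ∈ T} =
      ((WithLp.ofLp : Rn n → (Fin n → ℝ)) ⁻¹' Set.univ.pi S) ×ˢ T := by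
    ext x; simp
  rw [this, Measure.volume_eq_prod, Measure.prod_prod,
    (PiLp.volume_preserving_ofLp (Fin n)).measure_preimage
      (MeasurableSet.univ_pi hS).nullMeasurableSet, volume_pi_pi]

instance : (volume : Measure (Rn1 n)).IsAddHaarMeasure := by
  rw [Measure.volume_eq_prod]; infer_instance

/-- The index of the parabolic dyadic cube of generation `j` containing a point. -/
def parIdx (n : ℕ) (j : ℤ) (x : Rn1 n) : (Fin n → ℤ) × ℤ :=
  (fun k => ⌊x.1 k / (2 : ℝ) ^ j⌋, ⌊x.2 / (4 : ℝ) ^ j⌋)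

/-- The volume of the parabolic dyadic cubes of generation `j`. -/
def parVol (n : ℕ) (j : ℤ) : ℝ≥0∞ := ENNReal.ofReal (2 ^ j) ^ n * ENNReal.ofReal (4 ^ j)

lemma floor_div_eq_iff {a x : ℝ} (ha : 0 < a) (i : ℤ) :
    ⌊x / a⌋ = i ↔ x ∈ Set.Ico (i * a) (i * a + a) := by
  rw [Int.floor_eq_iff, le_div_iff₀ ha, div_lt_iff₀ ha, Set.mem_Ico, add_mul, one_mul]

lemma parIdx_preimage (j : ℤ) (i : (Fin n → ℤ) × ℤ) :
    parIdx n j ⁻¹' {i} = {x | (∀ k, x.1 k ∈ Set.Ico (i.1 k * (2 : ℝ) ^ j) (i.1 k * 2 ^ j + 2 ^ j)) ∧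
      x.2 ∈ Set.Ico (i.2 * (4 : ℝ) ^ j) (i.2 * 4 ^ j + 4 ^ j)} := by
  ext x
  simp only [Set.mem_preimage, Set.mem_singleton_iff, parIdx, Prod.ext_iff, funext_iff,
    Set.mem_ofPred_eq]
  rw [floor_div_eq_iff (by positivity)]
  simp_rw [floor_div_eq_iff (show (0 : ℝ) < 2 ^ j by positivity)]

lemma abs_sub_lt_of_floor_div_eq {a x y : ℝ} (ha : 0 < a) (h : ⌊x / a⌋ = ⌊y / a⌋) :
    |x - y| < a := by
  have := Int.abs_sub_lt_one_of_floor_eq_floor h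
  rwa [← sub_div, abs_div, abs_of_pos ha, div_lt_one ha] at this

lemma floor_div_mul_eq {a x y : ℝ} (m : ℕ) (h : ⌊x / a⌋ = ⌊y / a⌋) :
    ⌊x / (a * m)⌋ = ⌊y / (a * m)⌋ := by
  rw [← div_div, ← div_div, Int.floor_div_natCast, Int.floor_div_natCast, h]

lemma isDyadicGrid_parIdx (n : ℕ) : IsDyadicGrid (parIdx n) (parVol n) (2 ^ n * 4) where
  meas j i := by
    rw [parIdx_preimage]
    exact measurableSet_prod_pi (fun k => measurableSet_Ico) measurableSet_Ico
  nested j x y h := by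
    simp only [parIdx, Prod.ext_iff, funext_iff] at h ⊢
    have h2 : (2 : ℝ) ^ (j + 1) = 2 ^ j * (2 : ℕ) := by rw [zpow_add_one₀ (by norm_num)]; norm_num
    have h4 : (4 : ℝ) ^ (j + 1) = 4 ^ j * (4 : ℕ) := by rw [zpow_add_one₀ (by norm_num)]; norm_num
    rw [h2, h4]
    exact ⟨fun k => floor_div_mul_eq 2 (h.1 k), floor_div_mul_eq 4 h.2⟩
  vol j x := by
    rw [parIdx_preimage, volume_prod_pi fun k => measurableSet_Ico]
    simp [parVol]
  pos j := by
    have h2 : (0 : ℝ) < 2 ^ j := by positivity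
    have h4 : (0 : ℝ) < 4 ^ j := by positivity
    simp [parVol, h2, h4]
  ne_top j := by unfold parVol; finiteness
  doubling j := by
    refine le_of_eq ?_
    have h2 : ENNReal.ofReal (2 ^ (j + 1)) = 2 * ENNReal.ofReal (2 ^ j) := by
      rw [zpow_add_one₀ (by norm_num), mul_comm, ENNReal.ofReal_mul (by norm_num)]; simp
    have h4 : ENNReal.ofReal (4 ^ (j + 1)) = 4 * ENNReal.ofReal (4 ^ j) := by
      rw [zpow_add_one₀ (by norm_num), mul_comm, ENNReal.ofReal_mul (by norm_num)]; simp
    rw [parVol, parVol, h2, h4]; ring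
  large R hR := by
    obtain ⟨N, hN⟩ := pow_unbounded_of_one_lt R.toReal (show (1 : ℝ) < 4 by norm_num)
    refine ⟨N, fun j hj => ?_⟩
    have h1 : R < ENNReal.ofReal (4 ^ j) := by
      rw [ENNReal.lt_ofReal_iff_toReal_lt hR]
      refine hN.trans_le ?_
      rw [← zpow_natCast]
      exact zpow_le_zpow_right₀ (by norm_num) hj
    refine h1.trans_le ?_
    have h2 : 1 ≤ ENNReal.ofReal (2 ^ j) := by
      rw [ENNReal.one_le_ofReal]
      exact one_le_zpow₀ (by norm_num) (by omega)
    calc ENNReal.ofReal (4 ^ j) = 1 ^ n * ENNReal.ofReal (4 ^ j) := by simp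
      _ ≤ _ := by unfold parVol; gcongr
  small x U hU := by
    obtain ⟨ε, hε, hball⟩ := Metric.mem_nhds_iff.1 hU
    set δ := min 1 (ε / (n + 1)) with hδ
    have hδ0 : 0 < δ := by positivity
    obtain ⟨j, hj1, -⟩ := exists_mem_Ico_zpow hδ0 (show (1 : ℝ) < 2 by norm_num)
    refine ⟨j, fun y hy => hball ?_⟩
    simp only [Set.mem_preimage, Set.mem_singleton_iff, parIdx, Prod.ext_iff, funext_iff] at hy
    have hδε : (n + 1) * δ ≤ ε := by
      have : δ ≤ ε / (n + 1) := min_le_right _ _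
      rw [le_div_iff₀ (by positivity)] at this
      linarith
    have hjle : (2 : ℝ) ^ j ≤ δ := hj1
    have hδ1 : δ ≤ 1 := min_le_left _ _
    have h4 : (4 : ℝ) ^ j ≤ δ := by
      have : (4 : ℝ) ^ j = 2 ^ j * 2 ^ j := by rw [← mul_zpow]; norm_num
      rw [this]
      have : (0 : ℝ) < 2 ^ j := by positivity
      nlinarith
    rw [Metric.mem_ball, dist_eq_norm, Prod.norm_def, max_lt_iff]
    constructor
    · calc ‖(y - x).1‖ ≤ ∑ k, |(y - x).1 k| := norm_le_sum_abs _
        _ ≤ ∑ _k : Fin n, δ := by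
            refine Finset.sum_le_sum fun k _ => ?_
            exact (abs_sub_lt_of_floor_div_eq (by positivity) (hy.1 k)).le.trans hjle
        _ < ε := by simp; linarith
    · refine (abs_sub_lt_of_floor_div_eq (by positivity) hy.2).trans_le ?_
      have : 0 ≤ (n : ℝ) * δ := by positivity
      linarith

/-- The closed parabolic box of radius `r` centered at the origin. -/
def parBox (n : ℕ) (r : ℝ) : Set (Rn1 n) :=
  {x | (∀ k, x.1 k ∈ Set.Icc (-r) r) ∧ x.2 ∈ Set.Icc (-r ^ 2) (r ^ 2)}

lemma measurableSet_parBox (r : ℝ) : MeasurableSet (parBox n r) :=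
  measurableSet_prod_pi (fun _ => measurableSet_Icc) measurableSet_Icc

lemma neg_mem_parBox {r : ℝ} {x : Rn1 n} : -x ∈ parBox n r ↔ x ∈ parBox n r := by
  simp only [parBox, Set.mem_ofPred_eq, Prod.fst_neg, Prod.snd_neg, PiLp.neg_apply, Set.mem_Icc]
  refine and_congr (forall_congr' fun k => ?_) ?_ <;> constructor <;> rintro ⟨h1, h2⟩ <;>
    constructor <;> linarith

lemma volume_parBox (j : ℤ) : volume (parBox n (2 * 2 ^ j)) = 4 ^ n * 8 * parVol n j := by
  rw [parBox, volume_prod_pi fun _ => measurableSet_Icc]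
  have h2 : ENNReal.ofReal (2 * 2 ^ j - -(2 * 2 ^ j)) = 4 * ENNReal.ofReal (2 ^ j) := by
    rw [show (2 : ℝ) * 2 ^ j - -(2 * 2 ^ j) = 4 * 2 ^ j by ring, ENNReal.ofReal_mul (by norm_num)]
    simp
  have h4 : ENNReal.ofReal ((2 * 2 ^ j) ^ 2 - -(2 * 2 ^ j) ^ 2) = 8 * ENNReal.ofReal (4 ^ j) := by
    have : (4 : ℝ) ^ j = 2 ^ j * 2 ^ j := by rw [← mul_zpow]; norm_num
    rw [show ((2 : ℝ) * 2 ^ j) ^ 2 - -(2 * 2 ^ j) ^ 2 = 8 * 4 ^ j by rw [this]; ring,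
      ENNReal.ofReal_mul (by norm_num)]
    simp
  simp only [Real.volume_Icc, Finset.prod_const, Finset.card_univ, Fintype.card_fin]
  rw [h2, h4, parVol]; ring

/-- Hörmander's condition with respect to the parabolic boxes. -/
def IsHormander (K : Rn1 n → ℂ) (A : ℝ≥0∞) : Prop :=
  ∀ j : ℤ, ∀ w ∈ parBox n (2 ^ j), ∫⁻ x in (parBox n (2 * 2 ^ j))ᶜ, ‖K (x - w) - K x‖ₑ ≤ A

lemma IsHormander.neg {K : Rn1 n → ℂ} {A : ℝ≥0∞} (h : IsHormander K A) :
    IsHormander (fun x => K (-x)) A := by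
  classical
  intro j w hw
  have := h j (-w) (neg_mem_parBox.2 hw)
  rw [← lintegral_indicator (measurableSet_parBox _).compl] at this ⊢
  rw [← lintegral_neg_eq_self] at this
  refine (le_of_eq (lintegral_congr fun x => ?_)).trans this
  simp only [Set.indicator_apply, Set.mem_compl_iff, neg_mem_parBox]
  rw [neg_sub, sub_neg_eq_add, neg_add_eq_sub]

theorem IsHormander.hasCZCovers {K : Rn1 n → ℂ} {A : ℝ≥0∞} (h : IsHormander K A) :
    HasCZCovers (ℤ × ((Fin n → ℤ) × ℤ)) K (2 ^ n * 4) (4 ^ n * 8) A := by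
  refine (isDyadicGrid_parIdx n).hasCZCovers (fun j z => (fun x => x - z) ⁻¹' parBox n (2 * 2 ^ j))
    (fun j z => ?_)
    fun j y z hyz => ?_
  · rw [(measurePreserving_sub_right volume z).measure_preimage
      (measurableSet_parBox _).nullMeasurableSet, volume_parBox]
  · have hw : y - z ∈ parBox n (2 ^ j) := by
      simp only [parIdx, Prod.ext_iff, funext_iff] at hyz
      have h4 : (4 : ℝ) ^ j = (2 ^ j) ^ 2 := by rw [pow_two, ← mul_zpow]; norm_num
      refine ⟨fun k => abs_le.1 (abs_sub_lt_of_floor_div_eq (by positivity) (hyz.1 k)).le, ?_⟩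
      rw [← h4]
      exact abs_le.1 (abs_sub_lt_of_floor_div_eq (by positivity) hyz.2).le
    refine (le_of_eq ?_).trans (h j _ hw)
    have hms : MeasurableSet ((fun x : Rn1 n => x - z) ⁻¹' parBox n (2 * 2 ^ j)) :=
      (measurableSet_parBox _).preimage (measurable_id.sub_const z)
    rw [← lintegral_indicator (measurableSet_parBox _).compl,
      ← lintegral_indicator (hms.compl),
      ← lintegral_sub_right_eq_self
        ((parBox n (2 * 2 ^ j))ᶜ.indicator fun x => ‖K (x - (y - z)) - K x‖ₑ) z]
    classical
    refine lintegral_congr fun x => ?_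
    simp only [Set.indicator_apply, Set.mem_preimage, Set.mem_compl_iff]
    rw [sub_sub_sub_cancel_right]

end ParabolicBoxes

section ParabolicMultipliers

open scoped SchwartzMap FourierTransform LineDeriv ContDiff

/-- The `L²` product structure on `ℝⁿ × ℝ`, which is an inner product space. -/
abbrev Vn (n : ℕ) : Type := WithLp 2 (Rn n × ℝ)

/-- The identification of `ℝⁿ × ℝ` with its two product norms. -/
def eV (n : ℕ) : Vn n ≃L[ℝ] Rn1 n := WithLp.prodContinuousLinearEquiv 2 ℝ (Rn n) ℝ

/-- Transfer of Schwartz functions to the inner product structure. -/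
def toV {n : ℕ} (f : 𝓢(Rn1 n, ℂ)) : 𝓢(Vn n, ℂ) :=
  SchwartzMap.compCLMOfContinuousLinearEquiv ℂ (eV n) f

/-- Transfer of Schwartz functions from the inner product structure. -/
def ofV {n : ℕ} (f : 𝓢(Vn n, ℂ)) : 𝓢(Rn1 n, ℂ) :=
  SchwartzMap.compCLMOfContinuousLinearEquiv ℂ (eV n).symm f

lemma toV_apply {n : ℕ} (f : 𝓢(Rn1 n, ℂ)) (x : Vn n) : toV f x = f (eV n x) := rfl
lemma ofV_apply {n : ℕ} (f : 𝓢(Vn n, ℂ)) (x : Rn1 n) : ofV f x = f ((eV n).symm x) := rfl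
lemma toV_ofV {n : ℕ} (f : 𝓢(Vn n, ℂ)) : toV (ofV f) = f := by
  ext x; simp [toV_apply, ofV_apply]
lemma ofV_toV {n : ℕ} (f : 𝓢(Rn1 n, ℂ)) : ofV (toV f) = f := by
  ext x; simp [toV_apply, ofV_apply]

lemma measurePreserving_eV (n : ℕ) : MeasurePreserving (eV n) volume volume :=
  WithLp.volume_preserving_ofLp (Rn n) ℝ

lemma measurableEmbedding_eV (n : ℕ) : MeasurableEmbedding (eV n) :=
  (eV n).toHomeomorph.measurableEmbedding

lemma inner_eV {n : ℕ} (v w : Vn n) :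
    inner ℝ v w = (∑ k, (eV n v).1 k * (eV n w).1 k) + (eV n v).2 * (eV n w).2 := by
  rw [WithLp.prod_inner_apply, PiLp.inner_apply]
  simp only [eV, RCLike.inner_apply, conj_trivial]
  congr 1
  · exact Finset.sum_congr rfl fun k _ => mul_comm _ _
  · exact mul_comm _ _

/-- The Fourier transform on `ℝ^{n+1}` as a map of Schwartz functions. -/
def sFT {n : ℕ} (f : 𝓢(Rn1 n, ℂ)) : 𝓢(Rn1 n, ℂ) := ofV (𝓕 (toV f))

/-- The inverse Fourier transform on `ℝ^{n+1}` as a map of Schwartz functions. -/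
def sIFT {n : ℕ} (f : 𝓢(Rn1 n, ℂ)) : 𝓢(Rn1 n, ℂ) := ofV (𝓕⁻ (toV f))

lemma sFT_sIFT {n : ℕ} (f : 𝓢(Rn1 n, ℂ)) : sFT (sIFT f) = f := by
  simp [sFT, sIFT, toV_ofV, ofV_toV]
lemma sIFT_sFT {n : ℕ} (f : 𝓢(Rn1 n, ℂ)) : sIFT (sFT f) = f := by
  simp [sFT, sIFT, toV_ofV, ofV_toV]

lemma coe_sFT {n : ℕ} (f : 𝓢(Rn1 n, ℂ)) : ⇑(sFT f) = FT1 f := by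
  ext q
  rw [sFT, ofV_apply, SchwartzMap.fourier_coe, Real.fourier_eq, FT1,
    ← (measurePreserving_eV n).integral_comp (measurableEmbedding_eV n)]
  refine integral_congr_ae (.of_forall fun v => ?_)
  simp only [toV_apply, inner_eV, ContinuousLinearEquiv.apply_symm_apply, Circle.smul_def,
    Real.fourierChar_apply, smul_eq_mul]
  congr 2
  push_cast; ring

lemma coe_sIFT {n : ℕ} (f : 𝓢(Rn1 n, ℂ)) : ⇑(sIFT f) = IFT1 f := by
  ext q
  rw [sIFT, ofV_apply, SchwartzMap.fourierInv_coe, Real.fourierInv_eq, IFT1,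
    ← (measurePreserving_eV n).integral_comp (measurableEmbedding_eV n)]
  refine integral_congr_ae (.of_forall fun v => ?_)
  simp only [toV_apply, inner_eV, ContinuousLinearEquiv.apply_symm_apply, Circle.smul_def,
    Real.fourierChar_apply, smul_eq_mul]
  congr 2
  push_cast; ring

lemma toV_lineDeriv {n : ℕ} (f : 𝓢(Rn1 n, ℂ)) (m : Rn1 n) :
    toV (∂_{m} f) = ∂_{(eV n).symm m} (toV f) := by
  rw [toV, toV, SchwartzMap.lineDerivOp_compCLMOfContinuousLinearEquiv]
  simp

lemma sFT_lineDeriv {n : ℕ} (f : 𝓢(Rn1 n, ℂ)) (m : Rn1 n) (q : Rn1 n) :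
    sFT (∂_{m} f) q = 2 * π * Complex.I * (((∑ k, q.1 k * m.1 k) + q.2 * m.2 : ℝ) : ℂ)
      * sFT f q := by
  rw [sFT, toV_lineDeriv, SchwartzMap.fourier_lineDerivOp_eq, ofV_apply]
  rw [smul_apply, SchwartzMap.smulLeftCLM_apply_apply (by fun_prop)]
  rw [sFT, ofV_apply, inner_eV]
  simp [smul_eq_mul]
  ring

lemma dX_coe {n : ℕ} (k : Fin n) (f : 𝓢(Rn1 n, ℂ)) :
    dX k f = ⇑(∂_{((EuclideanSpace.single k 1, 0) : Rn1 n)} f : 𝓢(Rn1 n, ℂ)) := by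
  ext x; rw [SchwartzMap.lineDerivOp_apply_eq_fderiv]; rfl

lemma dT_coe {n : ℕ} (f : 𝓢(Rn1 n, ℂ)) :
    dT f = ⇑(∂_{((0, 1) : Rn1 n)} f : 𝓢(Rn1 n, ℂ)) := by
  ext x; rw [SchwartzMap.lineDerivOp_apply_eq_fderiv]; rfl

/-- `∂_{X_k}` as a map of Schwartz functions. -/
def sdX {n : ℕ} (k : Fin n) (f : 𝓢(Rn1 n, ℂ)) : 𝓢(Rn1 n, ℂ) :=
  ∂_{((EuclideanSpace.single k 1, 0) : Rn1 n)} f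

/-- `∂_t` as a map of Schwartz functions. -/
def sdT {n : ℕ} (f : 𝓢(Rn1 n, ℂ)) : 𝓢(Rn1 n, ℂ) := ∂_{((0, 1) : Rn1 n)} f

lemma coe_sdX {n : ℕ} (k : Fin n) (f : 𝓢(Rn1 n, ℂ)) : ⇑(sdX k f) = dX k f := (dX_coe k f).symm
lemma coe_sdT {n : ℕ} (f : 𝓢(Rn1 n, ℂ)) : ⇑(sdT f) = dT f := (dT_coe f).symm

lemma sFT_sdX {n : ℕ} (k : Fin n) (f : 𝓢(Rn1 n, ℂ)) (q : Rn1 n) :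
    sFT (sdX k f) q = 2 * π * Complex.I * (q.1 k : ℂ) * sFT f q := by
  rw [sdX, sFT_lineDeriv]
  simp

lemma sFT_sdT {n : ℕ} (f : 𝓢(Rn1 n, ℂ)) (q : Rn1 n) :
    sFT (sdT f) q = 2 * π * Complex.I * (q.2 : ℂ) * sFT f q := by
  rw [sdT, sFT_lineDeriv]
  simp

lemma lintegral_sFT_sq {n : ℕ} (f : 𝓢(Rn1 n, ℂ)) :
    ∫⁻ q, ‖sFT f q‖ₑ ^ 2 = ∫⁻ x, ‖f x‖ₑ ^ 2 := by
  have key : ∀ g : 𝓢(Vn n, ℂ), ∫⁻ v, ‖g v‖ₑ ^ 2 = ENNReal.ofReal (∫ v, ‖g v‖ ^ 2) := by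
    intro g
    have hi : Integrable (fun v => ‖g v‖ ^ 2) volume :=
      (g.memLp 2).integrable_norm_pow (by norm_num)
    rw [ofReal_integral_eq_lintegral_ofReal hi (.of_forall fun v => by positivity)]
    refine lintegral_congr fun v => ?_
    rw [ENNReal.ofReal_pow (norm_nonneg _), ofReal_norm]
  have h2 := SchwartzMap.integral_norm_sq_fourier (toV f)
  rw [← (measurePreserving_eV n).lintegral_comp_emb (measurableEmbedding_eV n),
    ← (measurePreserving_eV n).lintegral_comp_emb (measurableEmbedding_eV n)]
  have e1 := key (toV f)
  have e2 := key (𝓕 (toV f))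
  rw [h2, ← e1] at e2
  simpa [sFT, ofV_apply, toV_apply] using e2

/-- Convolution of Schwartz functions on `ℝ^{n+1}`. -/
def sConv {n : ℕ} (K h : 𝓢(Rn1 n, ℂ)) : 𝓢(Rn1 n, ℂ) :=
  ofV (SchwartzMap.convolution (ContinuousLinearMap.mul ℂ ℂ) (toV h) (toV K))

lemma coe_sConv {n : ℕ} (K h : 𝓢(Rn1 n, ℂ)) : ⇑(sConv K h) = kconv K h := by
  ext x
  rw [sConv, ofV_apply, SchwartzMap.convolution_apply, kconv, MeasureTheory.convolution,
    ← (measurePreserving_eV n).integral_comp (measurableEmbedding_eV n)]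
  refine integral_congr_ae (.of_forall fun v => ?_)
  simp [toV_apply, mul_comm]

lemma sFT_sConv {n : ℕ} (K h : 𝓢(Rn1 n, ℂ)) (q : Rn1 n) :
    sFT (sConv K h) q = sFT K q * sFT h q := by
  rw [sFT, sConv, toV_ofV, SchwartzMap.fourier_convolution]
  simp [ofV_apply, sFT, mul_comm]

lemma kconv_eq_inner {n : ℕ} (K : 𝓢(Rn1 n, ℂ)) (x : Rn1 n) :
    ∃ L : Lp (α := Rn1 n) ℂ 2 →L[ℂ] ℂ, ∀ (g : Rn1 n → ℂ) (hg : MemLp g 2),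
      kconv K g x = L hg.toLp := by
  have hm : MemLp (fun y => (starRingEnd ℂ) (K (x - y))) 2 := by
    have h1 : MemLp (fun y => K (x - y)) 2 :=
      (K.memLp 2).comp_measurePreserving (Measure.measurePreserving_sub_left volume x)
    exact h1.star
  refine ⟨innerSL ℂ hm.toLp, fun g hg => ?_⟩
  rw [innerSL_apply_apply, L2.inner_def, kconv]
  refine integral_congr_ae ?_
  filter_upwards [hm.coeFn_toLp, hg.coeFn_toLp] with y h1 h2
  rw [h1, h2]
  simp [mul_comm]

lemma lintegral_sq_eq_toLp {n : ℕ} {g : Rn1 n → ℂ} (hg : MemLp g 2) :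
    ∫⁻ x, ‖g x‖ₑ ^ 2 = ENNReal.ofReal ‖hg.toLp‖ ^ 2 := by
  rw [Lp.norm_toLp, ENNReal.ofReal_toReal hg.2.ne]
  rw [eLpNorm_eq_lintegral_rpow_enorm_toReal (by norm_num) (by norm_num)]
  rw [← ENNReal.rpow_natCast, ← ENNReal.rpow_mul]
  norm_num

/-- A convolution operator whose kernel has a bounded Fourier transform is bounded on `L²`. -/
theorem l2Bound_of_norm_sFT_le {n : ℕ} (K : 𝓢(Rn1 n, ℂ)) {b : ℝ} (hb : ∀ q, ‖sFT K q‖ ≤ b) :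
    L2Bound (K : Rn1 n → ℂ) (ENNReal.ofReal b ^ 2) := by
  rintro g hgm hgi ⟨R, hR⟩
  have hg : MemLp g 2 := by
    rw [memLp_two_iff_integrable_sq_norm hgi.1]
    refine (hgi.norm.const_mul R).mono' (hgi.1.norm.pow 2) (.of_forall fun x => ?_)
    rw [Real.norm_eq_abs, abs_of_nonneg (by positivity), sq]
    gcongr
    exact hR x
  have hS : ∀ h : 𝓢(Rn1 n, ℂ), ∫⁻ x, ‖kconv K h x‖ₑ ^ 2 ≤
      ENNReal.ofReal b ^ 2 * ∫⁻ x, ‖h x‖ₑ ^ 2 := by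
    intro h
    rw [← coe_sConv, ← lintegral_sFT_sq, ← lintegral_sFT_sq h,
      ← lintegral_const_mul' _ _ (by finiteness)]
    refine lintegral_mono fun q => ?_
    rw [sFT_sConv, enorm_mul, mul_pow]
    gcongr
    rw [← ofReal_norm]
    exact ENNReal.ofReal_le_ofReal (hb q)
  obtain ⟨u, hu, hlim⟩ := mem_closure_iff_seq_limit.1
    (SchwartzMap.denseRange_toLpCLM (F := ℂ) (μ := (volume : Measure (Rn1 n)))
      (p := 2) (by norm_num) hg.toLp)
  choose h hh using hu
  have hh' : ∀ i, u i = ((h i).memLp 2).toLp := fun i => (hh i).symm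
  have hpt : ∀ x, Filter.Tendsto (fun i => ‖kconv K (h i) x‖ₑ ^ 2) Filter.atTop
      (nhds (‖kconv K g x‖ₑ ^ 2)) := by
    intro x
    obtain ⟨L, hL⟩ := kconv_eq_inner K x
    have : Filter.Tendsto (fun i => kconv K (h i) x) Filter.atTop (nhds (kconv K g x)) := by
      simp_rw [hL g hg, hL _ ((h _).memLp 2), ← hh']
      exact (L.continuous.tendsto _).comp hlim
    exact (ENNReal.continuous_pow 2).tendsto _ |>.comp this.enorm
  have hnorm : Filter.Tendsto (fun i => ENNReal.ofReal b ^ 2 * ∫⁻ x, ‖h i x‖ₑ ^ 2) Filter.atTop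
      (nhds (ENNReal.ofReal b ^ 2 * ∫⁻ x, ‖g x‖ₑ ^ 2)) := by
    refine ENNReal.Tendsto.const_mul ?_ (.inr (by finiteness))
    rw [lintegral_sq_eq_toLp hg]
    simp_rw [lintegral_sq_eq_toLp ((h _).memLp 2), ← hh']
    exact (ENNReal.continuous_pow 2).tendsto _ |>.comp (ENNReal.tendsto_ofReal hlim.norm)
  calc ∫⁻ x, ‖kconv K g x‖ₑ ^ 2
      = ∫⁻ x, Filter.liminf (fun i => ‖kconv K (h i) x‖ₑ ^ 2) Filter.atTop :=
        lintegral_congr fun x => (hpt x).liminf_eq.symm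
    _ ≤ Filter.liminf (fun i => ∫⁻ x, ‖kconv K (h i) x‖ₑ ^ 2) Filter.atTop := by
        refine lintegral_liminf_le fun i => ?_
        rw [← coe_sConv]
        exact ((sConv K (h i)).continuous.measurable.enorm).pow_const _
    _ ≤ Filter.liminf (fun i => ENNReal.ofReal b ^ 2 * ∫⁻ x, ‖h i x‖ₑ ^ 2) Filter.atTop :=
        Filter.liminf_le_liminf (.of_forall fun i => hS (h i))
    _ = _ := hnorm.liminf_eq

/-- A linear automorphism rescales integrals by a constant. -/
lemma exists_scaling {E : Type*} [NormedAddCommGroup E] [NormedSpace ℝ E] [FiniteDimensional ℝ E]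
    [MeasureSpace E] [BorelSpace E] [(volume : Measure E).IsAddHaarMeasure] (e : E ≃L[ℝ] E) :
    ∃ c : ℝ, 0 < c ∧ (∀ f : E → ℂ, ∫ x, f (e x) = c * ∫ x, f x) ∧
      (∀ f : E → ℝ≥0∞, ENNReal.ofReal c * ∫⁻ x, f (e.symm x) = ∫⁻ x, f x) := by
  have hm := e.toHomeomorph.measurableEmbedding
  have hh : (Measure.map e (volume : Measure E)).IsAddHaarMeasure :=
    e.isAddHaarMeasure_map _
  have hc := Measure.isAddLeftInvariant_eq_smul (Measure.map e volume) (volume : Measure E)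
  have hc0 := Measure.addHaarScalarFactor_pos_of_isAddHaarMeasure (Measure.map e volume)
    (volume : Measure E)
  set c := Measure.addHaarScalarFactor (Measure.map e volume) (volume : Measure E)
  refine ⟨c, hc0, fun f => ?_, fun f => ?_⟩
  · have h := hm.integral_map (μ := volume) f
    change ∫ y, f y ∂(Measure.map e volume) = _ at h
    rw [hc, integral_smul_nnreal_measure] at h
    rw [← Complex.real_smul]
    exact h.symm
  · have h := hm.lintegral_map (μ := volume) (fun x => f (e.symm x))
    change ∫⁻ y, _ ∂(Measure.map e volume) = _ at h
    rw [hc, lintegral_smul_measure] at h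
    rw [ENNReal.ofReal_coe_nnreal]
    simpa [ENNReal.smul_def] using h

/-- The parabolic dilation `(X, t) ↦ (sX, s²t)`. -/
def dil (n : ℕ) (s : ℝ) (hs : s ≠ 0) : Rn1 n ≃L[ℝ] Rn1 n :=
  (ContinuousLinearEquiv.smulLeft (Units.mk0 s hs)).prodCongr
    (ContinuousLinearEquiv.smulLeft (Units.mk0 (s ^ 2) (pow_ne_zero 2 hs)))

lemma dil_apply {n : ℕ} {s : ℝ} (hs : s ≠ 0) (x : Rn1 n) :
    dil n s hs x = (s • x.1, s ^ 2 * x.2) := rfl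

lemma dil_symm_apply {n : ℕ} {s : ℝ} (hs : s ≠ 0) (x : Rn1 n) :
    (dil n s hs).symm x = (s⁻¹ • x.1, (s ^ 2)⁻¹ * x.2) := by
  rw [ContinuousLinearEquiv.symm_apply_eq, dil_apply]
  ext <;> simp [hs]

lemma dil_mem_parBox {n : ℕ} {s r : ℝ} (hs : 0 < s) (x : Rn1 n) :
    dil n s hs.ne' x ∈ parBox n (s * r) ↔ x ∈ parBox n r := by
  have h1 : ∀ a b : ℝ, ∀ c, 0 < c → ((-(c * b) ≤ c * a ∧ c * a ≤ c * b) ↔ (-b ≤ a ∧ a ≤ b)) := by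
    intro a b c hc
    rw [← mul_neg, mul_le_mul_iff_right₀ hc, mul_le_mul_iff_right₀ hc]
  simp only [parBox, Set.mem_ofPred_eq, dil_apply, Set.mem_Icc, PiLp.smul_apply, smul_eq_mul,
    mul_pow, h1 _ _ s hs, h1 _ _ (s ^ 2) (by positivity)]

/-- The kernel whose Fourier transform is a dilate of `M`. -/
def dilKer {n : ℕ} (M : 𝓢(Rn1 n, ℂ)) (s : ℝ) (hs : s ≠ 0) : 𝓢(Rn1 n, ℂ) :=
  sIFT (SchwartzMap.compCLMOfContinuousLinearEquiv ℂ (dil n s hs) M)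

lemma sFT_dilKer {n : ℕ} (M : 𝓢(Rn1 n, ℂ)) (s : ℝ) (hs : s ≠ 0) (q : Rn1 n) :
    sFT (dilKer M s hs) q = M (dil n s hs q) := by
  rw [dilKer, sFT_sIFT]; rfl

lemma exists_dilKer_apply {n : ℕ} (s : ℝ) (hs : s ≠ 0) : ∃ c : ℝ, 0 < c ∧
    (∀ (M : 𝓢(Rn1 n, ℂ)) x, dilKer M s hs x = c * sIFT M ((dil n s hs).symm x)) ∧
    (∀ f : Rn1 n → ℝ≥0∞, ENNReal.ofReal c * ∫⁻ x, f ((dil n s hs).symm x) = ∫⁻ x, f x) := by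
  obtain ⟨c, hc, h1, h2⟩ := exists_scaling (dil n s hs).symm
  obtain ⟨c', hc', h1', h2'⟩ := exists_scaling (dil n s hs)
  refine ⟨c', hc', fun M x => ?_, h2'⟩
  have h3 := h1' (fun q => Complex.exp ((2 * (π : ℂ) * Complex.I) *
      (((∑ k, ((dil n s hs).symm q).1 k * x.1 k) + ((dil n s hs).symm q).2 * x.2 : ℝ) : ℂ)) * M q)
  rw [dilKer, coe_sIFT, coe_sIFT, IFT1, IFT1]
  simp only [ContinuousLinearEquiv.symm_apply_apply] at h3
  refine h3.trans ?_
  congr 1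
  refine integral_congr_ae (.of_forall fun q => ?_)
  simp only [dil_symm_apply, PiLp.smul_apply, smul_eq_mul]
  congr 4
  congr 1
  · exact Finset.sum_congr rfl fun k _ => by ring
  · ring

lemma lintegral_compl_parBox_le {n : ℕ} (K : 𝓢(Rn1 n, ℂ)) : ∃ C : ℝ≥0∞, C ≠ ⊤ ∧
    ∀ r : ℝ, 0 < r → ∫⁻ x in (parBox n r)ᶜ, ‖K x‖ₑ ≤ C * ENNReal.ofReal r⁻¹ := by
  have hi : Integrable (fun x => (n + 1) * ‖K x‖ + (n + 1) * (‖x‖ ^ 1 * ‖K x‖)) volume :=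
    (K.integrable.norm.const_mul _).add ((K.integrable_pow_mul volume 1).const_mul _)
  refine ⟨∫⁻ x, ‖(n + 1) * ‖K x‖ + (n + 1) * (‖x‖ ^ 1 * ‖K x‖)‖ₑ, hi.2.ne, fun r hr => ?_⟩
  rw [← lintegral_mul_const' _ _ (by finiteness)]
  refine (setLIntegral_mono' (measurableSet_parBox r).compl fun x hx => ?_).trans
    (setLIntegral_le_lintegral _ _)
  have key : r ≤ (n + 1) * (1 + ‖x‖) := by
    have hn : (0:ℝ) ≤ n := Nat.cast_nonneg n
    by_contra hcon
    push Not at hcon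
    have h1 : ‖x.1‖ ≤ ‖x‖ := norm_fst_le x
    have h2 : |x.2| ≤ ‖x‖ := norm_snd_le x
    have h0 := norm_nonneg x
    refine hx ⟨fun k => ?_, ?_⟩
    · have := abs_apply_le_norm x.1 k
      exact abs_le.1 (by nlinarith)
    · refine abs_le.1 ?_
      have h3 : 1 + ‖x‖ < r := lt_of_le_of_lt (by nlinarith) hcon
      nlinarith
  rw [← ofReal_norm, ← ofReal_norm, ← ENNReal.ofReal_mul (by positivity)]
  refine ENNReal.ofReal_le_ofReal ?_
  rw [Real.norm_eq_abs, abs_of_nonneg (by positivity), ← div_eq_mul_inv, le_div_iff₀ hr]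
  nlinarith [norm_nonneg (K x)]

lemma lintegral_sub_le {n : ℕ} (K : 𝓢(Rn1 n, ℂ)) (w : Rn1 n) :
    ∫⁻ x, ‖K (x - w) - K x‖ₑ ≤ ‖w‖ₑ * ∫⁻ x, ‖fderiv ℝ K x‖ₑ := by
  have hc : Continuous (fderiv ℝ K) := (K.smooth 1).continuous_fderiv (by norm_num)
  have hpt : ∀ x, ‖K (x - w) - K x‖ₑ ≤
      ∫⁻ s in Set.Icc (0:ℝ) 1, ‖w‖ₑ * ‖fderiv ℝ K (x - s • w)‖ₑ := by
    intro x
    have hd : ∀ s : ℝ, HasDerivAt (fun s : ℝ => K (x - s • w)) (-(fderiv ℝ K (x - s • w) w)) s := by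
      intro s
      have h1 : HasDerivAt (fun s : ℝ => x - s • w) (-w) s := by
        simpa using ((hasDerivAt_id s).smul_const w).const_sub x
      have h2 := (K.hasFDerivAt (x - s • w)).comp_hasDerivAt s h1
      rw [map_neg] at h2
      exact h2
    have hcs : Continuous fun s : ℝ => -(fderiv ℝ K (x - s • w) w) := by fun_prop
    have h3 := intervalIntegral.integral_eq_sub_of_hasDerivAt (a := 0) (b := 1)
      (fun s _ => hd s) (hcs.intervalIntegrable _ _)
    simp only [one_smul, zero_smul, sub_zero] at h3
    rw [← h3, intervalIntegral.integral_of_le zero_le_one, ← integral_Icc_eq_integral_Ioc]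
    refine (enorm_integral_le_lintegral_enorm _).trans (lintegral_mono fun s => ?_)
    rw [enorm_neg, mul_comm]
    exact ContinuousLinearMap.le_opENorm _ _
  calc ∫⁻ x, ‖K (x - w) - K x‖ₑ
      ≤ ∫⁻ x, ∫⁻ s in Set.Icc (0:ℝ) 1, ‖w‖ₑ * ‖fderiv ℝ K (x - s • w)‖ₑ := lintegral_mono hpt
    _ = ∫⁻ s in Set.Icc (0:ℝ) 1, ∫⁻ x, ‖w‖ₑ * ‖fderiv ℝ K (x - s • w)‖ₑ := by
        refine lintegral_lintegral_swap (Continuous.aemeasurable ?_)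
        refine ENNReal.continuous_const_mul (by finiteness) |>.comp ?_
        refine Continuous.enorm ?_
        exact hc.comp (by fun_prop)
    _ = ∫⁻ s in Set.Icc (0:ℝ) 1, ‖w‖ₑ * ∫⁻ x, ‖fderiv ℝ K x‖ₑ := by
        refine lintegral_congr fun s => ?_
        rw [lintegral_const_mul' _ _ (by finiteness)]
        rw [lintegral_sub_right_eq_self (fun x => ‖fderiv ℝ K x‖ₑ) (s • w)]
    _ = _ := by simp

lemma sub_mem_parBox {n : ℕ} {r : ℝ} {x w : Rn1 n} (hw : w ∈ parBox n r)
    (hx : x ∉ parBox n (2 * r)) : x - w ∉ parBox n r := by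
  rintro ⟨h1, h2⟩
  refine hx ⟨fun k => ?_, ?_⟩
  · have a := h1 k
    have b := hw.1 k
    simp only [Prod.fst_sub, PiLp.sub_apply, Set.mem_Icc] at a b ⊢
    constructor <;> linarith [a.1, a.2, b.1, b.2]
  · have b := hw.2
    simp only [Prod.snd_sub, Set.mem_Icc] at h2 b ⊢
    constructor <;> nlinarith [h2.1, h2.2, b.1, b.2]

lemma norm_le_of_mem_parBox {n : ℕ} {r : ℝ} (hr : 0 < r) (hr1 : r ≤ 1) {w : Rn1 n}
    (hw : w ∈ parBox n r) : ‖w‖ ≤ (n + 1) * r := by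
  have hn : (0:ℝ) ≤ n := Nat.cast_nonneg n
  rw [Prod.norm_def, max_le_iff]
  constructor
  · calc ‖w.1‖ ≤ ∑ k, |w.1 k| := norm_le_sum_abs _
      _ ≤ ∑ _k : Fin n, r := Finset.sum_le_sum fun k _ => abs_le.2 (hw.1 k)
      _ = n * r := by simp
      _ ≤ _ := by nlinarith
  · have : |w.2| ≤ r ^ 2 := abs_le.2 hw.2
    rw [Real.norm_eq_abs]
    nlinarith

lemma lintegral_compl_parBox_sub_le {n : ℕ} (K : 𝓢(Rn1 n, ℂ)) : ∃ C : ℝ≥0∞, C ≠ ⊤ ∧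
    ∀ i : ℤ, ∀ w ∈ parBox n ((2:ℝ) ^ i),
      ∫⁻ x in (parBox n (2 * (2:ℝ) ^ i))ᶜ, ‖K (x - w) - K x‖ₑ
        ≤ C * ENNReal.ofReal ((2:ℝ) ^ (-|i|)) := by
  obtain ⟨C1, hC1, h1⟩ := lintegral_compl_parBox_le K
  have hdi : Integrable (fderiv ℝ K) volume := (SchwartzMap.fderivCLM ℝ (Rn1 n) ℂ K).integrable
  refine ⟨2 * C1 + ENNReal.ofReal (n + 1) * ∫⁻ x, ‖fderiv ℝ K x‖ₑ, ?_, fun i w hw => ?_⟩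
  · have := hdi.2.ne
    finiteness
  have hr : (0:ℝ) < (2:ℝ) ^ i := by positivity
  rcases le_total i 0 with hi | hi
  · rw [abs_of_nonpos hi, neg_neg]
    calc ∫⁻ x in (parBox n (2 * (2:ℝ) ^ i))ᶜ, ‖K (x - w) - K x‖ₑ
        ≤ ∫⁻ x, ‖K (x - w) - K x‖ₑ := setLIntegral_le_lintegral _ _
      _ ≤ ‖w‖ₑ * ∫⁻ x, ‖fderiv ℝ K x‖ₑ := lintegral_sub_le K w
      _ ≤ ENNReal.ofReal ((n + 1) * (2:ℝ) ^ i) * ∫⁻ x, ‖fderiv ℝ K x‖ₑ := by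
          gcongr
          rw [← ofReal_norm]
          exact ENNReal.ofReal_le_ofReal (norm_le_of_mem_parBox hr
            (zpow_le_one_of_nonpos₀ (by norm_num) hi) hw)
      _ = (ENNReal.ofReal (n + 1) * ∫⁻ x, ‖fderiv ℝ K x‖ₑ) * ENNReal.ofReal ((2:ℝ) ^ i) := by
          rw [ENNReal.ofReal_mul (by positivity)]; ring
      _ ≤ _ := by gcongr; exact le_add_self
  · rw [abs_of_nonneg hi]
    have hshift : ∫⁻ x in (parBox n (2 * (2:ℝ) ^ i))ᶜ, ‖K (x - w)‖ₑ
        ≤ ∫⁻ x in (parBox n ((2:ℝ) ^ i))ᶜ, ‖K x‖ₑ := by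
      rw [← lintegral_indicator (measurableSet_parBox _).compl,
        ← lintegral_indicator (measurableSet_parBox _).compl,
        ← lintegral_sub_right_eq_self (((parBox n ((2:ℝ) ^ i))ᶜ).indicator fun x => ‖K x‖ₑ) w]
      refine lintegral_mono fun x => ?_
      by_cases hx : x ∈ parBox n (2 * (2:ℝ) ^ i)
      · simp [hx]
      · simp [hx, sub_mem_parBox hw hx]
    have hmono : ∫⁻ x in (parBox n (2 * (2:ℝ) ^ i))ᶜ, ‖K x‖ₑ
        ≤ ∫⁻ x in (parBox n ((2:ℝ) ^ i))ᶜ, ‖K x‖ₑ := by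
      have h0 : (0 : Rn1 n) ∈ parBox n ((2:ℝ) ^ i) := by
        refine ⟨fun k => ?_, ?_⟩ <;> simp [Set.mem_Icc] <;> positivity
      refine lintegral_mono_set fun x hx => ?_
      simpa using sub_mem_parBox h0 hx
    have hb := h1 _ hr
    calc ∫⁻ x in (parBox n (2 * (2:ℝ) ^ i))ᶜ, ‖K (x - w) - K x‖ₑ
        ≤ ∫⁻ x in (parBox n (2 * (2:ℝ) ^ i))ᶜ, (‖K (x - w)‖ₑ + ‖K x‖ₑ) :=
          lintegral_mono fun x => enorm_sub_le
      _ = (∫⁻ x in (parBox n (2 * (2:ℝ) ^ i))ᶜ, ‖K (x - w)‖ₑ)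
          + ∫⁻ x in (parBox n (2 * (2:ℝ) ^ i))ᶜ, ‖K x‖ₑ :=
          lintegral_add_right _ K.continuous.measurable.enorm
      _ ≤ C1 * ENNReal.ofReal ((2:ℝ) ^ i)⁻¹ + C1 * ENNReal.ofReal ((2:ℝ) ^ i)⁻¹ := by
          gcongr
          · exact hshift.trans hb
          · exact hmono.trans hb
      _ = 2 * C1 * ENNReal.ofReal ((2:ℝ) ^ (-i)) := by rw [zpow_neg]; ring
      _ ≤ _ := by gcongr; exact le_self_add

lemma lintegral_dilKer_sub {n : ℕ} (M : 𝓢(Rn1 n, ℂ)) {s R : ℝ} (hs : 0 < s) (w : Rn1 n) :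
    ∫⁻ x in (parBox n (s * R))ᶜ, ‖dilKer M s hs.ne' (x - w) - dilKer M s hs.ne' x‖ₑ
      = ∫⁻ x in (parBox n R)ᶜ,
        ‖sIFT M (x - (dil n s hs.ne').symm w) - sIFT M x‖ₑ := by
  obtain ⟨c, hc, h1, h2⟩ := exists_dilKer_apply (n := n) s hs.ne'
  rw [← lintegral_indicator (measurableSet_parBox _).compl,
    ← lintegral_indicator (measurableSet_parBox _).compl,
    ← h2 (((parBox n R)ᶜ).indicator fun x =>
      ‖sIFT M (x - (dil n s hs.ne').symm w) - sIFT M x‖ₑ),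
    ← lintegral_const_mul' _ _ (by finiteness)]
  refine lintegral_congr fun x => ?_
  have hx : x ∈ parBox n (s * R) ↔ (dil n s hs.ne').symm x ∈ parBox n R := by
    rw [← dil_mem_parBox (r := R) hs, ContinuousLinearEquiv.apply_symm_apply]
  by_cases hxm : x ∈ parBox n (s * R)
  · simp [hxm, hx.1 hxm]
  · have hxm' : (dil n s hs.ne').symm x ∈ (parBox n R)ᶜ := fun h => hxm (hx.2 h)
    rw [Set.indicator_of_mem (Set.mem_compl hxm), Set.indicator_of_mem hxm', h1, h1, ← mul_sub,
      enorm_mul, map_sub]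
    congr 1
    rw [← ofReal_norm]
    simp [abs_of_pos hc]

lemma tsum_two_zpow_neg_abs_sub (j : ℤ) :
    ∑' i : ℤ, ENNReal.ofReal ((2:ℝ) ^ (-|j - i|))
      = ∑' i : ℤ, ENNReal.ofReal ((2:ℝ) ^ (-|i|)) :=
  (Equiv.subLeft j).tsum_eq (fun i : ℤ => ENNReal.ofReal ((2:ℝ) ^ (-|i|)))

lemma tsum_two_zpow_neg_abs_ne_top : ∑' i : ℤ, ENNReal.ofReal ((2:ℝ) ^ (-|i|)) ≠ ⊤ := by
  have hg : Summable fun m : ℕ => (2:ℝ) ^ (-(m:ℤ)) := by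
    simpa using summable_geometric_two
  have h : Summable fun i : ℤ => (2:ℝ) ^ (-|i|) := by
    refine Summable.of_nat_of_neg ?_ ?_
    · simpa using hg
    · simpa using hg
  exact h.tsum_ofReal_ne_top

/-- The sum of the dyadic dilates of a kernel. -/
def sumKer {n : ℕ} (M : 𝓢(Rn1 n, ℂ)) (s : Finset ℤ) : 𝓢(Rn1 n, ℂ) :=
  ∑ i ∈ s, dilKer M ((2:ℝ) ^ i) (by positivity)

theorem exists_isHormander_sumKer {n : ℕ} (M : 𝓢(Rn1 n, ℂ)) :
    ∃ A : ℝ≥0∞, A ≠ ⊤ ∧ ∀ s : Finset ℤ, IsHormander (sumKer M s : Rn1 n → ℂ) A := by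
  obtain ⟨C, hC, h⟩ := lintegral_compl_parBox_sub_le (sIFT M)
  refine ⟨C * ∑' i : ℤ, ENNReal.ofReal ((2:ℝ) ^ (-|i|)),
    ENNReal.mul_ne_top hC tsum_two_zpow_neg_abs_ne_top, fun s j w hw => ?_⟩
  have hi : ∀ i : ℤ, ∫⁻ x in (parBox n (2 * (2:ℝ) ^ j))ᶜ,
      ‖dilKer M ((2:ℝ) ^ i) (by positivity) (x - w) - dilKer M ((2:ℝ) ^ i) (by positivity) x‖ₑ
        ≤ C * ENNReal.ofReal ((2:ℝ) ^ (-|j - i|)) := by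
    intro i
    have e : (2:ℝ) ^ j = (2:ℝ) ^ i * (2:ℝ) ^ (j - i) := by
      rw [← zpow_add₀ (by norm_num)]; congr 1; ring
    have hpos : (0:ℝ) < (2:ℝ) ^ i := by positivity
    rw [show 2 * (2:ℝ) ^ j = (2:ℝ) ^ i * (2 * (2:ℝ) ^ (j - i)) by rw [e]; ring,
      lintegral_dilKer_sub M hpos]
    refine h _ _ ?_
    rw [← dil_mem_parBox hpos, ContinuousLinearEquiv.apply_symm_apply, ← e]
    exact hw
  calc ∫⁻ x in (parBox n (2 * (2:ℝ) ^ j))ᶜ, ‖sumKer M s (x - w) - sumKer M s x‖ₑ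
      ≤ ∫⁻ x in (parBox n (2 * (2:ℝ) ^ j))ᶜ, ∑ i ∈ s,
        ‖dilKer M ((2:ℝ) ^ i) (by positivity) (x - w)
          - dilKer M ((2:ℝ) ^ i) (by positivity) x‖ₑ := by
        refine lintegral_mono fun x => ?_
        rw [sumKer, sum_apply, sum_apply, ← Finset.sum_sub_distrib]
        exact enorm_sum_le _ _
    _ = ∑ i ∈ s, ∫⁻ x in (parBox n (2 * (2:ℝ) ^ j))ᶜ,
        ‖dilKer M ((2:ℝ) ^ i) (by positivity) (x - w)
          - dilKer M ((2:ℝ) ^ i) (by positivity) x‖ₑ := by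
        refine lintegral_finsetSum' _ fun i _ => ?_
        refine (Continuous.enorm ?_).aemeasurable
        have := (dilKer M ((2:ℝ) ^ i) (by positivity)).continuous
        fun_prop
    _ ≤ ∑ i ∈ s, C * ENNReal.ofReal ((2:ℝ) ^ (-|j - i|)) := Finset.sum_le_sum fun i _ => hi i
    _ ≤ ∑' i, C * ENNReal.ofReal ((2:ℝ) ^ (-|j - i|)) := ENNReal.sum_le_tsum _
    _ = _ := by rw [ENNReal.tsum_mul_left, tsum_two_zpow_neg_abs_sub]

lemma sFT_add {n : ℕ} (f g : 𝓢(Rn1 n, ℂ)) : sFT (f + g) = sFT f + sFT g := by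
  simp [sFT, toV, ofV, FourierTransform.fourier_add]

lemma sFT_zero {n : ℕ} : sFT (0 : 𝓢(Rn1 n, ℂ)) = 0 := by
  simpa using sFT_add (0 : 𝓢(Rn1 n, ℂ)) 0

lemma sFT_smul {n : ℕ} (c : ℂ) (f : 𝓢(Rn1 n, ℂ)) : sFT (c • f) = c • sFT f := by
  simp [sFT, toV, ofV, FourierTransform.fourier_smul]

lemma sFT_sum {n : ℕ} {ι : Type*} (s : Finset ι) (f : ι → 𝓢(Rn1 n, ℂ)) :
    sFT (∑ i ∈ s, f i) = ∑ i ∈ s, sFT (f i) := by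
  classical
  induction s using Finset.induction_on with
  | empty => simp [sFT_zero]
  | insert a s ha ih => rw [Finset.sum_insert ha, Finset.sum_insert ha, sFT_add, ih]

lemma sFT_sumKer {n : ℕ} (M : 𝓢(Rn1 n, ℂ)) (s : Finset ℤ) (q : Rn1 n) :
    sFT (sumKer M s) q = ∑ i ∈ s, M (dil n ((2:ℝ) ^ i) (by positivity) q) := by
  rw [sumKer, sFT_sum, sum_apply]
  simp [sFT_dilKer]

lemma exists_bound_schwartz {n : ℕ} (f : 𝓢(Rn1 n, ℂ)) : ∃ R : ℝ, ∀ x, ‖f x‖ ≤ R :=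
  ⟨SchwartzMap.seminorm ℝ 0 0 f, fun x => f.norm_le_seminorm ℝ x⟩

/-- Reflection of Schwartz functions. -/
def sNeg {n : ℕ} (f : 𝓢(Rn1 n, ℂ)) : 𝓢(Rn1 n, ℂ) :=
  SchwartzMap.compCLMOfContinuousLinearEquiv ℂ (ContinuousLinearEquiv.neg ℝ) f

lemma coe_sNeg {n : ℕ} (f : 𝓢(Rn1 n, ℂ)) : ⇑(sNeg f) = fun x => f (-x) := rfl

lemma sFT_sNeg {n : ℕ} (f : 𝓢(Rn1 n, ℂ)) (q : Rn1 n) : sFT (sNeg f) q = sFT f (-q) := by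
  rw [coe_sFT, coe_sFT, FT1, FT1, ← integral_neg_eq_self]
  simp [coe_sNeg]

/-- Kernels with bounded Fourier transform satisfying Hörmander's condition are uniformly bounded
on `Lᵖ`. -/
theorem exists_lintegral_kconv_schwartz_le {n : ℕ} {A : ℝ≥0∞} (hA : A ≠ ⊤) {p : ℝ} (hp : 1 < p) :
    ∃ C : ℝ≥0∞, C ≠ ⊤ ∧ ∀ K : 𝓢(Rn1 n, ℂ), IsHormander (K : Rn1 n → ℂ) A →
      (∀ q, ‖sFT K q‖ ≤ 1) → ∀ f : 𝓢(Rn1 n, ℂ),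
        ∫⁻ x, ‖kconv K f x‖ₑ ^ p ≤ C * ∫⁻ x, ‖f x‖ₑ ^ p := by
  obtain ⟨C, hC, h⟩ := exists_lintegral_kconv_rpow_le (E := Rn1 n) (ℤ × ((Fin n → ℤ) × ℤ))
    (D := 2 ^ n * 4) (D' := 4 ^ n * 8) (B := ENNReal.ofReal 1 ^ 2) (by finiteness) (by finiteness)
    hA (by finiteness) hp
  refine ⟨C, hC, fun K hK hb f => h K K.continuous (exists_bound_schwartz K) K.integrable
    hK.hasCZCovers hK.neg.hasCZCovers (l2Bound_of_norm_sFT_le K hb) ?_ f f.continuous f.integrable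
    (exists_bound_schwartz f)⟩
  rw [← coe_sNeg]
  exact l2Bound_of_norm_sFT_le _ fun q => by rw [sFT_sNeg]; exact hb _

/-- A smooth cutoff function. -/
def cutBump (n : ℕ) : ContDiffBump (0 : Rn1 n) := ⟨1, 2, by norm_num, by norm_num⟩

/-- The localisation of `m` to a parabolic annulus. -/
def annSymbol {n : ℕ} (m : Rn1 n → ℂ) (q : Rn1 n) : ℂ :=
  m q * ((cutBump n q - cutBump n (dil n 2 two_ne_zero q) : ℝ) : ℂ)

lemma annSymbol_hasCompactSupport {n : ℕ} (m : Rn1 n → ℂ) : HasCompactSupport (annSymbol m) := by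
  refine HasCompactSupport.mul_left ?_
  have h1 : HasCompactSupport (cutBump n) := (cutBump n).hasCompactSupport
  have h2 : HasCompactSupport fun q => cutBump n (dil n 2 two_ne_zero q) :=
    h1.comp_homeomorph (dil n 2 two_ne_zero).toHomeomorph
  have h3 := (h1.sub h2).comp_left (g := fun x : ℝ => (x : ℂ)) (by simp)
  exact h3

lemma annSymbol_contDiff {n : ℕ} {m : Rn1 n → ℂ} (hm : ∀ q, q ≠ 0 → ContDiffAt ℝ ∞ m q) :
    ContDiff ℝ ∞ (annSymbol m) := by
  rw [contDiff_iff_contDiffAt]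
  intro q
  have hχ : ContDiff ℝ ∞ (cutBump n) := (cutBump n).contDiff
  by_cases hq : q = 0
  · subst hq
    have hz : annSymbol m =ᶠ[nhds 0] fun _ => (0:ℂ) := by
      have e1 : ∀ᶠ q in nhds (0 : Rn1 n), cutBump n q = 1 := (cutBump n).eventuallyEq_one
      have e2 : ∀ᶠ q in nhds (0 : Rn1 n), cutBump n (dil n 2 two_ne_zero q) = 1 := by
        have := (dil n 2 two_ne_zero).continuous.tendsto 0
        rw [map_zero] at this
        exact this.eventually e1
      filter_upwards [e1, e2] with q h1 h2
      simp [annSymbol, h1, h2]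
    exact contDiffAt_const.congr_of_eventuallyEq hz
  · refine (hm q hq).mul ?_
    refine ContDiff.contDiffAt ?_
    refine Complex.ofRealCLM.contDiff.comp (hχ.sub (hχ.comp (dil n 2 two_ne_zero).contDiff))

/-- The localised symbol as a Schwartz function. -/
def annSchwartz {n : ℕ} (m : Rn1 n → ℂ) (hm : ∀ q, q ≠ 0 → ContDiffAt ℝ ∞ m q) : 𝓢(Rn1 n, ℂ) :=
  (annSymbol_hasCompactSupport m).toSchwartzMap (annSymbol_contDiff hm)

lemma annSchwartz_apply {n : ℕ} (m : Rn1 n → ℂ) (hm : ∀ q, q ≠ 0 → ContDiffAt ℝ ∞ m q)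
    (q : Rn1 n) : annSchwartz m hm q = annSymbol m q := rfl

/-- The integers `-N, …, N - 1`. -/
def intBlock (N : ℕ) : Finset ℤ :=
  (Finset.range (2 * N)).map ⟨fun k : ℕ => (k : ℤ) - N, fun a b h => by simpa using h⟩

lemma sum_intBlock (N : ℕ) (a : ℤ → ℝ) :
    ∑ i ∈ intBlock N, (a i - a (i + 1)) = a (-N) - a N := by
  rw [intBlock, Finset.sum_map]
  have := Finset.sum_range_sub' (fun k : ℕ => a ((k:ℤ) - N)) (2 * N)
  rw [show a (-N) = a (((0:ℕ):ℤ) - N) by simp,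
    show a N = a (((2 * N : ℕ):ℤ) - N) by congr 1; push_cast; ring, ← this]
  refine Finset.sum_congr rfl fun k _ => ?_
  change a ((k:ℤ) - N) - a ((k:ℤ) - N + 1) = _
  congr 2
  push_cast; ring

lemma dil_two_zpow {n : ℕ} (i : ℤ) (q : Rn1 n) :
    dil n 2 two_ne_zero (dil n ((2:ℝ) ^ i) (by positivity) q)
      = dil n ((2:ℝ) ^ (i + 1)) (by positivity) q := by
  simp only [dil_apply, smul_smul, zpow_add₀ (two_ne_zero' ℝ), zpow_one]
  refine Prod.ext ?_ ?_
  · rw [mul_comm]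
  · ring

/-- The cutoff to a large parabolic annulus. -/
def cutAnn (n : ℕ) (N : ℕ) (q : Rn1 n) : ℝ :=
  cutBump n (dil n ((2:ℝ) ^ (-N : ℤ)) (by positivity) q) -
    cutBump n (dil n ((2:ℝ) ^ (N : ℤ)) (by positivity) q)

lemma abs_cutAnn_le (n N : ℕ) (q : Rn1 n) : |cutAnn n N q| ≤ 1 := by
  rw [cutAnn, abs_le]
  have h1 := (cutBump n).nonneg (x := dil n ((2:ℝ) ^ (-N : ℤ)) (by positivity) q)
  have h2 := (cutBump n).le_one (x := dil n ((2:ℝ) ^ (-N : ℤ)) (by positivity) q)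
  have h3 := (cutBump n).nonneg (x := dil n ((2:ℝ) ^ (N : ℤ)) (by positivity) q)
  have h4 := (cutBump n).le_one (x := dil n ((2:ℝ) ^ (N : ℤ)) (by positivity) q)
  constructor <;> linarith

lemma tendsto_cutAnn {n : ℕ} {q : Rn1 n} (hq : q ≠ 0) :
    Filter.Tendsto (fun N : ℕ => cutAnn n N q) Filter.atTop (nhds 1) := by
  have h2 : Filter.Tendsto (fun N : ℕ => (2:ℝ) ^ (N:ℤ)) Filter.atTop Filter.atTop := by
    simpa using tendsto_pow_atTop_atTop_of_one_lt (one_lt_two (α := ℝ))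
  have h3 : Filter.Tendsto (fun N : ℕ => (2:ℝ) ^ (-N:ℤ)) Filter.atTop (nhds 0) := by
    simpa [Function.comp_def] using tendsto_inv_atTop_zero.comp h2
  have e1 : ∀ᶠ N : ℕ in Filter.atTop,
      cutBump n (dil n ((2:ℝ) ^ (-N : ℤ)) (by positivity) q) = 1 := by
    have ht : Filter.Tendsto (fun N : ℕ => dil n ((2:ℝ) ^ (-N : ℤ)) (by positivity) q)
        Filter.atTop (nhds 0) := by
      simp only [dil_apply]
      have := (h3.smul_const q.1).prodMk_nhds ((h3.pow 2).mul_const q.2)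
      simp only [zero_smul, ne_eq, OfNat.ofNat_ne_zero, not_false_eq_true, zero_pow,
        zero_mul] at this
      exact this
    exact ht.eventually (cutBump n).eventuallyEq_one
  have e2 : ∀ᶠ N : ℕ in Filter.atTop,
      cutBump n (dil n ((2:ℝ) ^ (N : ℤ)) (by positivity) q) = 0 := by
    have hpos : 0 < ‖q‖ := norm_pos_iff.2 hq
    filter_upwards [h2.eventually_ge_atTop (2 / ‖q‖), h2.eventually_ge_atTop 1] with N hN hN1
    refine (cutBump n).zero_of_le_dist ?_
    rw [dist_zero_right]
    change 2 ≤ _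
    rw [div_le_iff₀ hpos] at hN
    refine hN.trans ?_
    have hs : (0:ℝ) ≤ (2:ℝ) ^ (N:ℤ) := by positivity
    rw [dil_apply, Prod.norm_def, Prod.norm_def, mul_max_of_nonneg _ _ hs]
    refine max_le_max ?_ ?_
    · simp [norm_smul]
    · dsimp only
      rw [norm_mul, Real.norm_of_nonneg (by positivity : (0:ℝ) ≤ ((2:ℝ) ^ (N:ℤ)) ^ 2)]
      gcongr
      nlinarith
  refine tendsto_const_nhds.congr' ?_
  filter_upwards [e1, e2] with N h1 h2
  rw [cutAnn, h1, h2]; norm_num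

lemma sFT_sumKer_annSchwartz {n : ℕ} {m : Rn1 n → ℂ} (hm : ∀ q, q ≠ 0 → ContDiffAt ℝ ∞ m q)
    (hhom : ∀ (s : ℝ) (hs : 0 < s) q, m (dil n s hs.ne' q) = m q) (N : ℕ) (q : Rn1 n) :
    sFT (sumKer (annSchwartz m hm) (intBlock N)) q = m q * (cutAnn n N q : ℂ) := by
  rw [sFT_sumKer]
  simp only [annSchwartz_apply, annSymbol, dil_two_zpow]
  rw [cutAnn, ← sum_intBlock N fun i => cutBump n (dil n ((2:ℝ) ^ i) (by positivity) q),
    Complex.ofReal_sum, Finset.mul_sum]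
  refine Finset.sum_congr rfl fun i _ => ?_
  rw [hhom _ (by positivity)]

/-- A bounded parabolically homogeneous smooth multiplier is bounded on `Lᵖ`. -/
theorem exists_multiplier_bound {n : ℕ} {m : Rn1 n → ℂ} (hm : ∀ q, q ≠ 0 → ContDiffAt ℝ ∞ m q)
    (hhom : ∀ (s : ℝ) (hs : 0 < s) q, m (dil n s hs.ne' q) = m q) (hb : ∀ q, ‖m q‖ ≤ 1)
    {p : ℝ} (hp : 1 < p) :
    ∃ C : ℝ≥0∞, C ≠ ⊤ ∧ ∀ v w : 𝓢(Rn1 n, ℂ), (∀ q, sFT w q = m q * sFT v q) → sFT w 0 = 0 →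
      ∫⁻ x, ‖w x‖ₑ ^ p ≤ C * ∫⁻ x, ‖v x‖ₑ ^ p := by
  obtain ⟨A, hA, hH⟩ := exists_isHormander_sumKer (annSchwartz m hm)
  obtain ⟨C, hC, h⟩ := exists_lintegral_kconv_schwartz_le (n := n) hA hp
  refine ⟨C, hC, fun v w hw hw0 => ?_⟩
  set K : ℕ → 𝓢(Rn1 n, ℂ) := fun N => sumKer (annSchwartz m hm) (intBlock N) with hKdef
  have hK : ∀ N q, sFT (K N) q = m q * (cutAnn n N q : ℂ) :=
    fun N q => sFT_sumKer_annSchwartz hm hhom N q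
  have hKb : ∀ N q, ‖sFT (K N) q‖ ≤ 1 := by
    intro N q
    rw [hK, norm_mul]
    refine mul_le_one₀ (hb q) (norm_nonneg _) ?_
    simpa using abs_cutAnn_le n N q
  have hpt : ∀ x, Filter.Tendsto (fun N => kconv (K N) v x) Filter.atTop (nhds (w x)) := by
    intro x
    have e1 : ∀ N, kconv (K N) v x = ∫ q : Rn1 n, Complex.exp ((2 * (π : ℂ) * Complex.I) *
      (((∑ k, q.1 k * x.1 k) + q.2 * x.2 : ℝ) : ℂ)) * ((cutAnn n N q : ℂ) * sFT w q) := by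
      intro N
      rw [← coe_sConv, ← sIFT_sFT (sConv (K N) v), coe_sIFT, IFT1]
      refine integral_congr_ae (.of_forall fun q => ?_)
      simp only [sFT_sConv, hK, hw]
      ring
    simp_rw [e1]
    rw [← sIFT_sFT w, coe_sIFT, IFT1]
    simp only [sFT_sIFT]
    have hnorm : ∀ (q : Rn1 n), ‖Complex.exp ((2 * (π : ℂ) * Complex.I) *
      (((∑ k, q.1 k * x.1 k) + q.2 * x.2 : ℝ) : ℂ))‖ = 1 := by
      intro q
      rw [show (2 * (π : ℂ) * Complex.I) * (((∑ k, q.1 k * x.1 k) + q.2 * x.2 : ℝ) : ℂ)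
        = ((2 * π * ((∑ k, q.1 k * x.1 k) + q.2 * x.2) : ℝ) : ℂ) * Complex.I by push_cast; ring]
      exact Complex.norm_exp_ofReal_mul_I _
    have hχc : Continuous (cutBump n) := (cutBump n).continuous
    refine tendsto_integral_of_dominated_convergence (fun q => ‖sFT w q‖) (fun N => ?_)
      (sFT w).integrable.norm (fun N => .of_forall fun q => ?_) (.of_forall fun q => ?_)
    · refine Continuous.aestronglyMeasurable ?_
      have := (sFT w).continuous
      have hcut : Continuous fun q => cutAnn n N q := by
        unfold cutAnn
        exact (hχc.comp (dil n _ _).continuous).sub (hχc.comp (dil n _ _).continuous)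
      fun_prop
    · rw [norm_mul, hnorm, one_mul, norm_mul]
      refine mul_le_of_le_one_left (norm_nonneg _) ?_
      simpa using abs_cutAnn_le n N q
    · by_cases hq : q = 0
      · simp [hq, hw0]
      · refine Filter.Tendsto.const_mul _ ?_
        have h1 := (Complex.continuous_ofReal.tendsto _).comp (tendsto_cutAnn hq)
        simpa using h1.mul_const (sFT w q)
  have hp0 : 0 < p := by linarith
  have hpt' : ∀ x, Filter.Tendsto (fun N => ‖kconv (K N) v x‖ₑ ^ p) Filter.atTop
      (nhds (‖w x‖ₑ ^ p)) := fun x =>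
    (ENNReal.continuous_rpow_const.tendsto _).comp (hpt x).enorm
  calc ∫⁻ x, ‖w x‖ₑ ^ p
      = ∫⁻ x, Filter.liminf (fun N => ‖kconv (K N) v x‖ₑ ^ p) Filter.atTop :=
        lintegral_congr fun x => (hpt' x).liminf_eq.symm
    _ ≤ Filter.liminf (fun N => ∫⁻ x, ‖kconv (K N) v x‖ₑ ^ p) Filter.atTop := by
        refine lintegral_liminf_le fun N => ?_
        rw [← coe_sConv]
        exact (sConv (K N) v).continuous.measurable.enorm.pow_const _
    _ ≤ Filter.liminf (fun _ : ℕ => C * ∫⁻ x, ‖v x‖ₑ ^ p) Filter.atTop :=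
        Filter.liminf_le_liminf (.of_forall fun N => h _ (hH _) (hKb N) v)
    _ = _ := Filter.liminf_const _

/-- The symbol `4π²|ξ|² + iτ` of the heat operator. -/
def heatSym {n : ℕ} (q : Rn1 n) : ℂ := 4 * (π : ℂ) ^ 2 * (‖q.1‖ : ℂ) ^ 2 + Complex.I * (q.2 : ℂ)

lemma heatSym_re {n : ℕ} (q : Rn1 n) : (heatSym q).re = 4 * π ^ 2 * ‖q.1‖ ^ 2 := by
  rw [heatSym, show 4 * (π : ℂ) ^ 2 * (‖q.1‖ : ℂ) ^ 2 = ((4 * π ^ 2 * ‖q.1‖ ^ 2 : ℝ) : ℂ) by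
    push_cast; ring, Complex.add_re, Complex.ofReal_re, Complex.re_mul_ofReal, Complex.I_re]
  ring

lemma heatSym_im {n : ℕ} (q : Rn1 n) : (heatSym q).im = q.2 := by
  rw [heatSym, show 4 * (π : ℂ) ^ 2 * (‖q.1‖ : ℂ) ^ 2 = ((4 * π ^ 2 * ‖q.1‖ ^ 2 : ℝ) : ℂ) by
    push_cast; ring, Complex.add_im, Complex.ofReal_im, Complex.im_mul_ofReal, Complex.I_im]
  ring

lemma heatSym_ne_zero {n : ℕ} {q : Rn1 n} (hq : q ≠ 0) : heatSym q ≠ 0 := by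
  intro h
  have h1 := heatSym_re q
  have h2 := heatSym_im q
  rw [h] at h1 h2
  refine hq (Prod.ext ?_ h2.symm)
  have : ‖q.1‖ ^ 2 = 0 := by
    have hpi : (4 * π ^ 2) ≠ 0 := by positivity
    simpa [hpi] using h1.symm
  simpa using this

lemma contDiff_heatSym {n : ℕ} : ContDiff ℝ ∞ (heatSym : Rn1 n → ℂ) := by
  have h1 : ContDiff ℝ ∞ fun q : Rn1 n => ((‖q.1‖ ^ 2 : ℝ) : ℂ) :=
    Complex.ofRealCLM.contDiff.comp (contDiff_fst.norm_sq ℝ)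
  have h2 : ContDiff ℝ ∞ fun q : Rn1 n => ((q.2 : ℝ) : ℂ) :=
    Complex.ofRealCLM.contDiff.comp contDiff_snd
  have h3 := (contDiff_const (c := 4 * (π : ℂ) ^ 2)).mul h1
  have h4 := (contDiff_const (c := Complex.I)).mul h2
  have h5 : (heatSym : Rn1 n → ℂ) =
      fun q => 4 * (π : ℂ) ^ 2 * ((‖q.1‖ ^ 2 : ℝ) : ℂ) + Complex.I * (q.2 : ℂ) := by
    ext q
    rw [heatSym, Complex.ofReal_pow]
  rw [h5]
  exact h3.add h4

/-- The symbol of `∂_k ∂_l` divided by that of the heat operator. -/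
def rieszSym {n : ℕ} (k l : Fin n) (q : Rn1 n) : ℂ :=
  -((4 * π ^ 2 * q.1 k * q.1 l : ℝ) : ℂ) / heatSym q

lemma contDiffAt_rieszSym {n : ℕ} (k l : Fin n) (q : Rn1 n) (hq : q ≠ 0) :
    ContDiffAt ℝ ∞ (rieszSym k l) q := by
  have hc : ∀ k : Fin n, ContDiff ℝ ∞ fun q : Rn1 n => q.1 k := fun k =>
    (EuclideanSpace.proj (𝕜 := ℝ) k).contDiff.comp contDiff_fst
  have h1 : ContDiff ℝ ∞ fun q : Rn1 n => (4 * π ^ 2 * q.1 k * q.1 l : ℝ) :=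
    (contDiff_const.mul (hc k)).mul (hc l)
  have h2 : ContDiff ℝ ∞ fun q : Rn1 n => -((4 * π ^ 2 * q.1 k * q.1 l : ℝ) : ℂ) :=
    (Complex.ofRealCLM.contDiff.comp h1).neg
  exact (h2.contDiffAt.mul
    (contDiff_heatSym.contDiffAt.inv (heatSym_ne_zero hq))).congr_of_eventuallyEq
    (.of_forall fun q => div_eq_mul_inv _ _)

lemma heatSym_dil {n : ℕ} (s : ℝ) (hs : s ≠ 0) (q : Rn1 n) :
    heatSym (dil n s hs q) = (s : ℂ) ^ 2 * heatSym q := by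
  refine Complex.ext ?_ ?_
  · rw [heatSym_re, ← Complex.ofReal_pow, Complex.re_ofReal_mul, heatSym_re, dil_apply, norm_smul,
      mul_pow]
    simp only [Real.norm_eq_abs, sq_abs]
    ring
  · rw [heatSym_im, ← Complex.ofReal_pow, Complex.im_ofReal_mul, heatSym_im, dil_apply]

lemma rieszSym_dil {n : ℕ} (k l : Fin n) (s : ℝ) (hs : s ≠ 0) (q : Rn1 n) :
    rieszSym k l (dil n s hs q) = rieszSym k l q := by
  have hsc : (s : ℂ) ^ 2 ≠ 0 := pow_ne_zero 2 (Complex.ofReal_ne_zero.2 hs)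
  rw [rieszSym, rieszSym, heatSym_dil, ← mul_div_mul_left _ (heatSym q) hsc]
  congr 1
  simp only [dil_apply, PiLp.smul_apply, smul_eq_mul]
  push_cast
  ring

lemma norm_rieszSym_le {n : ℕ} (k l : Fin n) (q : Rn1 n) : ‖rieszSym k l q‖ ≤ 1 := by
  rw [rieszSym, norm_div, norm_neg, Complex.norm_real]
  refine div_le_one_of_le₀ ?_ (norm_nonneg _)
  refine le_trans ?_ (Complex.abs_re_le_norm _)
  rw [heatSym_re, abs_of_nonneg (by positivity), Real.norm_eq_abs, abs_mul, abs_mul,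
    abs_of_nonneg (by positivity : (0:ℝ) ≤ 4 * π ^ 2), mul_assoc, sq ‖q.1‖]
  gcongr
  · exact abs_apply_le_norm _ _
  · exact abs_apply_le_norm _ _

/-- Second spatial derivatives are controlled in `Lᵖ` by the heat operator. -/
theorem exists_lintegral_sdX_sdX_le (n : ℕ) (k l : Fin n) {p : ℝ} (hp : 1 < p) :
    ∃ C : ℝ≥0∞, C ≠ ⊤ ∧ ∀ u v : 𝓢(Rn1 n, ℂ), (∀ q, sFT v q = heatSym q * sFT u q) →
      ∫⁻ x, ‖sdX k (sdX l u) x‖ₑ ^ p ≤ C * ∫⁻ x, ‖v x‖ₑ ^ p := by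
  obtain ⟨C, hC, h⟩ := exists_multiplier_bound (contDiffAt_rieszSym (n := n) k l)
    (fun s hs q => rieszSym_dil k l s hs.ne' q) (norm_rieszSym_le k l) hp
  refine ⟨C, hC, fun u v huv => h v _ (fun q => ?_) (by simp [sFT_sdX])⟩
  rw [sFT_sdX, sFT_sdX, huv]
  by_cases hq : q = 0
  · simp [hq, rieszSym]
  · have := heatSym_ne_zero hq
    rw [rieszSym]
    field_simp
    push_cast
    rw [Complex.I_sq]
    ring

lemma exists_norm_add_le {n : ℕ} (k : ℕ) (g : 𝓢(Rn1 n, ℂ)) :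
    ∃ C : ℝ, 0 ≤ C ∧ ∀ x y : Rn1 n, ‖y‖ ≤ 1 → ‖g (x + y)‖ ≤ C * (1 + ‖x‖) ^ (-k : ℝ) := by
  obtain ⟨C, hC⟩ : ∃ C : ℝ, ∀ x, (1 + ‖x‖) ^ k * ‖g x‖ ≤ C :=
    ⟨_, fun x => by
      simpa using
        SchwartzMap.one_add_le_sup_seminorm_apply (𝕜 := ℝ) (m := (k, 0)) le_rfl le_rfl g x⟩
  refine ⟨2 ^ k * C, ?_, fun x y hy => ?_⟩
  · exact mul_nonneg (by positivity) (le_trans (by positivity) (hC 0))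
  · have h1 : 1 + ‖x‖ ≤ 2 * (1 + ‖x + y‖) := by
      have : ‖x‖ ≤ ‖x + y‖ + ‖y‖ := by simpa using norm_sub_le (x + y) y
      nlinarith [norm_nonneg (x + y)]
    have hpos : 0 < 1 + ‖x‖ := by positivity
    rw [Real.rpow_neg hpos.le, Real.rpow_natCast, ← div_eq_mul_inv, le_div_iff₀ (by positivity)]
    calc ‖g (x + y)‖ * (1 + ‖x‖) ^ k ≤ ‖g (x + y)‖ * (2 * (1 + ‖x + y‖)) ^ k := by gcongr
      _ = 2 ^ k * ((1 + ‖x + y‖) ^ k * ‖g (x + y)‖) := by rw [mul_pow]; ring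
      _ ≤ 2 ^ k * C := by gcongr; exact hC _

lemma norm_sub_le_of_hasDerivAt {G G' : ℝ → ℂ} {h K : ℝ} (hG : ∀ s, HasDerivAt G (G' s) s)
    (hK : ∀ s, 0 ≤ s → s ≤ h → ‖G' s‖ ≤ K) {s : ℝ} (hs : 0 ≤ s) (hsh : s ≤ h) :
    ‖G s - G 0‖ ≤ K * s := by
  simpa using norm_image_sub_le_of_norm_deriv_le_segment' (a := 0) (b := h) (C := K)
    (fun t _ => (hG t).hasDerivWithinAt) (fun t ht => hK t ht.1 ht.2.le) s ⟨hs, hsh⟩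

lemma hasDerivAt_complex_ofReal (s : ℝ) : HasDerivAt (fun s : ℝ => (s : ℂ)) 1 s :=
  Complex.ofRealCLM.hasDerivAt.congr_deriv (by simp)

lemma norm_taylor_one_le {F F₁ F₂ : ℝ → ℂ} {h M : ℝ} (hh : 0 ≤ h)
    (h₁ : ∀ s, HasDerivAt F (F₁ s) s) (h₂ : ∀ s, HasDerivAt F₁ (F₂ s) s)
    (hM : ∀ s, |s| ≤ h → ‖F₂ s‖ ≤ M) : ‖F h - F 0 - h * F₁ 0‖ ≤ M * h ^ 2 := by
  have hM0 : 0 ≤ M := (norm_nonneg _).trans (hM 0 (by simpa using hh))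
  have hG : ∀ s : ℝ, HasDerivAt (fun s : ℝ => F s - s * F₁ 0) (F₁ s - F₁ 0) s := fun s =>
    ((h₁ s).sub ((hasDerivAt_complex_ofReal s).mul_const (F₁ 0))).congr_deriv (by simp)
  have := norm_sub_le_of_hasDerivAt hG (K := M * h) (h := h) (fun s hs hsh =>
    (norm_sub_le_of_hasDerivAt h₂ (h := h) (fun t ht hth => hM t (by rwa [abs_of_nonneg ht]))
      hs hsh).trans (by gcongr)) hh le_rfl
  simp only [Complex.ofReal_zero, zero_mul, sub_zero] at this
  calc ‖F h - F 0 - h * F₁ 0‖ = ‖F h - h * F₁ 0 - F 0‖ := by ring_nf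
    _ ≤ M * h * h := this
    _ = M * h ^ 2 := by ring

lemma norm_taylor_symm_le {F F₁ F₂ F₃ : ℝ → ℂ} {h M : ℝ} (hh : 0 ≤ h)
    (h₁ : ∀ s, HasDerivAt F (F₁ s) s) (h₂ : ∀ s, HasDerivAt F₁ (F₂ s) s)
    (h₃ : ∀ s, HasDerivAt F₂ (F₃ s) s) (hM : ∀ s, |s| ≤ h → ‖F₃ s‖ ≤ M) :
    ‖F h + F (-h) - 2 * F 0 - h ^ 2 * F₂ 0‖ ≤ 2 * M * h ^ 3 := by
  have hM0 : 0 ≤ M := (norm_nonneg _).trans (hM 0 (by simpa using hh))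
  have hneg : ∀ {G G' : ℝ → ℂ}, (∀ s, HasDerivAt G (G' s) s) →
      ∀ s, HasDerivAt (fun s => G (-s)) (-G' (-s)) s := fun hG s =>
    ((hG (-s)).scomp s (hasDerivAt_neg s)).congr_deriv (by simp)
  have hid := hasDerivAt_complex_ofReal
  have d1 : ∀ s : ℝ, HasDerivAt (fun s : ℝ => F s + F (-s) - s ^ 2 * F₂ 0)
      (F₁ s - F₁ (-s) - 2 * s * F₂ 0) s := fun s =>
    (((h₁ s).add (hneg h₁ s)).sub (((hid s).pow 2).mul_const (F₂ 0))).congr_deriv (by simp; ring)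
  have d2 : ∀ s : ℝ, HasDerivAt (fun s : ℝ => F₁ s - F₁ (-s) - 2 * s * F₂ 0)
      (F₂ s + F₂ (-s) - 2 * F₂ 0) s := fun s =>
    (((h₂ s).sub (hneg h₂ s)).sub (((hid s).const_mul 2).mul_const (F₂ 0))).congr_deriv (by simp)
  have d3 : ∀ s : ℝ, HasDerivAt (fun s : ℝ => F₂ s + F₂ (-s) - 2 * F₂ 0) (F₃ s - F₃ (-s)) s :=
    fun s => (((h₃ s).add (hneg h₃ s)).sub_const (2 * F₂ 0)).congr_deriv (by ring)
  have b3 : ∀ s, 0 ≤ s → s ≤ h → ‖F₃ s - F₃ (-s)‖ ≤ 2 * M := fun s hs hsh => by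
    have e1 := hM s (by rwa [abs_of_nonneg hs])
    have e2 := hM (-s) (by rwa [abs_neg, abs_of_nonneg hs])
    linarith [norm_sub_le (F₃ s) (F₃ (-s))]
  have b2 : ∀ s, 0 ≤ s → s ≤ h → ‖F₂ s + F₂ (-s) - 2 * F₂ 0‖ ≤ 2 * M * h := fun s hs hsh => by
    have := norm_sub_le_of_hasDerivAt d3 b3 hs hsh
    rw [neg_zero, show F₂ 0 + F₂ 0 - 2 * F₂ 0 = 0 by ring, sub_zero] at this
    exact this.trans (by gcongr)
  have b1 : ∀ s, 0 ≤ s → s ≤ h → ‖F₁ s - F₁ (-s) - 2 * s * F₂ 0‖ ≤ 2 * M * h * h :=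
    fun s hs hsh => by
      have := norm_sub_le_of_hasDerivAt d2 b2 hs hsh
      simp only [neg_zero, Complex.ofReal_zero, mul_zero, zero_mul, sub_self, sub_zero] at this
      exact this.trans (by gcongr)
  have := norm_sub_le_of_hasDerivAt d1 b1 hh le_rfl
  calc ‖F h + F (-h) - 2 * F 0 - h ^ 2 * F₂ 0‖
      = ‖F h + F (-h) - h ^ 2 * F₂ 0 - (F 0 + F (-0) - ((0 : ℝ) : ℂ) ^ 2 * F₂ 0)‖ := by
        congr 1
        simp only [neg_zero, Complex.ofReal_zero]
        ring
    _ ≤ 2 * M * h * h * h := this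
    _ = 2 * M * h ^ 3 := by ring

lemma hasDerivAt_schwartz_line {n : ℕ} (u : 𝓢(Rn1 n, ℂ)) (x e : Rn1 n) (s : ℝ) :
    HasDerivAt (fun s : ℝ => u (x + s • e)) ((∂_{e} u : 𝓢(Rn1 n, ℂ)) (x + s • e)) s := by
  rw [SchwartzMap.lineDerivOp_apply_eq_fderiv]
  have h1 : HasDerivAt (fun s : ℝ => x + s • e) e s := by
    simpa using ((hasDerivAt_id s).smul_const e).const_add x
  exact (u.differentiableAt.hasFDerivAt (x := x + s • e)).comp_hasDerivAt s h1

lemma eLpNorm_const_mul_of_nonneg {n : ℕ} {P : ℝ≥0∞} {a : ℝ} (ha : 0 ≤ a) (f : Rn1 n → ℂ) :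
    eLpNorm (fun x => (a : ℂ) * f x) P volume = ENNReal.ofReal a * eLpNorm f P volume := by
  have := eLpNorm_const_smul (a : ℂ) f P volume
  rw [← ofReal_norm, Complex.norm_real, Real.norm_of_nonneg ha] at this
  exact this

lemma eLpNorm_sum_translates_le {n : ℕ} {ι : Type*} [Fintype ι] {P : ℝ≥0∞} (hP : 1 ≤ P)
    (u : 𝓢(Rn1 n, ℂ)) (a : ι → ℝ) (ha : ∀ i, 0 ≤ a i) (y : ι → Rn1 n) :
    eLpNorm (fun x => ∑ i, (a i : ℂ) * u (x + y i)) P volume ≤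
      ENNReal.ofReal (∑ i, a i) * eLpNorm u P volume := by
  have hm : ∀ i, AEStronglyMeasurable (fun x => u (x + y i)) volume := fun i =>
    (u.continuous.comp (continuous_add_const (y i))).aestronglyMeasurable
  have h1 := eLpNorm_sum_le (μ := volume) (p := P) (s := Finset.univ)
    (f := fun i x => (a i : ℂ) * u (x + y i)) (fun i _ => (hm i).const_mul _) hP
  have h2 : (∑ i, fun x => (a i : ℂ) * u (x + y i)) = fun x => ∑ i, (a i : ℂ) * u (x + y i) := by
    ext x; simp
  rw [h2] at h1
  refine h1.trans_eq ?_
  rw [ENNReal.ofReal_sum_of_nonneg fun i _ => ha i, Finset.sum_mul]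
  refine Finset.sum_congr rfl fun i _ => ?_
  rw [eLpNorm_const_mul_of_nonneg (ha i) fun x => u (x + y i)]
  congr 1
  exact eLpNorm_comp_measurePreserving u.continuous.aestronglyMeasurable
    (measurePreserving_add_right volume (y i))

/-- Lower bound for a Schwartz function plus weighted differences with its translates. -/
lemma eLpNorm_le_of_translates {n : ℕ} {ι : Type*} [Fintype ι] {P : ℝ≥0∞} (hP : 1 ≤ P)
    (u : 𝓢(Rn1 n, ℂ)) (a : ι → ℝ) (ha : ∀ i, 0 ≤ a i) (y : ι → Rn1 n) :
    eLpNorm u P volume ≤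
      eLpNorm (fun x => u x + ∑ i, (a i : ℂ) * (u x - u (x + y i))) P volume := by
  have hc : ∀ i, Continuous fun x => u (x + y i) := fun i =>
    u.continuous.comp (continuous_add_const (y i))
  have hN : eLpNorm u P volume ≠ ⊤ := (u.memLp P volume).eLpNorm_ne_top
  have hW : Continuous fun x => u x + ∑ i, (a i : ℂ) * (u x - u (x + y i)) :=
    u.continuous.add (continuous_finsetSum _ fun i _ => continuous_const.mul
      (u.continuous.sub (hc i)))
  have hB : Continuous fun x => ∑ i, (a i : ℂ) * u (x + y i) :=
    continuous_finsetSum _ fun i _ => continuous_const.mul (hc i)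
  have hc0 : 0 ≤ ∑ i, a i := Finset.sum_nonneg fun i _ => ha i
  have hsum := eLpNorm_add_le (p := P) (μ := volume) hW.aestronglyMeasurable
    hB.aestronglyMeasurable hP
  have he : ((fun x => u x + ∑ i, (a i : ℂ) * (u x - u (x + y i))) +
      fun x => ∑ i, (a i : ℂ) * u (x + y i)) = fun x => ((1 + ∑ i, a i : ℝ) : ℂ) * u x := by
    ext x
    simp only [Pi.add_apply, mul_sub, Finset.sum_sub_distrib, ← Finset.sum_mul]
    push_cast
    ring
  have h1c : (0:ℝ) ≤ 1 + ∑ i, a i := add_nonneg zero_le_one hc0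
  rw [he, eLpNorm_const_mul_of_nonneg h1c u, ENNReal.ofReal_add zero_le_one hc0,
    add_mul, ENNReal.ofReal_one, one_mul] at hsum
  have hfin : ENNReal.ofReal (∑ i, a i) * eLpNorm u P volume ≠ ⊤ :=
    ENNReal.mul_ne_top ENNReal.ofReal_ne_top hN
  exact (ENNReal.add_le_add_iff_right hfin).1
    (hsum.trans (by gcongr; exact eLpNorm_sum_translates_le hP u a ha y))

/-- The standard directions of `ℝⁿ × ℝ`. -/
abbrev dirX {n : ℕ} (k : Fin n) : Rn1 n := (EuclideanSpace.single k 1, 0)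

/-- The time direction of `ℝⁿ × ℝ`. -/
abbrev dirT (n : ℕ) : Rn1 n := (0, 1)

lemma norm_dirX {n : ℕ} (k : Fin n) : ‖dirX k‖ = 1 := by simp [Prod.norm_def]
lemma norm_dirT (n : ℕ) : ‖dirT n‖ = 1 := by simp [Prod.norm_def]

lemma exists_taylor_dirX_le {n : ℕ} (r : ℕ) (u : 𝓢(Rn1 n, ℂ)) (k : Fin n) :
    ∃ C : ℝ, 0 ≤ C ∧ ∀ h : ℝ, 0 ≤ h → h ≤ 1 → ∀ x,
      ‖u (x + h • dirX k) + u (x + (-h) • dirX k) - 2 * u x - h ^ 2 * sdX k (sdX k u) x‖ ≤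
        C * h ^ 3 * (1 + ‖x‖) ^ (-r : ℝ) := by
  obtain ⟨C, hC0, hC⟩ := exists_norm_add_le r (sdX k (sdX k (sdX k u)))
  refine ⟨2 * C, by positivity, fun h hh hh1 x => ?_⟩
  have := norm_taylor_symm_le (F := fun s => u (x + s • dirX k)) hh
    (hasDerivAt_schwartz_line u x (dirX k)) (hasDerivAt_schwartz_line (sdX k u) x (dirX k))
    (hasDerivAt_schwartz_line (sdX k (sdX k u)) x (dirX k))
    (M := C * (1 + ‖x‖) ^ (-r : ℝ)) (fun s hs => hC x _ (by
      rw [norm_smul, norm_dirX, mul_one]; exact hs.trans hh1))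
  simp only [zero_smul, add_zero] at this
  refine this.trans_eq (by ring)

lemma exists_taylor_dirT_le {n : ℕ} (r : ℕ) (u : 𝓢(Rn1 n, ℂ)) :
    ∃ C : ℝ, 0 ≤ C ∧ ∀ h : ℝ, 0 ≤ h → h ≤ 1 → ∀ x,
      ‖u (x + h • -dirT n) - u x + h * sdT u x‖ ≤ C * h ^ 2 * (1 + ‖x‖) ^ (-r : ℝ) := by
  obtain ⟨C, hC0, hC⟩ := exists_norm_add_le r (∂_{-dirT n} (∂_{-dirT n} u) : 𝓢(Rn1 n, ℂ))
  refine ⟨C, hC0, fun h hh hh1 x => ?_⟩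
  have := norm_taylor_one_le (F := fun s => u (x + s • -dirT n)) hh
    (hasDerivAt_schwartz_line u x (-dirT n))
    (hasDerivAt_schwartz_line (∂_{-dirT n} u : 𝓢(Rn1 n, ℂ)) x (-dirT n))
    (M := C * (1 + ‖x‖) ^ (-r : ℝ)) (fun s hs => hC x _ (by
      rw [norm_smul, norm_neg, norm_dirT, mul_one]; exact hs.trans hh1))
  have hneg : (∂_{-dirT n} u : 𝓢(Rn1 n, ℂ)) x = - sdT u x := by
    rw [LineDeriv.lineDerivOp_left_neg]; rfl
  simp only [zero_smul, add_zero, hneg, mul_neg, sub_neg_eq_add] at this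
  refine this.trans_eq (by ring)

/-- The operator `1 - Δ_X + (2π)⁻¹ ∂_t` as a map of Schwartz functions. -/
def resolventOp {n : ℕ} (u : 𝓢(Rn1 n, ℂ)) (x : Rn1 n) : ℂ :=
  u x - ∑ k, sdX k (sdX k u) x + (2 * π : ℂ)⁻¹ * sdT u x

lemma exists_resolventOp_approx {n : ℕ} (r : ℕ) (u : 𝓢(Rn1 n, ℂ)) :
    ∃ C : ℝ, 0 ≤ C ∧ ∀ h : ℝ, 0 < h → h ≤ 1 →
      ∃ (a : (Fin n ⊕ Fin n) ⊕ Unit → ℝ) (y : (Fin n ⊕ Fin n) ⊕ Unit → Rn1 n), (∀ i, 0 ≤ a i) ∧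
        ∀ x, ‖(u x + ∑ i, (a i : ℂ) * (u x - u (x + y i))) - resolventOp u x‖ ≤
          C * h * (1 + ‖x‖) ^ (-r : ℝ) := by
  choose CX hX0 hX using exists_taylor_dirX_le r u
  obtain ⟨CT, hT0, hT⟩ := exists_taylor_dirT_le r u
  refine ⟨∑ k, CX k + CT, add_nonneg (Finset.sum_nonneg fun k _ => hX0 k) hT0,
    fun h hh hh1 => ?_⟩
  have hhc : (h : ℂ) ≠ 0 := Complex.ofReal_ne_zero.2 hh.ne'
  have hpc : (π : ℂ) ≠ 0 := Complex.ofReal_ne_zero.2 Real.pi_ne_zero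
  refine ⟨Sum.elim (Sum.elim (fun _ => (h ^ 2)⁻¹) (fun _ => (h ^ 2)⁻¹)) (fun _ => (2 * π * h)⁻¹),
    Sum.elim (Sum.elim (fun k => h • dirX k) (fun k => (-h) • dirX k)) (fun _ => h • -dirT n),
    ?_, fun x => ?_⟩
  · rintro ((i | i) | i) <;> simp only [Sum.elim_inl, Sum.elim_inr] <;> positivity
  set W : ℝ := (1 + ‖x‖) ^ (-r : ℝ) with hW
  have hW0 : 0 ≤ W := by positivity
  have he : (u x + ∑ i, ((Sum.elim (Sum.elim (fun _ => (h ^ 2)⁻¹) (fun _ => (h ^ 2)⁻¹))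
      (fun _ => (2 * π * h)⁻¹) : (Fin n ⊕ Fin n) ⊕ Unit → ℝ) i : ℂ) * (u x - u (x +
        (Sum.elim (Sum.elim (fun k => h • dirX k) (fun k => (-h) • dirX k))
          (fun _ => h • -dirT n) : (Fin n ⊕ Fin n) ⊕ Unit → Rn1 n) i))) - resolventOp u x =
      -(∑ k, ((h : ℂ) ^ 2)⁻¹ * (u (x + h • dirX k) + u (x + (-h) • dirX k) - 2 * u x
        - h ^ 2 * sdX k (sdX k u) x)) -
      (2 * π * h : ℂ)⁻¹ * (u (x + h • -dirT n) - u x + h * sdT u x) := by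
    have e1 : ∀ k, ((h : ℂ) ^ 2)⁻¹ * (u (x + h • dirX k) + u (x + (-h) • dirX k) - 2 * u x
        - h ^ 2 * sdX k (sdX k u) x) = -(((h : ℂ) ^ 2)⁻¹ * (u x - u (x + h • dirX k)) +
        ((h : ℂ) ^ 2)⁻¹ * (u x - u (x + (-h) • dirX k))) - sdX k (sdX k u) x := fun k => by
      field_simp; ring
    have e2 : (2 * π * h : ℂ)⁻¹ * (u (x + h • -dirT n) - u x + h * sdT u x) =
        -((2 * π * h : ℂ)⁻¹ * (u x - u (x + h • -dirT n))) + (2 * π : ℂ)⁻¹ * sdT u x := by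
      field_simp; ring
    rw [Finset.sum_congr rfl fun k _ => e1 k, e2, resolventOp]
    simp only [Fintype.sum_sum_type, Sum.elim_inl, Sum.elim_inr, Finset.univ_unique,
      Finset.sum_singleton, Finset.sum_sub_distrib, Finset.sum_neg_distrib,
      Finset.sum_add_distrib, Complex.ofReal_inv, Complex.ofReal_pow, Complex.ofReal_mul,
      Complex.ofReal_ofNat]
    ring
  rw [he]
  refine (norm_sub_le _ _).trans ?_
  rw [norm_neg, add_mul, add_mul, Finset.sum_mul, Finset.sum_mul]
  refine add_le_add ((norm_sum_le _ _).trans (Finset.sum_le_sum fun k _ => ?_)) ?_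
  · rw [norm_mul, norm_inv, norm_pow, Complex.norm_real, Real.norm_of_nonneg hh.le]
    calc (h ^ 2)⁻¹ * _ ≤ (h ^ 2)⁻¹ * (CX k * h ^ 3 * W) := by
          gcongr; exact hX k h hh.le hh1 x
      _ = CX k * h * W := by field_simp
  · have hn : ‖(2 * π * h : ℂ)⁻¹‖ = (2 * π * h)⁻¹ := by
      rw [norm_inv, show (2 * π * h : ℂ) = ((2 * π * h : ℝ) : ℂ) by push_cast; ring,
        Complex.norm_real, Real.norm_of_nonneg (by positivity)]
    rw [norm_mul, hn]
    calc (2 * π * h)⁻¹ * _ ≤ (2 * π * h)⁻¹ * (CT * h ^ 2 * W) := by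
          gcongr; exact hT h hh.le hh1 x
      _ ≤ (1 * h)⁻¹ * (CT * h ^ 2 * W) := by
          gcongr; linarith [Real.two_le_pi]
      _ = CT * h * W := by field_simp

lemma continuous_resolventOp {n : ℕ} (u : 𝓢(Rn1 n, ℂ)) : Continuous (resolventOp u) :=
  (u.continuous.sub (continuous_finsetSum _ fun k _ => (sdX k (sdX k u)).continuous)).add
    (continuous_const.mul (sdT u).continuous)

/-- The operator `1 - Δ_X + (2π)⁻¹ ∂_t` is bounded below by one on `Lᵖ`. -/
theorem eLpNorm_le_resolventOp {n : ℕ} {P : ℝ≥0∞} (hP : 1 ≤ P) (u : 𝓢(Rn1 n, ℂ)) :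
    eLpNorm u P volume ≤ eLpNorm (resolventOp u) P volume := by
  obtain ⟨r, hr⟩ := MeasureTheory.Measure.HasTemperateGrowth.exists_eLpNorm_lt_top P
    (inferInstance : (volume : Measure (Rn1 n)).HasTemperateGrowth)
  obtain ⟨C, hC0, hC⟩ := exists_resolventOp_approx r u
  set Ω : ℝ≥0∞ := eLpNorm (fun x : Rn1 n => (1 + ‖x‖) ^ (-r : ℝ)) P volume with hΩ
  have hb : ∀ h : ℝ, 0 < h → h ≤ 1 →
      eLpNorm u P volume ≤ eLpNorm (resolventOp u) P volume + ENNReal.ofReal (C * h) * Ω := by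
    intro h hh hh1
    obtain ⟨a, y, ha, hR⟩ := hC h hh hh1
    refine (eLpNorm_le_of_translates hP u a ha y).trans ?_
    have hc : Continuous fun x => u x + ∑ i, (a i : ℂ) * (u x - u (x + y i)) :=
      u.continuous.add (continuous_finsetSum _ fun i _ => continuous_const.mul
        (u.continuous.sub (u.continuous.comp (continuous_add_const (y i)))))
    have h1 := eLpNorm_add_le (p := P) (μ := volume)
      (continuous_resolventOp u).aestronglyMeasurable
      (hc.sub (continuous_resolventOp u)).aestronglyMeasurable hP
    have h2 : (resolventOp u + fun x => (u x + ∑ i, (a i : ℂ) * (u x - u (x + y i))) -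
        resolventOp u x) = fun x => u x + ∑ i, (a i : ℂ) * (u x - u (x + y i)) := by
      ext x; simp
    have h3 : eLpNorm (fun x => (u x + ∑ i, (a i : ℂ) * (u x - u (x + y i))) -
        resolventOp u x) P volume ≤ ENNReal.ofReal (C * h) * Ω :=
      eLpNorm_le_mul_eLpNorm_of_ae_le_mul (.of_forall fun x => by
        rw [Real.norm_of_nonneg (by positivity)]; exact hR x) P
    rw [← h2]
    exact h1.trans (by gcongr; exact h3)
  have hlim : Filter.Tendsto
      (fun h : ℝ => eLpNorm (resolventOp u) P volume + ENNReal.ofReal (C * h) * Ω)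
      (nhdsWithin 0 (Set.Ioi 0)) (nhds (eLpNorm (resolventOp u) P volume + 0)) := by
    refine Filter.Tendsto.const_add _ ?_
    have h0 : Filter.Tendsto (fun h : ℝ => ENNReal.ofReal (C * h)) (nhdsWithin 0 (Set.Ioi 0))
        (nhds 0) := by
      have : Continuous fun h : ℝ => ENNReal.ofReal (C * h) :=
        ENNReal.continuous_ofReal.comp (continuous_const_mul C)
      simpa using (this.tendsto 0).mono_left nhdsWithin_le_nhds
    simpa using ENNReal.Tendsto.mul_const h0 (Or.inr hr.ne)
  rw [add_zero] at hlim
  refine ge_of_tendsto hlim ?_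
  filter_upwards [Ioc_mem_nhdsGT (zero_lt_one (α := ℝ))] with h hh
  exact hb h hh.1 hh.2

lemma cpow_slitPlane_of_one_le_re {w : ℂ} (h : 1 ≤ w.re) : w ∈ Complex.slitPlane :=
  Or.inl (by linarith)

section Cpow

variable {E : Type*} [NormedAddCommGroup E] [NormedSpace ℝ E] {z : E → ℂ}

lemma contDiff_cpow_real (hz : ContDiff ℝ ∞ z) (h1 : ∀ x, 1 ≤ (z x).re) (γ : ℝ) :
    ContDiff ℝ ∞ fun x => z x ^ (γ : ℂ) := by
  rw [contDiff_iff_contDiffAt]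
  intro x
  have h2 : AnalyticAt ℂ (fun w : ℂ => w ^ (γ : ℂ)) (z x) :=
    analyticAt_id.cpow analyticAt_const (cpow_slitPlane_of_one_le_re (h1 x))
  have h3 : ContDiffAt ℝ ∞ (fun w : ℂ => w ^ (γ : ℂ)) (z x) := h2.contDiffAt.restrict_scalars ℝ
  exact h3.comp x hz.contDiffAt

lemma fderiv_cpow_real (hz : ContDiff ℝ ∞ z) (h1 : ∀ x, 1 ≤ (z x).re) (γ : ℝ) :
    fderiv ℝ (fun x => z x ^ (γ : ℂ)) =
      fun x => z x ^ ((γ - 1 : ℝ) : ℂ) • (γ • fderiv ℝ z x) := by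
  ext1 x
  have h2 := (Complex.hasStrictDerivAt_cpow_const (c := γ)
    (cpow_slitPlane_of_one_le_re (h1 x))).hasDerivAt.hasFDerivAt.restrictScalars ℝ
  have h3 := (hz.differentiable (by simp) x).hasFDerivAt
  have h4 : HasFDerivAt (fun x => z x ^ (γ : ℂ)) _ x := h2.comp x h3
  rw [h4.fderiv]
  ext y
  simp
  ring

lemma exists_norm_cpow_real_le (hz : z.HasTemperateGrowth) (h1 : ∀ x, 1 ≤ (z x).re) (γ : ℝ) :
    ∃ (k : ℕ) (C : ℝ), ∀ x, ‖z x ^ (γ : ℂ)‖ ≤ C * (1 + ‖x‖) ^ k := by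
  obtain ⟨k, C, hC⟩ := hz.2 0
  obtain ⟨m, hm⟩ := exists_nat_ge γ
  refine ⟨k * m, C ^ m, fun x => ?_⟩
  have h2 : 1 ≤ ‖z x‖ := (h1 x).trans (Complex.re_le_norm _)
  have h3 : ‖z x‖ ≤ C * (1 + ‖x‖) ^ k := by simpa using hC x
  calc ‖z x ^ (γ : ℂ)‖ = ‖z x‖ ^ γ := Complex.norm_cpow_real _ _
    _ ≤ ‖z x‖ ^ (m : ℝ) := Real.rpow_le_rpow_of_exponent_le h2 hm
    _ = ‖z x‖ ^ m := Real.rpow_natCast _ _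
    _ ≤ (C * (1 + ‖x‖) ^ k) ^ m := by gcongr
    _ = C ^ m * (1 + ‖x‖) ^ (k * m) := by rw [mul_pow, pow_mul]

lemma exists_sum_mul_le {ι : Type*} (s : Finset ι) (a b : ι → E → ℝ) (c : ι → ℕ)
    (hb0 : ∀ i x, 0 ≤ b i x)
    (ha : ∀ i ∈ s, ∃ (k : ℕ) (C : ℝ), ∀ x, a i x ≤ C * (1 + ‖x‖) ^ k)
    (hb : ∀ i ∈ s, ∃ (k : ℕ) (C : ℝ), ∀ x, b i x ≤ C * (1 + ‖x‖) ^ k) :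
    ∃ (k : ℕ) (C : ℝ), ∀ x, ∑ i ∈ s, c i * a i x * b i x ≤ C * (1 + ‖x‖) ^ k := by
  classical
  induction s using Finset.induction_on with
  | empty => exact ⟨0, 0, fun x => by simp⟩
  | insert i s hi ih =>
    obtain ⟨k, C, hC⟩ := ih (fun j hj => ha j (Finset.mem_insert_of_mem hj))
      (fun j hj => hb j (Finset.mem_insert_of_mem hj))
    obtain ⟨k₁, C₁, h₁⟩ := ha i (Finset.mem_insert_self i s)
    obtain ⟨k₂, C₂, h₂⟩ := hb i (Finset.mem_insert_self i s)
    refine ⟨k₁ + k₂ + k, c i * |C₁| * |C₂| + |C|, fun x => ?_⟩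
    have hx : 1 ≤ 1 + ‖x‖ := by simp
    rw [Finset.sum_insert hi, add_mul]
    refine add_le_add ?_ ?_
    · calc c i * a i x * b i x
          ≤ c i * (|C₁| * (1 + ‖x‖) ^ k₁) * (|C₂| * (1 + ‖x‖) ^ k₂) := by
            gcongr
            · exact hb0 i x
            · exact (h₁ x).trans (by gcongr; exact le_abs_self _)
            · exact (h₂ x).trans (by gcongr; exact le_abs_self _)
        _ = c i * |C₁| * |C₂| * (1 + ‖x‖) ^ (k₁ + k₂) := by rw [pow_add]; ring
        _ ≤ c i * |C₁| * |C₂| * (1 + ‖x‖) ^ (k₁ + k₂ + k) :=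
          mul_le_mul_of_nonneg_left (pow_le_pow_right₀ hx (by omega)) (by positivity)
    · calc _ ≤ C * (1 + ‖x‖) ^ k := hC x
        _ ≤ |C| * (1 + ‖x‖) ^ (k₁ + k₂ + k) := by
            gcongr
            · exact le_abs_self _
            · omega

/-- Real powers of a symbol with real part at least one have temperate growth. -/
theorem hasTemperateGrowth_cpow_real (hz : z.HasTemperateGrowth) (h1 : ∀ x, 1 ≤ (z x).re) (γ : ℝ) :
    (fun x => z x ^ (γ : ℂ)).HasTemperateGrowth := by
  refine ⟨contDiff_cpow_real hz.1 h1 γ, fun N => ?_⟩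
  induction N using Nat.strong_induction_on generalizing γ with
  | _ N ih =>
    cases N with
    | zero => simpa using exists_norm_cpow_real_le hz h1 γ
    | succ N =>
      have hz' : ContDiff ℝ ∞ fun x => γ • fderiv ℝ z x :=
        (hz.1.fderiv_right (m := ∞) (by simp)).const_smul γ
      obtain ⟨k, C, hC⟩ := exists_sum_mul_le (Finset.range (N + 1))
        (fun i x => ‖iteratedFDeriv ℝ i (fun x => z x ^ ((γ - 1 : ℝ) : ℂ)) x‖)
        (fun i x => ‖iteratedFDeriv ℝ (N - i) (fun x => γ • fderiv ℝ z x) x‖)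
        (fun i => N.choose i) (fun i x => norm_nonneg _)
        (fun i hi => ih i (Finset.mem_range.1 hi) (γ - 1)) (fun i _ => by
          obtain ⟨k, C, hC⟩ := hz.2 (N - i + 1)
          refine ⟨k, |γ| * C, fun x => ?_⟩
          have h2 : iteratedFDeriv ℝ (N - i) (fun x => γ • fderiv ℝ z x) x =
              γ • iteratedFDeriv ℝ (N - i) (fderiv ℝ z) x :=
            iteratedFDeriv_const_smul_apply'
              (contDiff_infty.1 (hz.1.fderiv_right (m := ∞) (by simp)) (N - i)).contDiffAt
          rw [h2, norm_smul, norm_iteratedFDeriv_fderiv, Real.norm_eq_abs, mul_assoc]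
          gcongr
          exact hC x)
      refine ⟨k, C, fun x => ?_⟩
      rw [← norm_iteratedFDeriv_fderiv, fderiv_cpow_real hz.1 h1]
      exact (norm_iteratedFDeriv_smul_le (contDiff_cpow_real hz.1 h1 (γ - 1)) hz' x
        (by exact_mod_cast le_top)).trans (hC x)

end Cpow

lemma hasTemperateGrowth_heatSym {n : ℕ} : (heatSym : Rn1 n → ℂ).HasTemperateGrowth := by
  have h0 : Function.HasTemperateGrowth fun q : Rn1 n => q.1 :=
    (ContinuousLinearMap.fst ℝ (Rn n) ℝ).hasTemperateGrowth
  have h1 : Function.HasTemperateGrowth fun q : Rn1 n => ((‖q.1‖ ^ 2 : ℝ) : ℂ) :=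
    Function.Complex.hasTemperateGrowth_ofReal.comp
      ((Function.hasTemperateGrowth_norm_sq (Rn n)).comp h0)
  have h2 : Function.HasTemperateGrowth fun q : Rn1 n => ((q.2 : ℝ) : ℂ) :=
    Function.Complex.hasTemperateGrowth_ofReal.comp
      (ContinuousLinearMap.snd ℝ (Rn n) ℝ).hasTemperateGrowth
  have h5 : (heatSym : Rn1 n → ℂ) =
      fun q => 4 * (π : ℂ) ^ 2 * ((‖q.1‖ ^ 2 : ℝ) : ℂ) + Complex.I * (q.2 : ℂ) := by
    ext q
    rw [heatSym, Complex.ofReal_pow]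
  rw [h5]
  exact ((Function.HasTemperateGrowth.const (4 * (π : ℂ) ^ 2)).mul h1).add
    ((Function.HasTemperateGrowth.const Complex.I).mul h2)

lemma one_le_re_one_add_heatSym {n : ℕ} (q : Rn1 n) : 1 ≤ (1 + heatSym q).re := by
  rw [Complex.add_re, Complex.one_re, heatSym_re]
  have : 0 ≤ 4 * π ^ 2 * ‖q.1‖ ^ 2 := by positivity
  linarith

lemma mSym_eq {n : ℕ} (β : ℝ) (q : Rn1 n) : mSym β q = (1 + heatSym q) ^ ((β / 2 : ℝ) : ℂ) := by
  rw [mSym, heatSym, ← add_assoc]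
  push_cast
  rfl

lemma hasTemperateGrowth_mSym {n : ℕ} (β : ℝ) : (mSym β : Rn1 n → ℂ).HasTemperateGrowth := by
  rw [show (mSym β : Rn1 n → ℂ) = _ from funext (mSym_eq β)]
  exact hasTemperateGrowth_cpow_real
    ((Function.HasTemperateGrowth.const 1).add hasTemperateGrowth_heatSym)
    one_le_re_one_add_heatSym _

lemma mSym_eq_sub_two {n : ℕ} (α : ℝ) (q : Rn1 n) :
    mSym α q = mSym (α - 2) q * (1 + heatSym q) := by
  have hne : 1 + heatSym q ≠ 0 := fun h => by
    have := one_le_re_one_add_heatSym q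
    rw [h, Complex.zero_re] at this
    linarith
  rw [mSym_eq, mSym_eq, show ((α / 2 : ℝ) : ℂ) = (((α - 2) / 2 : ℝ) : ℂ) + 1 by push_cast; ring,
    Complex.cpow_add _ _ hne, Complex.cpow_one]

/-- The Fourier multiplier `m_β` as a map of Schwartz functions. -/
def sMOp {n : ℕ} (β : ℝ) (f : 𝓢(Rn1 n, ℂ)) : 𝓢(Rn1 n, ℂ) :=
  sIFT (SchwartzMap.smulLeftCLM ℂ (mSym β) (sFT f))

lemma sFT_sMOp {n : ℕ} (β : ℝ) (f : 𝓢(Rn1 n, ℂ)) (q : Rn1 n) :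
    sFT (sMOp β f) q = mSym β q * sFT f q := by
  rw [sMOp, sFT_sIFT, SchwartzMap.smulLeftCLM_apply_apply (hasTemperateGrowth_mSym β), smul_eq_mul]

lemma coe_sMOp {n : ℕ} (β : ℝ) (f : 𝓢(Rn1 n, ℂ)) : ⇑(sMOp β f) = MOp (mSym β) f := by
  rw [sMOp, coe_sIFT, MOp, ← coe_sFT]
  congr 1
  ext q
  rw [SchwartzMap.smulLeftCLM_apply_apply (hasTemperateGrowth_mSym β), smul_eq_mul]

lemma sFT_ext {n : ℕ} {f g : 𝓢(Rn1 n, ℂ)} (h : ∀ q, sFT f q = sFT g q) : f = g := by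
  rw [← sIFT_sFT f, ← sIFT_sFT g, SchwartzMap.ext h]

lemma sMOp_sdX {n : ℕ} (β : ℝ) (k : Fin n) (f : 𝓢(Rn1 n, ℂ)) :
    sMOp β (sdX k f) = sdX k (sMOp β f) :=
  sFT_ext fun q => by rw [sFT_sMOp, sFT_sdX, sFT_sdX, sFT_sMOp]; ring

lemma sMOp_sdT {n : ℕ} (β : ℝ) (f : 𝓢(Rn1 n, ℂ)) : sMOp β (sdT f) = sdT (sMOp β f) :=
  sFT_ext fun q => by rw [sFT_sMOp, sFT_sdT, sFT_sdT, sFT_sMOp]; ring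

/-- The heat operator `-Δ_X + (2π)⁻¹ ∂_t` as a map of Schwartz functions. -/
def heatOp {n : ℕ} (u : 𝓢(Rn1 n, ℂ)) : 𝓢(Rn1 n, ℂ) :=
  (-1 : ℂ) • ∑ k, sdX k (sdX k u) + (2 * π : ℂ)⁻¹ • sdT u

lemma heatOp_apply {n : ℕ} (u : 𝓢(Rn1 n, ℂ)) (x : Rn1 n) :
    heatOp u x = -∑ k, sdX k (sdX k u) x + (2 * π : ℂ)⁻¹ * sdT u x := by
  simp [heatOp]

lemma sFT_heatOp {n : ℕ} (u : 𝓢(Rn1 n, ℂ)) (q : Rn1 n) :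
    sFT (heatOp u) q = heatSym q * sFT u q := by
  have hpc : (π : ℂ) ≠ 0 := Complex.ofReal_ne_zero.2 Real.pi_ne_zero
  have hn : (‖q.1‖ : ℂ) ^ 2 = ∑ k, (q.1 k : ℂ) ^ 2 := by
    rw [← Complex.ofReal_pow, EuclideanSpace.norm_sq_eq]
    simp
  rw [heatOp, sFT_add, sFT_smul, sFT_smul, sFT_sum, heatSym, hn]
  simp only [add_apply, smul_apply, sum_apply, smul_eq_mul, sFT_sdX, sFT_sdT, add_mul,
    Finset.mul_sum, Finset.sum_mul]
  congr 1
  · refine Finset.sum_congr rfl fun k _ => ?_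
    linear_combination (-4 * (π : ℂ) ^ 2 * (q.1 k : ℂ) ^ 2 * sFT u q) * Complex.I_sq
  · field_simp

lemma sMOp_eq_add_heatOp {n : ℕ} (α : ℝ) (f : 𝓢(Rn1 n, ℂ)) :
    sMOp α f = sMOp (α - 2) f + heatOp (sMOp (α - 2) f) :=
  sFT_ext fun q => by
    rw [sFT_add, add_apply, sFT_heatOp, sFT_sMOp, sFT_sMOp, mSym_eq_sub_two]
    ring

lemma coe_add_heatOp {n : ℕ} (u : 𝓢(Rn1 n, ℂ)) : ⇑(u + heatOp u) = resolventOp u := by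
  ext x
  rw [add_apply, heatOp_apply, resolventOp]
  ring

lemma exists_eLpNorm_sdX_sdX_le (n : ℕ) (k l : Fin n) {p : ℝ} (hp : 1 < p) :
    ∃ C : ℝ≥0∞, C ≠ ⊤ ∧ ∀ u : 𝓢(Rn1 n, ℂ),
      pNorm p (sdX k (sdX l u)) ≤ C * pNorm p (heatOp u) := by
  obtain ⟨C, hC, h⟩ := exists_lintegral_sdX_sdX_le n k l hp
  have hp0 : 0 < p := by linarith
  refine ⟨C ^ (1 / p), ENNReal.rpow_ne_top_of_nonneg (by positivity) hC, fun u => ?_⟩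
  have key : ∀ f : Rn1 n → ℂ, pNorm p f = (∫⁻ x, ‖f x‖ₑ ^ p) ^ (1 / p) := fun f => by
    rw [pNorm, eLpNorm_eq_lintegral_rpow_enorm_toReal (by simpa using hp0) ENNReal.ofReal_ne_top,
      ENNReal.toReal_ofReal hp0.le]
  rw [key, key, ← ENNReal.mul_rpow_of_nonneg _ _ (by positivity)]
  gcongr
  exact h u _ (sFT_heatOp u)

lemma pNorm_add_le {n : ℕ} {p : ℝ} (hp : 1 < p) (f g : 𝓢(Rn1 n, ℂ)) :
    pNorm p ⇑(f + g) ≤ pNorm p f + pNorm p g :=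
  eLpNorm_add_le f.continuous.aestronglyMeasurable g.continuous.aestronglyMeasurable
    (by simpa using hp.le)

lemma pNorm_sum_le {n : ℕ} {ι : Type*} {p : ℝ} (hp : 1 < p) (s : Finset ι)
    (f : ι → 𝓢(Rn1 n, ℂ)) : pNorm p ⇑(∑ i ∈ s, f i) ≤ ∑ i ∈ s, pNorm p (f i) := by
  classical
  induction s using Finset.induction_on with
  | empty => simp [pNorm]
  | insert i s hi ih =>
    rw [Finset.sum_insert hi, Finset.sum_insert hi]
    exact (pNorm_add_le hp _ _).trans (by gcongr)

lemma pNorm_smul {n : ℕ} {p : ℝ} (c : ℂ) (f : 𝓢(Rn1 n, ℂ)) :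
    pNorm p ⇑(c • f) = ‖c‖ₑ * pNorm p f :=
  eLpNorm_const_smul c f _ volume

lemma pNorm_heatOp_le {n : ℕ} {p : ℝ} (hp : 1 < p) (u : 𝓢(Rn1 n, ℂ)) :
    pNorm p (heatOp u) ≤ ∑ k, pNorm p (sdX k (sdX k u)) + pNorm p (sdT u) := by
  refine (pNorm_add_le hp _ _).trans ?_
  have hc : ‖(2 * π : ℂ)⁻¹‖ₑ ≤ 1 := by
    rw [← ofReal_norm, show (2 * π : ℂ)⁻¹ = (((2 * π)⁻¹ : ℝ) : ℂ) by push_cast; ring,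
      Complex.norm_real, Real.norm_of_nonneg (by positivity)]
    exact ENNReal.ofReal_le_one.2 (inv_le_one_of_one_le₀ (by linarith [Real.two_le_pi]))
  rw [pNorm_smul, pNorm_smul, enorm_neg, enorm_one, one_mul]
  exact add_le_add (pNorm_sum_le hp _ _) (mul_le_of_le_one_left' hc)

lemma pNorm_le_pNorm_add_heatOp {n : ℕ} {p : ℝ} (hp : 1 < p) (u : 𝓢(Rn1 n, ℂ)) :
    pNorm p u ≤ pNorm p ⇑(u + heatOp u) := by
  rw [coe_add_heatOp]
  exact eLpNorm_le_resolventOp (by simpa using hp.le) u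

lemma pNorm_heatOp_le_two_mul {n : ℕ} {p : ℝ} (hp : 1 < p) (u : 𝓢(Rn1 n, ℂ)) :
    pNorm p (heatOp u) ≤ 2 * pNorm p ⇑(u + heatOp u) := by
  calc pNorm p (heatOp u) = pNorm p ⇑((u + heatOp u) + (-1 : ℂ) • u) := by
        congr 2; module
    _ ≤ pNorm p ⇑(u + heatOp u) + pNorm p ⇑((-1 : ℂ) • u) := pNorm_add_le hp _ _
    _ ≤ pNorm p ⇑(u + heatOp u) + pNorm p ⇑(u + heatOp u) := by
        rw [pNorm_smul, enorm_neg, enorm_one, one_mul]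
        gcongr
        exact pNorm_le_pNorm_add_heatOp hp u
    _ = _ := (two_mul _).symm

lemma pNorm_sdT_le {n : ℕ} {p : ℝ} (hp : 1 < p) (u : 𝓢(Rn1 n, ℂ)) :
    pNorm p (sdT u) ≤
      ENNReal.ofReal (2 * π) * (pNorm p (heatOp u) + ∑ k, pNorm p (sdX k (sdX k u))) := by
  have hpc : (2 * π : ℂ) ≠ 0 := by simp
  have he : sdT u = ((2 * π : ℝ) : ℂ) • (heatOp u + ∑ k, sdX k (sdX k u)) := by
    ext x
    rw [smul_apply, add_apply, heatOp_apply, sum_apply]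
    push_cast
    rw [smul_eq_mul]
    field_simp
    ring
  have hc : ‖((2 * π : ℝ) : ℂ)‖ₑ = ENNReal.ofReal (2 * π) := by
    rw [← ofReal_norm, Complex.norm_real, Real.norm_of_nonneg (by positivity)]
  calc pNorm p (sdT u) = ENNReal.ofReal (2 * π) *
        pNorm p ⇑(heatOp u + ∑ k, sdX k (sdX k u)) := by rw [he, pNorm_smul, hc]
    _ ≤ _ := by
        gcongr
        exact (pNorm_add_le hp _ _).trans (by gcongr; exact pNorm_sum_le hp _ _)

/-- The upper bound in terms of the heat operator. -/
theorem exists_sobolev_le (n : ℕ) {p : ℝ} (hp : 1 < p) :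
    ∃ C : ℝ, 0 < C ∧ ∀ u : 𝓢(Rn1 n, ℂ),
      pNorm p u + ∑ k, ∑ l, pNorm p (sdX k (sdX l u)) + pNorm p (sdT u) ≤
        ENNReal.ofReal C * pNorm p ⇑(u + heatOp u) := by
  choose K hK hb using fun k l => exists_eLpNorm_sdX_sdX_le n k l hp
  set D : ℝ≥0∞ := 1 + ∑ k, ∑ l, K k l * 2 + ENNReal.ofReal (2 * π) * (2 + ∑ k, K k k * 2) with hD
  have hs : ∀ s : Finset (Fin n), ∀ g : Fin n → ℝ≥0∞, (∀ k, g k ≠ ⊤) → ∑ k ∈ s, g k ≠ ⊤ :=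
    fun s g hg => ENNReal.sum_ne_top.2 fun k _ => hg k
  have hK2 : ∀ k l, K k l * 2 ≠ ⊤ := fun k l => ENNReal.mul_ne_top (hK k l) ENNReal.ofNat_ne_top
  have hDt : D ≠ ⊤ := by
    refine ENNReal.add_ne_top.2 ⟨ENNReal.add_ne_top.2 ⟨ENNReal.one_ne_top,
      hs _ _ fun k => hs _ _ fun l => hK2 k l⟩, ENNReal.mul_ne_top ENNReal.ofReal_ne_top
        (ENNReal.add_ne_top.2 ⟨ENNReal.ofNat_ne_top, hs _ _ fun k => hK2 k k⟩)⟩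
  have hD0 : D ≠ 0 := by simp [hD]
  refine ⟨D.toReal, ENNReal.toReal_pos hD0 hDt, fun u => ?_⟩
  rw [ENNReal.ofReal_toReal hDt]
  have h2 := pNorm_heatOp_le_two_mul hp u
  have hkl : ∀ k l, pNorm p (sdX k (sdX l u)) ≤ K k l * 2 * pNorm p ⇑(u + heatOp u) :=
    fun k l => (hb k l u).trans (by rw [mul_assoc]; gcongr)
  rw [hD, add_mul, add_mul, one_mul, mul_assoc, add_mul, Finset.sum_mul, Finset.sum_mul]
  refine add_le_add (add_le_add (pNorm_le_pNorm_add_heatOp hp u) ?_) ?_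
  · refine Finset.sum_le_sum fun k _ => ?_
    rw [Finset.sum_mul]
    exact Finset.sum_le_sum fun l _ => hkl k l
  · refine (pNorm_sdT_le hp u).trans ?_
    gcongr
    exact hkl _ _

end ParabolicMultipliers

/-- Second-order parabolic Sobolev equivalence
`‖f‖_{𝓛^p_α} ≈ ‖f‖_{𝓛^p_{α−2}} + Σ_{k,l}‖D_{X_k}D_{X_l}f‖_{𝓛^p_{α−2}} + ‖D_t f‖_{𝓛^p_{α−2}}`. -/
theorem stmt1 (n : ℕ) (hn : 1 ≤ n) (p : ℝ) (hp : 1 < p) (α : ℝ) :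
    ∃ c C : ℝ, 0 < c ∧ 0 < C ∧
      ∀ f : SchwartzMap (Rn1 n) ℂ,
        ENNReal.ofReal c * pNorm p (MOp (mSym α) ⇑f) ≤
            pNorm p (MOp (mSym (α - 2)) ⇑f)
            + ∑ k : Fin n, ∑ l : Fin n, pNorm p (MOp (mSym (α - 2)) (dX k (dX l ⇑f)))
            + pNorm p (MOp (mSym (α - 2)) (dT ⇑f))
          ∧
          pNorm p (MOp (mSym (α - 2)) ⇑f)
            + ∑ k : Fin n, ∑ l : Fin n, pNorm p (MOp (mSym (α - 2)) (dX k (dX l ⇑f)))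
            + pNorm p (MOp (mSym (α - 2)) (dT ⇑f))
            ≤ ENNReal.ofReal C * pNorm p (MOp (mSym α) ⇑f) := by
  obtain ⟨C, hC, h⟩ := exists_sobolev_le n hp
  refine ⟨1, C, one_pos, hC, fun f => ?_⟩
  simp only [← coe_sdX, ← coe_sdT, ← coe_sMOp, sMOp_sdX, sMOp_sdT, sMOp_eq_add_heatOp α f]
  refine ⟨?_, h _⟩
  rw [ENNReal.ofReal_one, one_mul, add_assoc]
  refine (pNorm_add_le hp _ _).trans (add_le_add le_rfl ((pNorm_heatOp_le hp _).trans ?_))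
  gcongr with k
  exact Finset.single_le_sum (f := fun l => pNorm p (sdX k (sdX l (sMOp (α - 2) f))))
    (fun _ _ => zero_le) (Finset.mem_univ k)
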